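/- There exists an absolute constant C > 0 with the following property. Let N and K be positive integers with K ≥ 3, and suppose the interval [N, N+K] contains three distinct integers of the form a₁·x₁², a₂·x₂², a₃·x₃² with positive integers aᵢ, xᵢ for i = 1, 2, 3. Put H = max(a₁, a₂, a₃, 3). Then C·H²·(log H)³·(H·log H + log K)·(log H + log log K) > log N. -/

import Mathlib

open Real

section Determinants

variable {ι : Type*} [Fintype ι] [DecidableEq ι]

theorem abs_det_le_factorial_mul_prod (A : Matrix ι ι ℝ) (G : ι → ℝ)
    (h : ∀ r c, |A r c| ≤ G r) :
    |A.det| ≤ (Fintype.card ι).factorial * ∏ r, G r := by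
  rw [Matrix.det_apply, ← Fintype.card_perm, ← Finset.card_univ, ← nsmul_eq_mul,
    ← Finset.sum_const]
  refine (Finset.abs_sum_le_sum_abs _ _).trans (Finset.sum_le_sum fun σ _ => ?_)
  have h1 : |Equiv.Perm.sign σ • ∏ i, A (σ i) i| = ∏ i, |A (σ i) i| := by
    rw [← Finset.abs_prod]
    rcases Int.units_eq_one_or (Equiv.Perm.sign σ) with h | h <;> simp [h]
  rw [h1, ← Equiv.prod_comp σ G]
  exact Finset.prod_le_prod (fun _ _ => abs_nonneg _) fun i _ => h _ _

theorem abs_det_add_le (P R : Matrix ι ι ℝ) (p : ι → ℝ) (ε : ℝ) (hε : 0 ≤ ε) (hε1 : ε ≤ 1)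
    (hp : ∀ r c, |P r c| ≤ p r) (hR : ∀ r c, |R r c| ≤ ε * p r) (hp0 : ∀ r, 0 ≤ p r)
    (V : Submodule ℝ (ι → ℝ)) (d : ℕ) (hd : Module.finrank ℝ V ≤ d) (hV : ∀ r, P r ∈ V) :
    |(P + R).det| ≤ 2 ^ Fintype.card ι *
      ((Fintype.card ι).factorial * (∏ r, p r) * ε ^ (Fintype.card ι - d)) := by
  let Q : Finset ι → Matrix ι ι ℝ := fun s => Matrix.of fun r c => if r ∈ s then P r c else R r c
  have h0 : (P + R).det = ∑ s : Finset ι, (Q s).det := by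
    have := MultilinearMap.map_add_univ
      (Matrix.detRowAlternating (R := ℝ) (n := ι)).toMultilinearMap (fun r => P r) (fun r => R r)
    refine this.trans (Finset.sum_congr rfl fun s _ => ?_)
    change Matrix.det _ = _
    congr 1
    ext r c
    by_cases hr : r ∈ s <;> simp [Q, hr, Finset.piecewise]
  have hpp : 0 ≤ ∏ r, p r := Finset.prod_nonneg fun r _ => hp0 r
  rw [h0]
  refine (Finset.abs_sum_le_sum_abs _ _).trans ?_
  have h2 : ∑ s : Finset ι, |(Q s).det| ≤ ∑ _s : Finset ι,
      ((Fintype.card ι).factorial * (∏ r, p r) * ε ^ (Fintype.card ι - d) : ℝ) := by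
    refine Finset.sum_le_sum fun s _ => ?_
    by_cases hs : s.card ≤ d
    · have h3 := abs_det_le_factorial_mul_prod (Q s)
        (fun r => (if r ∈ s then 1 else ε) * p r) (fun r c => by
          by_cases hr : r ∈ s
          · simpa [Q, hr] using hp r c
          · simpa [Q, hr] using hR r c)
      refine h3.trans ?_
      rw [Finset.prod_mul_distrib, Finset.prod_ite, mul_assoc]
      have h4 : (Finset.univ.filter fun r => r ∉ s).card = Fintype.card ι - s.card := by
        rw [← Finset.card_compl]; congr 1; ext; simp
      simp only [Finset.prod_const_one, Finset.prod_const, one_mul, h4]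
      rw [mul_comm (ε ^ _)]
      have h5 : ε ^ (Fintype.card ι - s.card) ≤ ε ^ (Fintype.card ι - d) :=
        pow_le_pow_of_le_one hε hε1 (by omega)
      rw [mul_assoc]
      exact mul_le_mul_of_nonneg_left (mul_le_mul_of_nonneg_left h5 hpp) (Nat.cast_nonneg _)
    · have h6 : (Q s).det = 0 := by
        by_contra hne
        have h7 : IsUnit (Q s) := by
          rw [Matrix.isUnit_iff_isUnit_det]; exact isUnit_iff_ne_zero.2 hne
        have h8 := Matrix.linearIndependent_rows_iff_isUnit.2 h7
        have h9 : LinearIndependent ℝ (fun r : s => (⟨P r, hV r⟩ : V)) := by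
          have h10 := h8.comp (fun r : s => (r : ι)) Subtype.val_injective
          refine LinearIndependent.of_comp V.subtype ?_
          have h11 : (V.subtype ∘ fun r : s => (⟨P r, hV r⟩ : V)) = (Q s).row ∘ fun r : s => (r : ι) := by
            funext r c
            have := r.2
            simp only [Function.comp, Matrix.row, Q, Matrix.of_apply, this, if_true,
              Submodule.subtype_apply]
          rw [h11]
          exact h10
        have := h9.fintype_card_le_finrank
        simp at this
        omega
      rw [h6, abs_zero]
      positivity
  refine h2.trans (le_of_eq ?_)
  rw [Finset.sum_const, Finset.card_univ, Fintype.card_finset, nsmul_eq_mul]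
  push_cast; ring

theorem det_eq_one_of_triangular (M : Matrix ι ι ℝ) (f : ι → ℕ) (h1 : ∀ i, M i i = 1)
    (h : ∀ i j, i ≠ j → M i j ≠ 0 → f j < f i) : M.det = 1 := by
  rw [Matrix.det_apply, Finset.sum_eq_single 1]
  · simp [h1]
  · intro σ _ hσ
    have : ∏ i, M (σ i) i = 0 := by
      by_contra hne
      rw [Finset.prod_eq_zero_iff] at hne
      push Not at hne
      have hle : ∀ i, f i ≤ f (σ i) := fun i => by
        by_cases hi : σ i = i
        · rw [hi]
        · exact (h _ _ hi (hne i (Finset.mem_univ _))).le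
      have hlt : ∃ i, f i < f (σ i) := by
        obtain ⟨i, hi⟩ : ∃ i, σ i ≠ i := by
          by_contra hc
          push Not at hc
          exact hσ (Equiv.ext hc)
        exact ⟨i, h _ _ hi (hne i (Finset.mem_univ _))⟩
      obtain ⟨i, hi⟩ := hlt
      have h3 := Finset.sum_lt_sum (s := Finset.univ) (f := f) (g := fun i => f (σ i))
        (fun i _ => hle i) ⟨i, Finset.mem_univ _, hi⟩
      rw [Equiv.sum_comp σ f] at h3
      exact lt_irrefl _ h3
    rw [this, smul_zero]
  · simp

theorem exists_det_ne_zero_of_linearIndependent {C : Type*} [Fintype C] (F : ι → C → ℝ)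
    (hF : LinearIndependent ℝ F) :
    ∃ c : ι → C, Matrix.det (Matrix.of fun i j => F i (c j)) ≠ 0 := by
  classical
  have hspan : Submodule.span ℝ (Set.range fun c => fun i => F i c) = ⊤ := by
    have h1 : (Matrix.of F).rank = Fintype.card ι := LinearIndependent.rank_matrix (M := Matrix.of F) hF
    rw [Matrix.rank_eq_finrank_span_cols] at h1
    refine Submodule.eq_top_of_finrank_eq ?_
    rw [Module.finrank_pi]
    exact h1
  obtain ⟨κ, a, ha, hs, hli⟩ := exists_linearIndependent' ℝ (fun c => fun i => F i c)
  rw [hspan] at hs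
  have hfin : Finite κ := Finite.of_injective a ha
  have := Fintype.ofFinite κ
  let b := Module.Basis.mk hli hs.ge
  have hcard : Fintype.card κ = Fintype.card ι := by
    rw [← Module.finrank_eq_card_basis b, Module.finrank_pi]
  let eq := Fintype.equivOfCardEq hcard
  refine ⟨fun j => a (eq.symm j), ?_⟩
  have h2 := hli.comp eq.symm eq.symm.injective
  have h3 := Matrix.linearIndependent_cols_iff_isUnit
    (A := Matrix.of fun i j => F i (a (eq.symm j))) |>.1 h2
  rw [Matrix.isUnit_iff_isUnit_det] at h3
  exact h3.ne_zero

end Determinants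

section Interpolation

theorem interpolation_det_bound {A : Type*} [CommRing A] (φ : Fin 4 → A →+* ℝ)
    (hφ : ∀ z, φ 0 z ≠ 0 → 1 ≤ |∏ k, φ k z|)
    {J C : Type*} [Fintype J] [DecidableEq J] [Fintype C] (S : ℕ)
    (e : J → C → ℤ) (g : J → C → ℝ) (M : Matrix J J ℝ) (hM : M.det = 1)
    (he : ∀ a c, (e a c : ℝ) = ∑ b, M a b * g b c)
    (w : C → A) (h : ℝ) (hh : 0 ≤ h) (hw : ∀ k c, |φ k (w c)| ≤ exp h)
    (B W : ℝ) (ω δ : C → ℝ) (hB : 1 ≤ B) (hw0 : ∀ c, φ 0 (w c) = B * exp (ω c + δ c))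
    (hBW : B * exp W ≤ exp h) (hω : ∀ c, |ω c| ≤ W)
    (ind : ∀ y : Fin S × J → ℝ,
      (∀ c, ∑ r, y r * (φ 0 (w c) ^ (r.1 : ℕ) * g r.2 c) = 0) → y = 0)
    (V : Submodule ℝ (C → ℝ)) (d k₀ : ℕ) (hd : Module.finrank ℝ V ≤ d)
    (hV : ∀ a, ∀ k < k₀, (fun c => g a c * ω c ^ k) ∈ V)
    (G : J → ℝ) (hG : ∀ a c, |g a c| ≤ G a) (hG0 : ∀ a, 0 ≤ G a)
    (ε : ℝ) (hε0 : 0 ≤ ε) (hε1 : ε ≤ 1)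
    (hε : ∀ s < S, ∀ c, |exp (s * (ω c + δ c)) -
      ∑ k ∈ Finset.range k₀, (s * ω c) ^ k / k.factorial| ≤ ε * exp (s * W)) :
    1 ≤ 2 ^ (S * Fintype.card J) * ((S * Fintype.card J).factorial : ℝ) ^ 4 *
      (exp (S * h) ^ (S * Fintype.card J) * (∏ a, G a) ^ S) ^ 4 *
      ε ^ (S * Fintype.card J - d) := by
  classical
  have hn : Fintype.card (Fin S × J) = S * Fintype.card J := by simp
  have hli : LinearIndependent ℝ
      (fun (r : Fin S × J) (c : C) => φ 0 (w c) ^ (r.1 : ℕ) * g r.2 c) := by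
    rw [Fintype.linearIndependent_iff]
    intro y hy
    have h1 := ind y fun c => by
      have := congrFun hy c
      simpa [Finset.sum_apply] using this
    intro i
    rw [h1]; rfl
  obtain ⟨c, hc⟩ := exists_det_ne_zero_of_linearIndependent _ hli
  let D : Matrix (Fin S × J) (Fin S × J) A := Matrix.of fun r j => w (c j) ^ (r.1 : ℕ) * (e r.2 (c j) : A)
  let E : Fin 4 → Matrix (Fin S × J) (Fin S × J) ℝ :=
    fun k => Matrix.of fun r j => φ k (w (c j)) ^ (r.1 : ℕ) * g r.2 (c j)
  have hDE : ∀ k, φ k D.det = (E k).det := by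
    intro k
    rw [RingHom.map_det]
    have h1 : (φ k).mapMatrix D =
        (Matrix.kroneckerMap (· * ·) (1 : Matrix (Fin S) (Fin S) ℝ) M) * E k := by
      ext r j
      rw [Matrix.mul_apply, Fintype.sum_prod_type, Finset.sum_eq_single r.1]
      · simp only [RingHom.mapMatrix_apply, Matrix.map_apply, D, E, Matrix.of_apply, map_mul,
          map_pow, map_intCast, he, Matrix.kroneckerMap_apply, Matrix.one_apply_eq, one_mul,
          Finset.mul_sum]
        exact Finset.sum_congr rfl fun _ _ => by ring
      · intro s _ hs
        refine Finset.sum_eq_zero fun b _ => ?_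
        simp [Matrix.kroneckerMap_apply, Matrix.one_apply_ne hs.symm]
      · simp
    rw [h1, Matrix.det_mul, Matrix.det_kronecker, hM]
    simp
  have h1 : 1 ≤ |∏ k, (E k).det| := by
    have := hφ D.det (by rw [hDE]; exact hc)
    simpa only [hDE] using this
  rw [Fin.prod_univ_four, abs_mul, abs_mul, abs_mul] at h1
  set p : Fin S × J → ℝ := fun r => exp (S * h) * G r.2 with hp
  have hsh : ∀ s : Fin S, exp h ^ (s : ℕ) ≤ exp (S * h) := fun s => by
    rw [← exp_nat_mul]
    have : ((s : ℕ) : ℝ) ≤ S := by exact_mod_cast s.2.le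
    gcongr
  have hprod : ∏ r, p r = exp (S * h) ^ (S * Fintype.card J) * (∏ a, G a) ^ S := by
    rw [hp, Finset.prod_mul_distrib, Finset.prod_const, Finset.card_univ, hn,
      Fintype.prod_prod_type]
    simp
  have hp0 : ∀ r, 0 ≤ p r := fun r => mul_nonneg (exp_pos _).le (hG0 _)
  have hother : ∀ k, |(E k).det| ≤ (S * Fintype.card J).factorial * ∏ r, p r := by
    intro k
    rw [← hn]
    refine abs_det_le_factorial_mul_prod _ _ fun r j => ?_
    simp only [E, Matrix.of_apply, abs_mul, abs_pow]
    refine mul_le_mul ((pow_le_pow_left₀ (abs_nonneg _) (hw k _) _).trans (hsh r.1)) (hG _ _)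
      (abs_nonneg _) (exp_pos _).le
  have hmain : |(E 0).det| ≤ 2 ^ (S * Fintype.card J) *
      ((S * Fintype.card J).factorial * (∏ r, p r) * ε ^ (S * Fintype.card J - d)) := by
    let t : Fin S × J → C → ℝ := fun r x => ∑ k ∈ Finset.range k₀, (r.1 * ω x) ^ k / k.factorial
    let P : Matrix (Fin S × J) (Fin S × J) ℝ :=
      Matrix.of fun r j => B ^ (r.1 : ℕ) * g r.2 (c j) * t r (c j)
    have hBp : ∀ s : Fin S, B ^ (s : ℕ) * exp (s * W) ≤ exp (S * h) := fun s => by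
      refine le_trans ?_ (hsh s)
      rw [exp_nat_mul, ← mul_pow]
      exact pow_le_pow_left₀ (by positivity) hBW _
    have ht : ∀ r x, |t r x| ≤ exp (r.1 * W) := by
      intro r x
      have hW : 0 ≤ W := (abs_nonneg _).trans (hω x)
      refine (Finset.abs_sum_le_sum_abs _ _).trans ?_
      refine le_trans (Finset.sum_le_sum fun k _ => ?_)
        (Real.sum_le_exp_of_nonneg (mul_nonneg (Nat.cast_nonneg (r.1 : ℕ)) hW) k₀)
      rw [abs_div, abs_pow, abs_mul, Nat.abs_cast, Nat.abs_cast]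
      gcongr
      exact hω x
    have hER : E 0 = P + (E 0 - P) := by abel
    rw [hER, ← hn]
    let res : (C → ℝ) →ₗ[ℝ] (Fin S × J → ℝ) := LinearMap.funLeft ℝ ℝ c
    refine abs_det_add_le P _ p ε hε0 hε1 (fun r j => ?_) (fun r j => ?_) hp0 (V.map res) d
      ((Submodule.finrank_map_le _ _).trans hd) fun r => ?_
    · simp only [P, Matrix.of_apply, abs_mul, abs_pow]
      rw [abs_of_nonneg (by linarith : (0 : ℝ) ≤ B), mul_right_comm, hp]
      refine mul_le_mul ?_ (hG _ _) (abs_nonneg _) (exp_pos _).le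
      exact (mul_le_mul_of_nonneg_left (ht _ _) (by positivity)).trans (hBp _)
    · have : (E 0 - P) r j = B ^ (r.1 : ℕ) * g r.2 (c j) *
          (exp (r.1 * (ω (c j) + δ (c j))) - t r (c j)) := by
        simp only [E, P, Matrix.sub_apply, Matrix.of_apply, hw0, exp_nat_mul, mul_pow]
        ring
      rw [this, abs_mul, abs_mul, abs_pow, abs_of_nonneg (by linarith : (0 : ℝ) ≤ B), hp]
      calc B ^ (r.1 : ℕ) * |g r.2 (c j)| * |exp (r.1 * (ω (c j) + δ (c j))) - t r (c j)|
          ≤ B ^ (r.1 : ℕ) * G r.2 * (ε * exp (r.1 * W)) := by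
            refine mul_le_mul (mul_le_mul_of_nonneg_left (hG _ _) (by positivity))
              (hε _ r.1.2 _) (abs_nonneg _) (mul_nonneg (by positivity) (hG0 _))
        _ = ε * (B ^ (r.1 : ℕ) * exp (r.1 * W) * G r.2) := by ring
        _ ≤ ε * (exp (S * h) * G r.2) := by
            exact mul_le_mul_of_nonneg_left (mul_le_mul_of_nonneg_right (hBp _) (hG0 _)) hε0
    · refine ⟨∑ k ∈ Finset.range k₀, (B ^ (r.1 : ℕ) * (r.1 : ℝ) ^ k / k.factorial) •
        (fun x => g r.2 x * ω x ^ k), ?_, ?_⟩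
      · exact V.sum_mem fun k hk => V.smul_mem _ (hV _ _ (Finset.mem_range.1 hk))
      · funext j
        simp only [res, LinearMap.funLeft_apply, P, t, Finset.sum_apply, Pi.smul_apply, smul_eq_mul,
          Matrix.of_apply, Finset.mul_sum]
        exact Finset.sum_congr rfl fun k _ => by rw [mul_pow]; ring
  have hP0 : 0 ≤ ∏ r, p r := Finset.prod_nonneg fun r _ => hp0 r
  have hF0 : (0 : ℝ) ≤ (S * Fintype.card J).factorial * ∏ r, p r := by positivity
  refine h1.trans ?_
  rw [← hprod]
  calc _ ≤ 2 ^ (S * Fintype.card J) *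
      ((S * Fintype.card J).factorial * (∏ r, p r) * ε ^ (S * Fintype.card J - d)) *
      ((S * Fintype.card J).factorial * ∏ r, p r) * ((S * Fintype.card J).factorial * ∏ r, p r) *
      ((S * Fintype.card J).factorial * ∏ r, p r) := by
        gcongr
        exacts [hother 1, hother 2, hother 3]
    _ = _ := by ring

theorem exp_sub_sum_le (q y : ℝ) (hq : 1 ≤ q) (hy : 0 ≤ y) (n : ℕ) :
    exp y - ∑ k ∈ Finset.range n, y ^ k / k.factorial ≤ exp (q * y) / q ^ n := by
  have hq0 : 0 < q := by linarith
  have hs := NormedSpace.expSeries_div_hasSum_exp (𝔸 := ℝ) y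
  have hsq := NormedSpace.expSeries_div_hasSum_exp (𝔸 := ℝ) (q * y)
  rw [← Real.exp_eq_exp_ℝ] at hs hsq
  rw [le_div_iff₀ (by positivity)]
  have h1 := (hasSum_nat_add_iff' n).2 hs
  have h2 := (hasSum_nat_add_iff' n).2 hsq
  have h3 := h1.mul_right (q ^ n)
  refine (hasSum_le (fun k => ?_) h3 h2).trans (sub_le_self _ ?_)
  · rw [mul_pow, mul_div_assoc, mul_comm]
    have : q ^ n ≤ q ^ (k + n) := pow_le_pow_right₀ hq (by omega)
    gcongr
  · exact Finset.sum_nonneg fun k _ => by positivity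

theorem abs_exp_sub_sum_le (x : ℝ) (n : ℕ) :
    |exp x - ∑ k ∈ Finset.range n, x ^ k / k.factorial| ≤
      exp |x| - ∑ k ∈ Finset.range n, |x| ^ k / k.factorial := by
  have := Complex.norm_exp_sub_sum_le_exp_norm_sub_sum (x : ℂ) n
  rw [Complex.norm_real, Real.norm_eq_abs] at this
  convert this using 1
  rw [← Real.norm_eq_abs, ← Complex.norm_real]
  push_cast
  rfl

theorem interpolation_contradiction {A : Type*} [CommRing A] (φ : Fin 4 → A →+* ℝ)
    (hφ : ∀ z, φ 0 z ≠ 0 → 1 ≤ |∏ k, φ k z|)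
    {J C : Type*} [Fintype J] [DecidableEq J] [Fintype C] (S q T : ℕ) (hq : 16 ≤ q) (hT : 1 ≤ T)
    (e : J → C → ℤ) (g : J → C → ℝ) (M : Matrix J J ℝ) (hM : M.det = 1)
    (he : ∀ a c, (e a c : ℝ) = ∑ b, M a b * g b c)
    (w : C → A) (h : ℝ) (hh : 0 ≤ h) (hw : ∀ k c, |φ k (w c)| ≤ exp h)
    (B W : ℝ) (ω δ : C → ℝ) (hB : 1 ≤ B) (hw0 : ∀ c, φ 0 (w c) = B * exp (ω c + δ c))
    (hBW : B * exp W ≤ exp h) (hW : 0 ≤ W) (hω : ∀ c, |ω c| ≤ W)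
    (ind : ∀ y : Fin S × J → ℝ,
      (∀ c, ∑ r, y r * (φ 0 (w c) ^ (r.1 : ℕ) * g r.2 c) = 0) → y = 0)
    (V : Submodule ℝ (C → ℝ)) (hd : 2 * Module.finrank ℝ V ≤ S * Fintype.card J)
    (hV : ∀ a, ∀ k < 64 * T, (fun c => g a c * ω c ^ k) ∈ V)
    (G : J → ℝ) (hG : ∀ a c, |g a c| ≤ G a) (hG0 : ∀ a, 0 ≤ G a)
    (hGT : ∏ a, G a ≤ ((q : ℝ) ^ (5 * T)) ^ Fintype.card J)
    (hn : 0 < S * Fintype.card J) (hnT : ((S * Fintype.card J : ℕ) : ℝ) ≤ exp T)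
    (hSh : S * h ≤ T) (hSW : q * (S * W) ≤ T)
    (hδ : ∀ c, 2 * S * |δ c| * (q : ℝ) ^ (64 * T) ≤ 1) : False := by
  have hq0 : (16 : ℝ) ≤ q := by exact_mod_cast hq
  have hS : (1 : ℝ) ≤ S := by
    have : 1 ≤ S := Nat.pos_of_mul_pos_right hn
    exact_mod_cast this
  have heT : exp (T : ℝ) ≤ 3 ^ T := by
    rw [← exp_one_pow]
    exact pow_le_pow_left₀ (exp_pos _).le exp_one_lt_three.le _
  set ε : ℝ := ((q : ℝ) ^ (48 * T))⁻¹ with hεd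
  have hε0 : 0 < ε := by positivity
  have hε1 : ε ≤ 1 := inv_le_one_of_one_le₀ (one_le_pow₀ (by linarith))
  have hε : ∀ s < S, ∀ c, |exp (s * (ω c + δ c)) -
      ∑ k ∈ Finset.range (64 * T), (s * ω c) ^ k / k.factorial| ≤ ε * exp (s * W) := by
    intro s hs c
    have hsS : (s : ℝ) ≤ S := by exact_mod_cast hs.le
    have hqi : 0 < ((q : ℝ) ^ (64 * T))⁻¹ := by positivity
    have hqi1 : ((q : ℝ) ^ (64 * T))⁻¹ ≤ 1 :=
      inv_le_one_of_one_le₀ (one_le_pow₀ (by linarith))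
    have h2 : 2 * (s * |δ c|) ≤ ((q : ℝ) ^ (64 * T))⁻¹ := by
      have h3 := hδ c
      rw [← le_div_iff₀ (by positivity), one_div] at h3
      have : s * |δ c| ≤ S * |δ c| := by gcongr
      linarith
    have habs : |(s : ℝ) * δ c| = s * |δ c| := by rw [abs_mul, Nat.abs_cast]
    have h3 : |exp (s * δ c) - 1| ≤ ((q : ℝ) ^ (64 * T))⁻¹ := by
      refine (Real.abs_exp_sub_one_le ?_).trans ?_ <;> rw [habs]
      · nlinarith [abs_nonneg (δ c)]
      · exact h2
    have h4 : exp (s * ω c) ≤ exp (s * W) := by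
      have := (le_abs_self _).trans (hω c)
      gcongr
    have h5 : |exp (s * ω c) - ∑ k ∈ Finset.range (64 * T), (s * ω c) ^ k / k.factorial| ≤
        exp T * ((q : ℝ) ^ (64 * T))⁻¹ := by
      refine (abs_exp_sub_sum_le _ _).trans ((exp_sub_sum_le q _ (by linarith) (abs_nonneg _) _).trans ?_)
      rw [div_eq_mul_inv]
      gcongr
      refine le_trans ?_ hSW
      rw [abs_mul, Nat.abs_cast]
      have := hω c
      gcongr
    have h6 : (1 : ℝ) ≤ exp (s * W) := one_le_exp (by positivity)
    have h7 : exp (s * (ω c + δ c)) = exp (s * ω c) * (exp (s * δ c) - 1) + exp (s * ω c) := by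
      rw [mul_add, exp_add]; ring
    rw [h7, add_sub_assoc]
    refine (abs_add_le _ _).trans ?_
    rw [abs_mul, abs_of_pos (exp_pos _)]
    have h8 : exp (s * ω c) * |exp (s * δ c) - 1| ≤ exp (s * W) * ((q : ℝ) ^ (64 * T))⁻¹ := by
      gcongr
    have h9 : (1 + exp T) * ((q : ℝ) ^ (64 * T))⁻¹ ≤ ε := by
      rw [hεd, show 64 * T = 48 * T + 16 * T by ring, pow_add, mul_inv, mul_comm, mul_assoc]
      refine mul_le_of_le_one_right hε0.le ?_
      rw [inv_mul_le_iff₀ (by positivity), mul_one]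
      calc (1 : ℝ) + exp T ≤ 3 ^ T + 3 ^ T := add_le_add (one_le_pow₀ (by norm_num)) heT
        _ = 2 ^ 1 * 3 ^ T := by ring
        _ ≤ 2 ^ T * 3 ^ T := by gcongr; norm_num
        _ = 6 ^ T := by rw [← mul_pow]; norm_num
        _ ≤ (q ^ 16) ^ T := by
            gcongr
            calc (6 : ℝ) ≤ q := by linarith
              _ ≤ q ^ 16 := le_self_pow₀ (by linarith) (by norm_num)
        _ = _ := by rw [pow_mul]
    have h10 : exp T * ((q : ℝ) ^ (64 * T))⁻¹ ≤ exp (s * W) * (exp T * ((q : ℝ) ^ (64 * T))⁻¹) :=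
      le_mul_of_one_le_left (by positivity) h6
    calc _ ≤ exp (s * W) * ((1 + exp T) * ((q : ℝ) ^ (64 * T))⁻¹) := by linarith
      _ ≤ exp (s * W) * ε := by gcongr
      _ = _ := mul_comm _ _
  have key := interpolation_det_bound φ hφ S e g M hM he w h hh hw B W ω δ hB hw0 hBW hω ind V _
    (64 * T) le_rfl hV G hG hG0 ε hε0.le hε1 hε
  set n := S * Fintype.card J with hnd
  have hd' : n ≤ 2 * (n - Module.finrank ℝ V) := by omega
  have hfact : ((n.factorial : ℕ) : ℝ) ≤ (3 ^ T) ^ n := by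
    calc ((n.factorial : ℕ) : ℝ) ≤ (n : ℝ) ^ n := by exact_mod_cast Nat.factorial_le_pow n
      _ ≤ _ := by gcongr; exact hnT.trans heT
  have hexp : exp (S * h) ^ n ≤ (3 ^ T) ^ n := by
    gcongr
    exact (exp_le_exp.2 hSh).trans heT
  have hprod : (∏ a, G a) ^ S ≤ ((q : ℝ) ^ (5 * T)) ^ n := by
    have h0 : 0 ≤ ∏ a, G a := Finset.prod_nonneg fun a _ => hG0 a
    calc (∏ a, G a) ^ S ≤ (((q : ℝ) ^ (5 * T)) ^ Fintype.card J) ^ S := by gcongr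
      _ = _ := by rw [← pow_mul, ← pow_mul, ← pow_mul, hnd]; ring_nf
  have hGS : 0 ≤ (∏ a, G a) ^ S := pow_nonneg (Finset.prod_nonneg fun a _ => hG0 a) _
  have hX : 1 ≤ (2 * (3 ^ T) ^ 8 * ((q : ℝ) ^ (5 * T)) ^ 4) ^ n *
      ε ^ (n - Module.finrank ℝ V) := by
    refine key.trans ?_
    calc _ ≤ 2 ^ n * ((3 ^ T) ^ n) ^ 4 * ((3 ^ T) ^ n * ((q : ℝ) ^ (5 * T)) ^ n) ^ 4 *
          ε ^ (n - Module.finrank ℝ V) := by gcongr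
      _ = _ := by
        congr 1
        simp only [mul_pow, ← pow_mul]
        ring
  have hX2 : 1 ≤ ((2 * (3 ^ T) ^ 8 * ((q : ℝ) ^ (5 * T)) ^ 4) ^ 2 * ε) ^ n := by
    have hZ : 0 ≤ 2 * (3 ^ T) ^ 8 * ((q : ℝ) ^ (5 * T)) ^ 4 := by positivity
    generalize 2 * (3 ^ T) ^ 8 * ((q : ℝ) ^ (5 * T)) ^ 4 = Z at hX hZ
    calc (1 : ℝ) ≤ (Z ^ n * ε ^ (n - Module.finrank ℝ V)) ^ 2 := one_le_pow₀ hX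
      _ = (Z ^ 2) ^ n * ε ^ (2 * (n - Module.finrank ℝ V)) := by
            rw [mul_pow, pow_mul' ε, ← pow_mul Z, ← pow_mul Z, mul_comm n 2]
      _ ≤ (Z ^ 2) ^ n * ε ^ n :=
          mul_le_mul_of_nonneg_left (pow_le_pow_of_le_one hε0.le hε1 hd') (by positivity)
      _ = _ := by rw [mul_pow (Z ^ 2)]
  have hlt : (2 * (3 ^ T) ^ 8 * ((q : ℝ) ^ (5 * T)) ^ 4) ^ 2 * ε < 1 := by
    rw [hεd, ← div_eq_mul_inv, div_lt_one (by positivity)]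
    calc _ = 4 * (3 ^ 16) ^ T * (q : ℝ) ^ (40 * T) := by
          simp only [mul_pow, ← pow_mul]; ring_nf
      _ ≤ 4 ^ T * (3 ^ 16) ^ T * (q : ℝ) ^ (40 * T) := by
          gcongr
          exact le_self_pow₀ (by norm_num) (by omega)
      _ < (16 ^ 8) ^ T * (q : ℝ) ^ (40 * T) := by
          gcongr ?_ * _
          rw [← mul_pow]
          exact pow_lt_pow_left₀ (by norm_num) (by norm_num) (by omega)
      _ ≤ (q ^ 8) ^ T * (q : ℝ) ^ (40 * T) := by gcongr
      _ = _ := by rw [← pow_mul, ← pow_add]; ring_nf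
  exact absurd hX2 (not_le.2 (pow_lt_one₀ (by positivity) hlt hn.ne'))

end Interpolation

section ChangeOfBasis

theorem intCast_choose_eq_sum (i : ℕ) (u : ℤ) :
    ((Ring.choose u i : ℤ) : ℝ) = ∑ b ∈ Finset.range (i + 1),
      (((descPochhammer ℤ i).coeff b * b.factorial : ℝ) / i.factorial) *
        ((u : ℝ) ^ b / b.factorial) := by
  have h := Ring.descPochhammer_eq_factorial_smul_choose u i
  have h2 : (descPochhammer ℤ i).smeval u =
      ∑ b ∈ Finset.range (i + 1), (descPochhammer ℤ i).coeff b * u ^ b := by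
    rw [← Polynomial.eval_eq_smeval, Polynomial.eval_eq_sum_range, descPochhammer_natDegree]
  rw [h2] at h
  have h3 : (∑ b ∈ Finset.range (i + 1), ((descPochhammer ℤ i).coeff b : ℝ) * (u : ℝ) ^ b) =
      i.factorial * ((Ring.choose u i : ℤ) : ℝ) := by
    have := congrArg (Int.cast : ℤ → ℝ) h
    push_cast at this
    rw [this, nsmul_eq_mul]
    push_cast
    rfl
  have hi : (i.factorial : ℝ) ≠ 0 := by exact_mod_cast i.factorial_ne_zero
  rw [← mul_right_inj' hi, ← h3, Finset.mul_sum]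
  refine Finset.sum_congr rfl fun b _ => ?_
  have hb : (b.factorial : ℝ) ≠ 0 := by exact_mod_cast b.factorial_ne_zero
  field_simp

theorem exists_chooseMatrix : ∃ m : ℕ → ℕ → ℝ, (∀ i, m i i = 1) ∧ (∀ i b, i < b → m i b = 0) ∧
    ∀ i (u : ℤ), ((Ring.choose u i : ℤ) : ℝ) = ∑ b ∈ Finset.range (i + 1),
      m i b * ((u : ℝ) ^ b / b.factorial) := by
  refine ⟨fun i b => ((descPochhammer ℤ i).coeff b * b.factorial : ℝ) / i.factorial,
    fun i => ?_, fun i b hb => ?_, fun i u => intCast_choose_eq_sum i u⟩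
  · have hi : (i.factorial : ℝ) ≠ 0 := by exact_mod_cast i.factorial_ne_zero
    have : (descPochhammer ℤ i).coeff i = 1 := by
      have := monic_descPochhammer ℤ i
      rwa [Polynomial.Monic, Polynomial.leadingCoeff, descPochhammer_natDegree] at this
    simp [this, hi]
  · have : (descPochhammer ℤ i).coeff b = 0 :=
      Polynomial.coeff_eq_zero_of_natDegree_lt (by rwa [descPochhammer_natDegree])
    simp [this]

/-- Exponent pairs of total degree less than `T`. -/
def lowDegree (T : ℕ) : Finset (ℕ × ℕ) :=
  (Finset.range T ×ˢ Finset.range T).filter fun p => p.1 + p.2 < T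

theorem mem_lowDegree {T : ℕ} {p : ℕ × ℕ} : p ∈ lowDegree T ↔ p.1 + p.2 < T := by
  simp only [lowDegree, Finset.mem_filter, Finset.mem_product, Finset.mem_range]
  omega

theorem card_lowDegree (T : ℕ) : 2 * (lowDegree T).card = T * (T + 1) := by
  have h : lowDegree T = (Finset.range T).biUnion fun k => Finset.HasAntidiagonal.antidiagonal k := by
    ext p
    simp [mem_lowDegree]
  rw [h, Finset.card_biUnion]
  · simp only [Finset.Nat.card_antidiagonal]
    have := Finset.sum_range_id_mul_two T
    rw [Finset.sum_add_distrib, Finset.sum_const, Finset.card_range]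
    rcases T with _ | T
    · simp
    · simp only [Nat.add_sub_cancel, smul_eq_mul, mul_one] at *
      nlinarith
  · intro a _ b _ hab
    rw [Function.onFun, Finset.disjoint_left]
    intro p hp hp'
    rw [Finset.HasAntidiagonal.mem_antidiagonal] at hp hp'
    omega

theorem sum_lowDegree_swap (T : ℕ) :
    ∑ p ∈ lowDegree T, p.1 = ∑ p ∈ lowDegree T, p.2 := by
  refine Finset.sum_bij' (fun p _ => p.swap) (fun p _ => p.swap) ?_ ?_ ?_ ?_ ?_ <;>
    simp [mem_lowDegree, add_comm]

theorem two_mul_sum_lowDegree_le (T : ℕ) :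
    2 * ∑ p ∈ lowDegree T, p.1 ≤ T * (lowDegree T).card := by
  rw [two_mul]
  nth_rw 2 [sum_lowDegree_swap]
  rw [← Finset.sum_add_distrib, mul_comm, ← smul_eq_mul, ← Finset.sum_const]
  exact Finset.sum_le_sum fun p hp => (mem_lowDegree.1 hp).le

theorem exists_matrix_choose_mul_choose (T : ℕ) :
    ∃ M : Matrix (lowDegree T) (lowDegree T) ℝ, M.det = 1 ∧ ∀ (u v : ℤ) a,
      ((Ring.choose u a.1.1 * Ring.choose v a.1.2 : ℤ) : ℝ) = ∑ b, M a b *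
        ((u : ℝ) ^ b.1.1 / b.1.1.factorial * ((v : ℝ) ^ b.1.2 / b.1.2.factorial)) := by
  obtain ⟨m, m1, m2, m3⟩ := exists_chooseMatrix
  refine ⟨Matrix.of fun a b => m a.1.1 b.1.1 * m a.1.2 b.1.2,
    det_eq_one_of_triangular _ (fun a => a.1.1 + a.1.2) (fun a => by simp [m1]) ?_, ?_⟩
  · intro a b hab h
    simp only [Matrix.of_apply, ne_eq, mul_eq_zero, not_or] at h
    have h1 : b.1.1 ≤ a.1.1 := not_lt.1 fun hc => h.1 (m2 _ _ hc)
    have h2 : b.1.2 ≤ a.1.2 := not_lt.1 fun hc => h.2 (m2 _ _ hc)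
    by_contra hc
    exact hab (Subtype.ext (Prod.ext (by omega) (by omega)))
  · intro u v a
    push_cast
    rw [m3, m3, Finset.sum_mul_sum, ← Finset.sum_product']
    simp only [Matrix.of_apply]
    rw [Finset.sum_coe_sort (lowDegree T) (fun b => m a.1.1 b.1 * m a.1.2 b.2 *
      ((u : ℝ) ^ b.1 / b.1.factorial * ((v : ℝ) ^ b.2 / b.2.factorial)))]
    refine Eq.trans (Finset.sum_congr rfl fun b _ => by ring) (Finset.sum_subset (fun b hb => ?_) ?_)
    · have := mem_lowDegree.1 a.2
      simp only [Finset.mem_product, Finset.mem_range] at hb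
      rw [mem_lowDegree]
      omega
    · intro b _ hb
      simp only [Finset.mem_product, Finset.mem_range] at hb
      by_cases h1 : a.1.1 < b.1
      · simp [m2 _ _ h1]
      · have h2 : a.1.2 < b.2 := by omega
        simp [m2 _ _ h2]

theorem exists_matrix_shift (T : ℕ) (c : ℝ) :
    ∃ M : Matrix (lowDegree T) (lowDegree T) ℝ, M.det = 1 ∧ ∀ (x y : ℝ) a,
      x ^ a.1.1 / a.1.1.factorial * ((y - c * x) ^ a.1.2 / a.1.2.factorial) = ∑ b, M a b *
        (x ^ b.1.1 / b.1.1.factorial * (y ^ b.1.2 / b.1.2.factorial)) := by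
  refine ⟨Matrix.of fun a b => if a.1.1 + a.1.2 = b.1.1 + b.1.2 ∧ b.1.2 ≤ a.1.2 then
      (-c) ^ (a.1.2 - b.1.2) * (b.1.1.choose a.1.1 : ℝ) else 0,
    det_eq_one_of_triangular _ (fun a => a.1.2) (fun a => by simp) ?_, ?_⟩
  · intro a b hab h
    simp only [Matrix.of_apply, ne_eq, ite_eq_right_iff, not_forall] at h
    obtain ⟨⟨h1, h2⟩, -⟩ := h
    refine lt_of_le_of_ne h2 fun h3 => hab (Subtype.ext (Prod.ext (by omega) (by omega)))
  · rintro x y ⟨⟨i, j⟩, ha⟩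
    rw [mem_lowDegree] at ha
    simp only [Matrix.of_apply] at ha ⊢
    rw [Finset.sum_coe_sort (lowDegree T) (fun b => (if i + j = b.1 + b.2 ∧ b.2 ≤ j then
      (-c) ^ (j - b.2) * (b.1.choose i : ℝ) else 0) *
      (x ^ b.1 / b.1.factorial * (y ^ b.2 / b.2.factorial)))]
    have h1 : ∑ b ∈ lowDegree T, (if i + j = b.1 + b.2 ∧ b.2 ≤ j then
        (-c) ^ (j - b.2) * (b.1.choose i : ℝ) else 0) *
        (x ^ b.1 / b.1.factorial * (y ^ b.2 / b.2.factorial)) =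
        ∑ k ∈ Finset.range (j + 1), (-c) ^ (j - k) * ((i + (j - k)).choose i : ℝ) *
          (x ^ (i + (j - k)) / (i + (j - k)).factorial * (y ^ k / k.factorial)) := by
      simp only [ite_mul, zero_mul]
      rw [← Finset.sum_filter]
      refine Finset.sum_bij' (fun b _ => b.2) (fun k _ => (i + (j - k), k)) ?_ ?_ ?_ ?_ ?_
      · rintro b hb
        simp only [Finset.mem_filter, Finset.mem_range] at hb ⊢
        omega
      · intro k hk
        simp only [Finset.mem_filter, Finset.mem_range, mem_lowDegree] at hk ⊢
        omega
      · rintro ⟨p, r⟩ hb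
        simp only [Finset.mem_filter] at hb
        simp only [Prod.mk.injEq, and_true]
        omega
      · simp
      · rintro ⟨p, r⟩ hb
        simp only [Finset.mem_filter] at hb
        obtain rfl : p = i + (j - r) := by omega
        rfl
    rw [h1, sub_eq_add_neg, add_comm y, (Commute.all _ _).add_pow', Finset.Nat.sum_antidiagonal_eq_sum_range_succ_mk,
      Finset.sum_div, Finset.mul_sum, ← Finset.sum_range_reflect]
    refine Finset.sum_congr rfl fun k hk => ?_
    have hk' : k ≤ j := by simpa [Nat.lt_succ_iff] using hk
    have e1 : j + 1 - 1 - k = j - k := by omega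
    have e2 : j - (j - k) = k := by omega
    simp only [e1, e2, nsmul_eq_mul]
    rw [Nat.choose_symm hk', Nat.cast_choose ℝ hk', Nat.cast_choose ℝ (Nat.le_add_right i (j - k)),
      Nat.add_sub_cancel_left, pow_add]
    have f1 : (i.factorial : ℝ) ≠ 0 := by exact_mod_cast i.factorial_ne_zero
    have f2 : (j.factorial : ℝ) ≠ 0 := by exact_mod_cast j.factorial_ne_zero
    have f3 : (k.factorial : ℝ) ≠ 0 := by exact_mod_cast k.factorial_ne_zero
    have f4 : ((j - k).factorial : ℝ) ≠ 0 := by exact_mod_cast (j - k).factorial_ne_zero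
    have f5 : ((i + (j - k)).factorial : ℝ) ≠ 0 := by
      exact_mod_cast (i + (j - k)).factorial_ne_zero
    rw [show -(c * x) = -c * x by ring, mul_pow]
    field_simp

theorem exists_matrix_choose (T : ℕ) :
    ∃ M : Matrix (Fin T) (Fin T) ℝ, M.det = 1 ∧ ∀ (u : ℤ) (a : Fin T),
      ((Ring.choose u (a : ℕ) : ℤ) : ℝ) = ∑ b, M a b * ((u : ℝ) ^ (b : ℕ) / (b : ℕ).factorial) := by
  obtain ⟨m, m1, m2, m3⟩ := exists_chooseMatrix
  refine ⟨Matrix.of fun a b => m a b, det_eq_one_of_triangular _ (fun a => (a : ℕ))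
    (fun a => by simp [m1]) ?_, ?_⟩
  · intro a b hab h
    refine lt_of_le_of_ne (not_lt.1 fun hc => h (m2 _ _ hc)) fun hc => hab (Fin.ext hc.symm)
  · intro u a
    simp only [Matrix.of_apply]
    rw [m3, Fin.sum_univ_eq_sum_range (fun b => m a b * ((u : ℝ) ^ b / b.factorial))]
    refine Finset.sum_subset (fun b hb => ?_) fun b _ hb => ?_
    · simp only [Finset.mem_range] at hb ⊢; omega
    · simp only [Finset.mem_range] at hb
      rw [m2 _ _ (by omega), zero_mul]

end ChangeOfBasis

section Interpolation

theorem pow_div_factorial_le (x : ℝ) (X : ℝ) (hx : |x| ≤ X) (T : ℝ) (hT : 0 < T) (i : ℕ) :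
    |x ^ i / i.factorial| ≤ (X / T) ^ i * exp T := by
  rw [abs_div, abs_pow, Nat.abs_cast]
  have h1 := Real.pow_div_factorial_le_exp T hT.le i
  calc |x| ^ i / i.factorial ≤ X ^ i / i.factorial := by gcongr
    _ = (X / T) ^ i * (T ^ i / i.factorial) := by
      rw [← mul_div_assoc, ← mul_pow, div_mul_cancel₀ _ hT.ne']
    _ ≤ _ := by
      have : 0 ≤ X := (abs_nonneg _).trans hx
      gcongr

theorem interpolation_contradiction_one {A : Type*} [CommRing A] (φ : Fin 4 → A →+* ℝ)
    (hφ : ∀ z, φ 0 z ≠ 0 → 1 ≤ |∏ k, φ k z|)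
    {C : Type*} [Fintype C] (S q T : ℕ) (hS : S = 8450) (hq : 81 ≤ q) (hT : 1 ≤ T)
    (θ : C → ℤ) (ω₀ : ℝ)
    (w : C → A) (h : ℝ) (hh : 0 ≤ h) (hw : ∀ k c, |φ k (w c)| ≤ exp h)
    (B W : ℝ) (δ : C → ℝ) (hB : 1 ≤ B) (hw0 : ∀ c, φ 0 (w c) = B * exp (θ c * ω₀ + δ c))
    (hBW : B * exp W ≤ exp h) (hW : 0 ≤ W) (hω : ∀ c, |θ c * ω₀| ≤ W)
    (ind : ∀ y : Fin S × Fin T → ℝ,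
      (∀ c, ∑ r, y r * (φ 0 (w c) ^ (r.1 : ℕ) * (θ c : ℝ) ^ (r.2 : ℕ)) = 0) → y = 0)
    (Θ : ℝ) (hθ : ∀ c, |(θ c : ℝ)| ≤ Θ) (hΘ : 3 * Θ ≤ q ^ 5 * T)
    (hnT : ((S * T : ℕ) : ℝ) ≤ exp T)
    (hSh : S * h ≤ T) (hSW : q * (S * W) ≤ T)
    (hδ : ∀ c, 2 * S * |δ c| * (q : ℝ) ^ (64 * T) ≤ 1) : False := by
  have hT0 : (0 : ℝ) < T := by exact_mod_cast hT
  have hq0 : (81 : ℝ) ≤ q := by exact_mod_cast hq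
  obtain ⟨M, hM, hMe⟩ := exists_matrix_choose T
  let V : Submodule ℝ (C → ℝ) :=
    Submodule.span ℝ (Set.range fun k : Fin (65 * T) => fun c => (θ c : ℝ) ^ (k : ℕ))
  have hVd : Module.finrank ℝ V ≤ 65 * T := by
    exact (finrank_range_le_card (R := ℝ) _).trans (by simp)
  refine interpolation_contradiction φ hφ S q T (by omega) hT
    (fun (a : Fin T) c => Ring.choose (θ c) (a : ℕ)) (fun a c => (θ c : ℝ) ^ (a : ℕ) / (a : ℕ).factorial)
    M hM (fun a c => hMe _ _) w h hh hw B W (fun c => θ c * ω₀) δ hB hw0 hBW hW hω ?_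
    V ?_ ?_ (fun _ => (q : ℝ) ^ (5 * T)) ?_ (fun _ => by positivity) (by simp)
    (by simp; omega) (by simpa using hnT) hSh hSW hδ
  · intro y hy
    have h1 := ind (fun r => y r / (r.2 : ℕ).factorial) fun c => by
      rw [← hy c]
      exact Finset.sum_congr rfl fun r _ => by ring
    funext r
    have h2 := congrFun h1 r
    have hr : ((r.2 : ℕ).factorial : ℝ) ≠ 0 := by exact_mod_cast (r.2 : ℕ).factorial_ne_zero
    simpa [hr] using h2
  · simp only [Fintype.card_fin]
    rw [hS]
    omega
  · intro a k hk
    have h1 : (fun c => (θ c : ℝ) ^ (a : ℕ) / (a : ℕ).factorial * (θ c * ω₀) ^ k) =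
        (ω₀ ^ k / (a : ℕ).factorial) • fun c => (θ c : ℝ) ^ ((a : ℕ) + k) := by
      funext c
      simp only [Pi.smul_apply, smul_eq_mul, mul_pow, pow_add]
      ring
    rw [h1]
    exact V.smul_mem _ (Submodule.subset_span ⟨⟨a + k, by omega⟩, rfl⟩)
  · intro a c
    refine (pow_div_factorial_le _ _ ((hθ c).trans (le_max_left Θ T)) T hT0 a).trans ?_
    have h1 : 1 ≤ max Θ T / T := (one_le_div hT0).2 (le_max_right _ _)
    have h2 : max Θ T / T * 3 ≤ q ^ 5 := by
      rw [div_mul_eq_mul_div, div_le_iff₀ hT0]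
      rcases max_cases Θ T with ⟨h, -⟩ | ⟨h, -⟩ <;> rw [h]
      · linarith
      · have : (3 : ℝ) ≤ q ^ 5 := le_trans (by linarith) (le_self_pow₀ (by linarith) (by norm_num))
        nlinarith
    calc _ ≤ (max Θ T / T) ^ T * 3 ^ T := by
          have : exp (T : ℝ) ≤ 3 ^ T := by
            rw [← exp_one_pow]
            exact pow_le_pow_left₀ (exp_pos _).le exp_one_lt_three.le _
          have := pow_le_pow_right₀ h1 a.2.le
          gcongr
      _ = (max Θ T / T * 3) ^ T := by rw [mul_pow]
      _ ≤ (q ^ 5) ^ T := by gcongr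
      _ = _ := by rw [pow_mul]

theorem interpolation_contradiction_two {A : Type*} [CommRing A] (φ : Fin 4 → A →+* ℝ)
    (hφ : ∀ z, φ 0 z ≠ 0 → 1 ≤ |∏ k, φ k z|)
    {C : Type*} [Fintype C] (S q T : ℕ) (hS : S = 8450) (hq : 81 ≤ q) (hT : 1 ≤ T)
    (u v : C → ℤ) (l₁ l₂ : ℝ) (hl₂ : 0 < l₂) (ω : C → ℝ) (hωd : ∀ c, ω c = u c * l₁ + v c * l₂)
    (w : C → A) (h : ℝ) (hh : 0 ≤ h) (hw : ∀ k c, |φ k (w c)| ≤ exp h)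
    (B W : ℝ) (δ : C → ℝ) (hB : 1 ≤ B) (hw0 : ∀ c, φ 0 (w c) = B * exp (ω c + δ c))
    (hBW : B * exp W ≤ exp h) (hW : 0 ≤ W) (hω : ∀ c, |ω c| ≤ W)
    (ind : ∀ y : Fin S × lowDegree T → ℝ,
      (∀ c, ∑ r, y r * (φ 0 (w c) ^ (r.1 : ℕ) * ((u c : ℝ) ^ r.2.1.1 * ω c ^ r.2.1.2)) = 0) → y = 0)
    (U X : ℝ) (hU : ∀ c, |(u c : ℝ)| ≤ U) (hX : ∀ c, |ω c| ≤ l₂ * X) (hU0 : 0 ≤ U) (hX0 : 0 ≤ X)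
    (hUX : U * X ≤ T ^ 2 * q ^ 9)
    (hnT : ((S * (T * (T + 1)) : ℕ) : ℝ) ≤ exp T)
    (hSh : S * h ≤ T) (hSW : q * (S * W) ≤ T)
    (hδ : ∀ c, 2 * S * |δ c| * (q : ℝ) ^ (64 * T) ≤ 1) : False := by
  have hT0 : (0 : ℝ) < T := by exact_mod_cast hT
  have hq0 : (81 : ℝ) ≤ q := by exact_mod_cast hq
  have hcard := card_lowDegree T
  have hpos : 0 < (lowDegree T).card := by
    have : 0 < T * (T + 1) := by positivity
    omega
  obtain ⟨M₁, hM₁, hMe₁⟩ := exists_matrix_choose_mul_choose T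
  obtain ⟨M₂, hM₂, hMe₂⟩ := exists_matrix_shift T (l₁ / l₂)
  let F : ℕ × ℕ → C → ℝ := fun p c => (u c : ℝ) ^ p.1 * ω c ^ p.2
  let V : Submodule ℝ (C → ℝ) := Submodule.span ℝ (Set.range fun k : lowDegree (65 * T) => F k.1)
  have hVd : Module.finrank ℝ V ≤ (lowDegree (65 * T)).card := by
    exact (finrank_range_le_card (R := ℝ) _).trans (by simp)
  have hcard' := card_lowDegree (65 * T)
  refine interpolation_contradiction φ hφ S q T (by omega) hT
    (fun (a : lowDegree T) c => Ring.choose (u c) a.1.1 * Ring.choose (v c) a.1.2)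
    (fun a c => (u c : ℝ) ^ a.1.1 / a.1.1.factorial * ((ω c / l₂) ^ a.1.2 / a.1.2.factorial))
    (M₁ * M₂) (by rw [Matrix.det_mul, hM₁, hM₂, one_mul]) (fun a c => ?_)
    w h hh hw B W ω δ hB hw0 hBW hW hω ?_
    V ?_ ?_ (fun a => (U / T) ^ a.1.1 * exp T * ((X / T) ^ a.1.2 * exp T)) ?_
    (fun _ => by positivity) ?_ (by rw [Fintype.card_coe]; positivity) ?_ hSh hSW hδ
  · rw [hMe₁]
    have hv : (v c : ℝ) = ω c / l₂ - l₁ / l₂ * u c := by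
      rw [hωd]; field_simp; ring
    simp only [Matrix.mul_apply, Finset.sum_mul]
    rw [Finset.sum_comm]
    refine Finset.sum_congr rfl fun b _ => ?_
    rw [hv, hMe₂, Finset.mul_sum]
    exact Finset.sum_congr rfl fun _ _ => by ring
  · intro y hy
    have h1 := ind (fun r => y r / (r.2.1.1.factorial * r.2.1.2.factorial * l₂ ^ r.2.1.2)) fun c => by
      rw [← hy c]
      exact Finset.sum_congr rfl fun r _ => by rw [div_pow]; field_simp
    funext r
    have h2 := congrFun h1 r
    have hr : (r.2.1.1.factorial * r.2.1.2.factorial * l₂ ^ r.2.1.2 : ℝ) ≠ 0 := by positivity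
    simpa only [Pi.zero_apply, div_eq_zero_iff, hr, or_false] using h2
  · rw [Fintype.card_coe]
    have : 65 * T * (65 * T + 1) ≤ 4225 * (T * (T + 1)) := by nlinarith
    subst hS
    omega
  · intro a k hk
    have h1 : (fun c => (u c : ℝ) ^ a.1.1 / a.1.1.factorial *
        ((ω c / l₂) ^ a.1.2 / a.1.2.factorial) * ω c ^ k) =
        (1 / (a.1.1.factorial * a.1.2.factorial * l₂ ^ a.1.2)) • F (a.1.1, a.1.2 + k) := by
      funext c
      simp only [Pi.smul_apply, smul_eq_mul, pow_add, div_pow, F]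
      field_simp
    rw [h1]
    have := mem_lowDegree.1 a.2
    exact V.smul_mem _ (Submodule.subset_span
      ⟨⟨(a.1.1, a.1.2 + k), by rw [mem_lowDegree]; dsimp only; omega⟩, rfl⟩)
  · intro a c
    rw [abs_mul]
    have h1 : |ω c / l₂| ≤ X := by
      rw [abs_div, abs_of_pos hl₂, div_le_iff₀ hl₂, mul_comm]
      exact hX c
    exact mul_le_mul (pow_div_factorial_le _ _ (hU c) _ hT0 _) (pow_div_factorial_le _ _ h1 _ hT0 _)
      (abs_nonneg _) (by positivity)
  · rw [Fintype.card_coe, Finset.prod_coe_sort (lowDegree T)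
      (fun a => (U / T) ^ a.1 * exp T * ((X / T) ^ a.2 * exp (T : ℝ)))]
    simp only [Finset.prod_mul_distrib, Finset.prod_pow_eq_pow_sum, Finset.prod_const]
    rw [← sum_lowDegree_swap]
    set n := (lowDegree T).card
    have hσ : 2 * ∑ p ∈ lowDegree T, p.1 ≤ T * n := two_mul_sum_lowDegree_le T
    set σ := ∑ p ∈ lowDegree T, p.1
    have hQ : U / T * (X / T) ≤ q ^ 9 := by
      rw [div_mul_div_comm, div_le_iff₀ (by positivity)]
      linarith
    have heT : exp (T : ℝ) ≤ 3 ^ T := by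
      rw [← exp_one_pow]
      exact pow_le_pow_left₀ (exp_pos _).le exp_one_lt_three.le _
    refine (pow_le_pow_iff_left₀ (by positivity) (by positivity) two_ne_zero).1 ?_
    calc _ = (U / T * (X / T)) ^ (2 * σ) * (exp T ^ n) ^ 4 := by
          rw [mul_pow (U / T)]; ring
      _ ≤ (q ^ 9) ^ (2 * σ) * ((3 ^ T) ^ n) ^ 4 := by gcongr
      _ ≤ (q ^ 9) ^ (T * n) * ((3 ^ T) ^ n) ^ 4 := by
          gcongr
          exact one_le_pow₀ (by linarith)
      _ = (q ^ 9) ^ (T * n) * (81 : ℝ) ^ (T * n) := by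
          congr 1
          rw [← pow_mul, ← pow_mul, show (81 : ℝ) = 3 ^ 4 by norm_num, ← pow_mul]
          ring_nf
      _ ≤ (q ^ 9) ^ (T * n) * (q : ℝ) ^ (T * n) := by gcongr
      _ = _ := by ring
  · rw [Fintype.card_coe]
    refine le_trans ?_ hnT
    have : S * (lowDegree T).card ≤ S * (T * (T + 1)) := Nat.mul_le_mul_left _ (by omega)
    exact_mod_cast this

end Interpolation

section Elimination

theorem exists_common_zero_of_exponential_relation {A L : Type*} [CommRing A] [Algebra ℝ A]
    [IsDomain A] [Add L] (Fil : ℕ → A → Prop)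
    (hmono : ∀ d d' x, d ≤ d' → Fil d x → Fil d' x)
    (hmul : ∀ d d' x y, Fil d x → Fil d' y → Fil (d + d') (x * y))
    (hsub : ∀ d x y, Fil d x → Fil d y → Fil d (x - y))
    (hsmul : ∀ d (c : ℝ) x, Fil d x → Fil d (c • x))
    (lc : A → ℝ) (hlc0 : ∀ x, lc x = 0 → x = 0) (hlcm : ∀ x y, lc (x * y) = lc x * lc y)
    (hlcs : ∀ (c : ℝ) x, lc (c • x) = c * lc x)
    (τ : A → A) (hτF : ∀ d x, Fil d x → Fil d (τ x)) (hτlc : ∀ x, lc (τ x) = lc x)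
    (ev : L → A →ₐ[ℝ] ℝ) (g : L) (hev : ∀ l x, ev (l + g) x = ev l (τ x))
    (χ : L → ℝ) (c : ℝ) (hχ : ∀ l, χ l ≠ 0) (hχg : ∀ l, χ (l + g) = χ l * c) (hc0 : 0 < c)
    (hc1 : c ≠ 1) (C : ℕ → Set L) (hC : ∀ j, C j ⊆ C (j + 1))
    (hCg : ∀ j, ∀ l ∈ C j, l + g ∈ C (j + 1)) (n d : ℕ) (y : ℕ → A)
    (hy : ∀ s < n, Fil d (y s)) (hy0 : ∃ s < n, y s ≠ 0)
    (hrel : ∀ l ∈ C n, ∑ s ∈ Finset.range n, χ l ^ s * ev l (y s) = 0) :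
    ∃ z ≠ 0, Fil (2 ^ n * d) z ∧ ∀ l ∈ C 0, ev l z = 0 := by
  have hC0 : ∀ j, C 0 ⊆ C j := fun j => by
    induction j with
    | zero => exact subset_rfl
    | succ j ih => exact ih.trans (hC j)
  induction n generalizing d y with
  | zero => obtain ⟨s, hs, -⟩ := hy0; omega
  | succ n ih =>
    by_cases h0 : y 0 = 0
    · obtain ⟨z, hz, hzF, hzv⟩ := ih d (fun s => y (s + 1)) (fun s hs => hy _ (by omega)) (by
        obtain ⟨s, hs, hs0⟩ := hy0
        rcases s with _ | s
        · exact absurd h0 hs0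
        · exact ⟨s, by omega, hs0⟩) fun l hl => by
          have h1 := hrel l (hC _ hl)
          rw [Finset.sum_range_succ', h0, map_zero, mul_zero, add_zero] at h1
          have h2 : χ l * ∑ s ∈ Finset.range n, χ l ^ s * ev l (y (s + 1)) = 0 := by
            rw [← h1, Finset.mul_sum]
            exact Finset.sum_congr rfl fun s _ => by ring
          exact (mul_eq_zero.1 h2).resolve_left (hχ l)
      exact ⟨z, hz, hmono _ _ _ (Nat.mul_le_mul_right _ (Nat.pow_le_pow_right (by norm_num)
        (by omega))) hzF, hzv⟩
    by_cases hall : ∀ s < n, y (s + 1) = 0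
    · refine ⟨y 0, h0, hmono _ _ _ (Nat.le_mul_of_pos_left _ (by positivity)) (hy 0 (by omega)),
        fun l hl => ?_⟩
      have h1 := hrel l (hC0 _ hl)
      rw [Finset.sum_range_succ', Finset.sum_eq_zero fun s hs => by
        rw [hall s (Finset.mem_range.1 hs), map_zero, mul_zero]] at h1
      simpa using h1
    push Not at hall
    obtain ⟨z, hz, hzF, hzv⟩ := ih (d + d)
      (fun s => τ (y 0) * y (s + 1) - c ^ (s + 1) • (y 0 * τ (y (s + 1))))
      (fun s hs => hsub _ _ _ (hmul _ _ _ _ (hτF _ _ (hy 0 (by omega))) (hy _ (by omega)))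
        (hsmul _ _ _ (hmul _ _ _ _ (hy 0 (by omega)) (hτF _ _ (hy _ (by omega)))))) (by
        obtain ⟨s, hs, hs0⟩ := hall
        refine ⟨s, hs, fun hzero => ?_⟩
        have h1 := congrArg lc (sub_eq_zero.1 hzero)
        rw [hlcs, hlcm, hlcm, hτlc, hτlc] at h1
        have h2 : lc (y 0) * lc (y (s + 1)) ≠ 0 :=
          mul_ne_zero (fun h => h0 (hlc0 _ h)) fun h => hs0 (hlc0 _ h)
        have h3 : c ^ (s + 1) = 1 := by
          have := mul_right_cancel₀ h2 ((one_mul _).trans h1)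
          exact this.symm
        exact hc1 ((pow_eq_one_iff_of_nonneg hc0.le (by omega)).1 h3)) fun l hl => by
        have h1 := hrel l (hC _ hl)
        have h2 := hrel (l + g) (hCg _ _ hl)
        rw [Finset.sum_range_succ'] at h1 h2
        simp only [hχg, hev, pow_zero, one_mul] at h1 h2
        have h3 : χ l * ∑ s ∈ Finset.range n, χ l ^ s * ev l (τ (y 0) * y (s + 1) -
            c ^ (s + 1) • (y 0 * τ (y (s + 1)))) =
            ev l (τ (y 0)) * ((∑ s ∈ Finset.range n, χ l ^ (s + 1) * ev l (y (s + 1))) + ev l (y 0)) -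
            ev l (y 0) * ((∑ s ∈ Finset.range n, (χ l * c) ^ (s + 1) * ev l (τ (y (s + 1)))) +
              ev l (τ (y 0))) := by
          rw [mul_add, mul_add, Finset.mul_sum, Finset.mul_sum, Finset.mul_sum,
            mul_comm (ev l (y 0)) (ev l (τ (y 0))), add_sub_add_right_eq_sub,
            ← Finset.sum_sub_distrib]
          refine Finset.sum_congr rfl fun s _ => ?_
          simp only [map_sub, map_mul, map_smul, smul_eq_mul]
          ring
        rw [h1, h2, mul_zero, mul_zero, sub_zero] at h3
        exact (mul_eq_zero.1 h3).resolve_left (hχ l)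
    exact ⟨z, hz, by rwa [pow_succ, mul_assoc, two_mul], hzv⟩

open Polynomial

/-- Translation of the two variables of a bivariate polynomial. -/
noncomputable def biTranslate (a b : ℝ) : ℝ[X][X] →+* ℝ[X][X] :=
  (taylorAlgHom (C b : ℝ[X])).toRingHom.comp (mapRingHom (taylorAlgHom a).toRingHom)

theorem biTranslate_apply (a b : ℝ) (p : ℝ[X][X]) :
    biTranslate a b p = taylor (C b) (p.map (taylorAlgHom a).toRingHom) := rfl

theorem natDegree_map_taylor (a : ℝ) (p : ℝ[X][X]) :
    (p.map (taylorAlgHom a).toRingHom).natDegree = p.natDegree :=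
  natDegree_map_eq_of_injective (taylor_injective a) p

theorem natDegree_biTranslate (a b : ℝ) (p : ℝ[X][X]) :
    (biTranslate a b p).natDegree = p.natDegree := by
  rw [biTranslate_apply, natDegree_taylor, natDegree_map_taylor]

theorem leadingCoeff_biTranslate (a b : ℝ) (p : ℝ[X][X]) :
    (biTranslate a b p).leadingCoeff.leadingCoeff = p.leadingCoeff.leadingCoeff := by
  rw [biTranslate_apply, leadingCoeff_taylor, leadingCoeff_map_of_injective (taylor_injective a)]
  exact leadingCoeff_taylor a _

theorem evalEval_biTranslate (a b x y : ℝ) (p : ℝ[X][X]) :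
    (biTranslate a b p).evalEval x y = p.evalEval (x + a) (y + b) := by
  have : (evalEvalRingHom x y).comp (biTranslate a b) = evalEvalRingHom (x + a) (y + b) := by
    ext
    · simp
    · simp [biTranslate_apply]
    · simp [biTranslate_apply]
  exact DFunLike.congr_fun this p

theorem swap_biTranslate (a b : ℝ) (p : ℝ[X][X]) :
    Bivariate.swap (biTranslate a b p) = biTranslate b a (Bivariate.swap p) := by
  have hC : ∀ r : ℝ, ∀ a b, biTranslate a b (C (C r)) = C (C r) := fun r a b => by
    simp [biTranslate_apply]
  have hX : ∀ a b, biTranslate a b (C X) = C X + C (C a) := fun a b => by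
    simp [biTranslate_apply]
  have hY : ∀ a b, biTranslate a b X = X + C (C b) := fun a b => by
    simp [biTranslate_apply]
  have : (Bivariate.swap (R := ℝ)).toRingEquiv.toRingHom.comp (biTranslate a b) =
      (biTranslate b a).comp (Bivariate.swap (R := ℝ)).toRingEquiv.toRingHom := by
    refine ringHom_ext' (ringHom_ext (fun r => ?_) ?_) ?_
    · change Bivariate.swap (biTranslate a b (C (C r))) = biTranslate b a (Bivariate.swap (C (C r)))
      rw [hC, Bivariate.swap_C_C, hC]
    · change Bivariate.swap (biTranslate a b (C X)) = biTranslate b a (Bivariate.swap (C X))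
      rw [hX, map_add, Bivariate.swap_X, Bivariate.swap_C_C, hY]
    · change Bivariate.swap (biTranslate a b X) = biTranslate b a (Bivariate.swap X)
      rw [hY, map_add, Bivariate.swap_Y, Bivariate.swap_C_C, hX]
  exact DFunLike.congr_fun this p

theorem exists_bivariate_zero_of_relation {L : Type*} [Add L] (S T : ℕ) (x y : L → ℝ) (g : L)
    (a b : ℝ) (hx : ∀ l, x (l + g) = x l + a) (hy : ∀ l, y (l + g) = y l + b)
    (χ : L → ℝ) (c : ℝ) (hχ : ∀ l, χ l ≠ 0) (hχg : ∀ l, χ (l + g) = χ l * c) (hc0 : 0 < c)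
    (hc1 : c ≠ 1) (C : ℕ → Set L) (hC : ∀ j, C j ⊆ C (j + 1))
    (hCg : ∀ j, ∀ l ∈ C j, l + g ∈ C (j + 1)) (f : Fin S × lowDegree T → ℝ) (hf : f ≠ 0)
    (hrel : ∀ l ∈ C S, ∑ r, f r * (χ l ^ (r.1 : ℕ) * (y l ^ r.2.1.1 * x l ^ r.2.1.2)) = 0) :
    ∃ R : ℝ[X][X], R ≠ 0 ∧ R.natDegree ≤ 2 ^ S * T ∧ (Bivariate.swap R).natDegree ≤ 2 ^ S * T ∧
      ∀ l ∈ C 0, R.evalEval (x l) (y l) = 0 := by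
  let P : ℕ → ℝ[X][X] := fun s => if h : s < S then
    ∑ p : lowDegree T, monomial p.1.1 (monomial p.1.2 (f (⟨s, h⟩, p))) else 0
  have hP : ∀ s : Fin S, P s = ∑ p : lowDegree T, monomial p.1.1 (monomial p.1.2 (f (s, p))) :=
    fun s => by simp [P]
  have hlow : ∀ p : lowDegree T, p.1.1 ≤ T ∧ p.1.2 ≤ T := fun p => by
    have := mem_lowDegree.1 p.2
    omega
  obtain ⟨R, hR0, ⟨hR1, hR2⟩, hR3⟩ := exists_common_zero_of_exponential_relation (A := ℝ[X][X])
    (fun d p => p.natDegree ≤ d ∧ (Bivariate.swap p).natDegree ≤ d)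
    (fun d d' p hd hp => ⟨hp.1.trans hd, hp.2.trans hd⟩)
    (fun d d' p r hp hr => ⟨natDegree_mul_le_of_le hp.1 hr.1, by
      rw [map_mul]; exact natDegree_mul_le_of_le hp.2 hr.2⟩)
    (fun d p r hp hr => ⟨natDegree_sub_le_of_le hp.1 hr.1 |>.trans (by simp), by
      rw [map_sub]; exact natDegree_sub_le_of_le hp.2 hr.2 |>.trans (by simp)⟩)
    (fun d c p hp => ⟨(natDegree_smul_le _ _).trans hp.1, by
      rw [map_smul]; exact (natDegree_smul_le _ _).trans hp.2⟩)
    (fun p => p.leadingCoeff.leadingCoeff) (fun p hp => by simpa using hp)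
    (fun p r => by rw [leadingCoeff_mul, leadingCoeff_mul])
    (fun c p => by
      have : c • p = Polynomial.C (Polynomial.C c) * p := by
        ext; simp
      rw [this, leadingCoeff_mul, leadingCoeff_mul, leadingCoeff_C, leadingCoeff_C])
    (biTranslate a b) (fun d p hp => ⟨by rw [natDegree_biTranslate]; exact hp.1, by
      rw [swap_biTranslate, natDegree_biTranslate]; exact hp.2⟩)
    (fun p => leadingCoeff_biTranslate _ _ _)
    (fun l => aevalAeval (x l) (y l)) g
    (fun l p => by simp only [coe_aevalAeval_eq_evalEval]; rw [evalEval_biTranslate, hx, hy])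
    χ c hχ hχg hc0 hc1 C hC hCg S T P
    (fun s hs => by
      rw [hP ⟨s, hs⟩]
      refine ⟨natDegree_sum_le_of_forall_le _ _ fun p _ => (natDegree_monomial_le _).trans (hlow p).1,
        ?_⟩
      rw [map_sum]
      refine natDegree_sum_le_of_forall_le _ _ fun p _ => ?_
      rw [Bivariate.swap_monomial_monomial]
      exact (natDegree_monomial_le _).trans (hlow p).2)
    (by
      obtain ⟨⟨s, p⟩, hs⟩ := Function.ne_iff.1 hf
      refine ⟨s, s.2, fun h0 => hs ?_⟩
      have h1 := congrArg (fun q : ℝ[X][X] => (q.coeff p.1.1).coeff p.1.2) h0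
      rw [hP] at h1
      simp only [finsetSum_coeff, coeff_zero, coeff_monomial] at h1
      rw [Finset.sum_eq_single p] at h1
      · simpa using h1
      · intro r _ hr
        by_cases e1 : r.1.1 = p.1.1
        · have e2 : r.1.2 ≠ p.1.2 := fun e2 => hr (Subtype.ext (Prod.ext e1 e2))
          simp [e1, coeff_monomial, e2]
        · simp [e1]
      · simp)
    (fun l hl => by
      rw [← hrel l hl, Fintype.sum_prod_type,
        ← Fin.sum_univ_eq_sum_range (fun s => χ l ^ s * aevalAeval (x l) (y l) (P s))]
      refine Finset.sum_congr rfl fun s _ => ?_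
      rw [hP, map_sum, Finset.mul_sum]
      refine Finset.sum_congr rfl fun p _ => ?_
      rw [coe_aevalAeval_eq_evalEval, evalEval]
      simp only [eval_monomial, eval_mul, eval_pow, eval_C]
      ring)
  exact ⟨R, hR0, hR1, hR2, fun l hl => by rw [← coe_aevalAeval_eq_evalEval]; exact hR3 l hl⟩

theorem exists_univariate_zero_of_relation {L : Type*} [Add L] (S T : ℕ) (x : L → ℝ) (g : L)
    (a : ℝ) (hx : ∀ l, x (l + g) = x l + a)
    (χ : L → ℝ) (c : ℝ) (hχ : ∀ l, χ l ≠ 0) (hχg : ∀ l, χ (l + g) = χ l * c) (hc0 : 0 < c)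
    (hc1 : c ≠ 1) (C : ℕ → Set L) (hC : ∀ j, C j ⊆ C (j + 1))
    (hCg : ∀ j, ∀ l ∈ C j, l + g ∈ C (j + 1)) (f : Fin S × Fin T → ℝ) (hf : f ≠ 0)
    (hrel : ∀ l ∈ C S, ∑ r, f r * (χ l ^ (r.1 : ℕ) * x l ^ (r.2 : ℕ)) = 0) :
    ∃ R : ℝ[X], R ≠ 0 ∧ R.natDegree ≤ 2 ^ S * T ∧ ∀ l ∈ C 0, R.eval (x l) = 0 := by
  let P : ℕ → ℝ[X] := fun s => if h : s < S then
    ∑ p : Fin T, monomial (p : ℕ) (f (⟨s, h⟩, p)) else 0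
  have hP : ∀ s : Fin S, P s = ∑ p : Fin T, monomial (p : ℕ) (f (s, p)) :=
    fun s => by simp [P]
  obtain ⟨R, hR0, hR1, hR3⟩ := exists_common_zero_of_exponential_relation (A := ℝ[X])
    (fun d p => p.natDegree ≤ d)
    (fun d d' p hd hp => hp.trans hd)
    (fun d d' p r hp hr => natDegree_mul_le_of_le hp hr)
    (fun d p r hp hr => natDegree_sub_le_of_le hp hr |>.trans (by simp))
    (fun d c p hp => (natDegree_smul_le _ _).trans hp)
    leadingCoeff (fun p hp => by simpa using hp) (fun p r => by rw [leadingCoeff_mul])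
    (fun c p => by rw [smul_eq_C_mul, leadingCoeff_mul, leadingCoeff_C])
    (taylor a) (fun d p hp => by rwa [natDegree_taylor])
    (fun p => leadingCoeff_taylor _ _)
    (fun l => aeval (x l)) g
    (fun l p => by simp only [coe_aeval_eq_eval]; rw [taylor_eval, hx])
    χ c hχ hχg hc0 hc1 C hC hCg S T P
    (fun s hs => by
      rw [hP ⟨s, hs⟩]
      exact natDegree_sum_le_of_forall_le _ _ fun p _ => (natDegree_monomial_le _).trans p.2.le)
    (by
      obtain ⟨⟨s, p⟩, hs⟩ := Function.ne_iff.1 hf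
      refine ⟨s, s.2, fun h0 => hs ?_⟩
      have h1 := congrArg (fun q : ℝ[X] => q.coeff p) h0
      rw [hP] at h1
      simp only [finsetSum_coeff, coeff_zero, coeff_monomial] at h1
      rw [Finset.sum_eq_single p] at h1
      · simpa using h1
      · intro r _ hr
        have e1 : (r : ℕ) ≠ p := fun e => hr (Fin.ext e)
        simp [e1]
      · simp)
    (fun l hl => by
      rw [← hrel l hl, Fintype.sum_prod_type,
        ← Fin.sum_univ_eq_sum_range (fun s => χ l ^ s * aeval (x l) (P s))]
      refine Finset.sum_congr rfl fun s _ => ?_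
      rw [hP, map_sum, Finset.mul_sum]
      refine Finset.sum_congr rfl fun p _ => ?_
      simp only [aeval_monomial, Algebra.algebraMap_self, RingHom.id_apply]
      ring)
  exact ⟨R, hR0, hR1, fun l hl => by simpa using hR3 l hl⟩

end Elimination

section Bezout

open Polynomial

theorem coeff_coeff_swap (p : ℝ[X][X]) (i j : ℕ) :
    ((Bivariate.swap p).coeff i).coeff j = (p.coeff j).coeff i := by
  induction p using Polynomial.induction_on' with
  | add p q hp hq => simp only [map_add, coeff_add, hp, hq]
  | monomial n f =>
    induction f using Polynomial.induction_on' with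
    | add p q hp hq => simp only [map_add, coeff_add, hp, hq]
    | monomial m r =>
      rw [Bivariate.swap_monomial_monomial]
      simp only [coeff_monomial]
      split_ifs <;> simp_all [coeff_monomial]

theorem natDegree_coeff_le_natDegree_swap (p : ℝ[X][X]) (i : ℕ) :
    (p.coeff i).natDegree ≤ (Bivariate.swap p).natDegree := by
  refine natDegree_le_iff_coeff_eq_zero.2 fun j hj => ?_
  rw [← coeff_coeff_swap, coeff_eq_zero_of_natDegree_lt hj, coeff_zero]

theorem natDegree_det_le {n : Type*} [Fintype n] [DecidableEq n] (M : Matrix n n ℝ[X]) (d : ℕ)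
    (hM : ∀ i j, (M i j).natDegree ≤ d) : M.det.natDegree ≤ Fintype.card n * d := by
  rw [Matrix.det_apply]
  refine natDegree_sum_le_of_forall_le _ _ fun σ _ => ?_
  have h : ∀ ε : ℤˣ, ∀ p : ℝ[X], (ε • p).natDegree = p.natDegree := fun ε p => by
    rcases Int.units_eq_one_or ε with rfl | rfl <;> simp
  rw [h]
  refine (natDegree_prod_le _ _).trans ((Finset.sum_le_sum fun i _ => hM _ _).trans ?_)
  simp

theorem natDegree_resultant_le (p q : ℝ[X][X]) (m n d : ℕ)
    (hp : (Bivariate.swap p).natDegree ≤ d) (hq : (Bivariate.swap q).natDegree ≤ d) :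
    (resultant p q m n).natDegree ≤ (m + n) * d := by
  refine (natDegree_det_le _ d fun i j => ?_).trans (by simp)
  rw [sylvester, Matrix.of_apply]
  refine Fin.addCases (fun j => ?_) (fun j => ?_) j
  · rw [Fin.addCases_left]
    split_ifs
    · exact (natDegree_coeff_le_natDegree_swap _ _).trans hq
    · simp
  · rw [Fin.addCases_right]
    split_ifs
    · exact (natDegree_coeff_le_natDegree_swap _ _).trans hp
    · simp

theorem exists_eval_eq_zero_of_not_dvd (F G : ℝ[X][X]) (hF : Irreducible F) (hFG : ¬ F ∣ G)
    (h1 : G.natDegree = F.natDegree)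
    (h2 : (Bivariate.swap G).natDegree = (Bivariate.swap F).natDegree) :
    ∃ r : ℝ[X], r ≠ 0 ∧ r.natDegree ≤ (F.natDegree + (Bivariate.swap F).natDegree) ^ 2 ∧
      ∀ x y : ℝ, F.evalEval x y = 0 → G.evalEval x y = 0 → r.eval x = 0 := by
  by_cases hn : F.natDegree = 0
  · obtain ⟨f, rfl⟩ := natDegree_eq_zero.1 hn
    refine ⟨f, fun h => hF.ne_zero (by simp [h]), ?_, fun x y h _ => by rwa [evalEval_C] at h⟩
    have := natDegree_coeff_le_natDegree_swap (C f) 0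
    rw [coeff_C_zero] at this
    nlinarith
  · have hprim : F.IsPrimitive := hF.isPrimitive hn
    refine ⟨resultant F G, fun h0 => ?_, ?_, fun x y hx hy => ?_⟩
    · let φ := algebraMap ℝ[X] (FractionRing ℝ[X])
      have hφ : Function.Injective φ := IsFractionRing.injective _ _
      have h3 : resultant (F.map φ) (G.map φ) = 0 := by
        rw [natDegree_map_eq_of_injective hφ, natDegree_map_eq_of_injective hφ,
          resultant_map_map, h0, map_zero]
      rw [resultant_eq_zero_iff] at h3
      have h4 : Irreducible (F.map φ) :=
        (hprim.irreducible_iff_irreducible_map_fraction_map).1 hF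
      refine hFG (hprim.dvd_of_fraction_map_dvd_fraction_map (K := FractionRing ℝ[X]) ?_)
      by_contra h5
      exact h3.2 ((EuclideanDomain.dvd_or_coprime _ _ h4).resolve_left h5)
    · refine (natDegree_resultant_le F G _ _ _ le_rfl h2.le).trans ?_
      rw [h1]
      nlinarith [sq_nonneg ((F.natDegree : ℤ) - (Bivariate.swap F).natDegree)]
    · obtain ⟨p, q, -, -, h⟩ := exists_mul_add_mul_eq_C_resultant F G le_rfl le_rfl (Or.inl hn)
      have := congrArg (evalEval x y) h
      rw [evalEval_add, evalEval_mul, evalEval_mul, hx, hy] at this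
      rw [evalEval_C] at this
      simpa using this.symm

theorem card_common_zeros_le {ι : Type*} (F G : ℝ[X][X]) (hF : Irreducible F) (hFG : ¬ F ∣ G)
    (h1 : G.natDegree = F.natDegree)
    (h2 : (Bivariate.swap G).natDegree = (Bivariate.swap F).natDegree) (x y : ι → ℝ)
    (s : Finset ι) (hx : Set.InjOn x s) (hsF : ∀ i ∈ s, F.evalEval (x i) (y i) = 0)
    (hsG : ∀ i ∈ s, G.evalEval (x i) (y i) = 0) :
    s.card ≤ (F.natDegree + (Bivariate.swap F).natDegree) ^ 2 := by
  classical
  obtain ⟨r, hr0, hr1, hr⟩ := exists_eval_eq_zero_of_not_dvd F G hF hFG h1 h2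
  rw [← Finset.card_image_of_injOn hx]
  refine le_trans (Multiset.card_le_card ?_ ) ((card_roots' r).trans hr1)
  rw [Finset.val_le_iff_val_subset]
  intro a ha
  rw [Finset.mem_val] at ha
  obtain ⟨i, hi, rfl⟩ := Finset.mem_image.1 ha
  exact (mem_roots hr0).2 (hr _ _ (hsF i hi) (hsG i hi))

theorem exists_irreducible_factor_of_many_zeros {ι : Type*} (x y : ι → ℝ) (K : ℕ) (R : ℝ[X][X])
    (hR : R ≠ 0) (s : Finset ι) (hs : ∀ i ∈ s, R.evalEval (x i) (y i) = 0)
    (hK : (R.natDegree + (Bivariate.swap R).natDegree) * K < s.card) :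
    ∃ F : ℝ[X][X], Irreducible F ∧ ∃ t ⊆ s, (∀ i ∈ t, F.evalEval (x i) (y i) = 0) ∧
      (F.natDegree + (Bivariate.swap F).natDegree) * K < t.card := by
  classical
  revert s
  induction R using WfDvdMonoid.induction_on_irreducible with
  | zero => exact absurd rfl hR
  | unit u hu =>
    intro s hs hK
    obtain ⟨i, hi⟩ := Finset.card_pos.1 (Nat.zero_lt_of_lt hK)
    have := (hu.map (evalEvalRingHom (x i) (y i))).ne_zero
    exact absurd (hs i hi) this
  | mul a i ha hi ih =>
    intro s hs hK
    by_contra! hcon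
    have h1 := hcon i hi (s.filter fun j => i.evalEval (x j) (y j) = 0) (Finset.filter_subset _ _)
      (by simp)
    have h2 : (s.filter fun j => a.evalEval (x j) (y j) = 0).card ≤
        (a.natDegree + (Bivariate.swap a).natDegree) * K := by
      by_contra! h
      obtain ⟨F, hF, t, ht, h⟩ := ih ha _ (by simp) h
      exact absurd h.2 (not_lt.2 (hcon F hF t (ht.trans (Finset.filter_subset _ _)) h.1))
    have h3 : s.card ≤ (s.filter fun j => i.evalEval (x j) (y j) = 0).card +
        (s.filter fun j => a.evalEval (x j) (y j) = 0).card := by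
      refine le_trans (Finset.card_le_card fun j hj => ?_) (Finset.card_union_le _ _)
      have := hs j hj
      rw [evalEval_mul, mul_eq_zero] at this
      simp only [Finset.mem_union, Finset.mem_filter]
      tauto
    have hi' : Bivariate.swap i ≠ 0 := (map_ne_zero_iff _ Bivariate.swap.injective).2 hi.ne_zero
    have ha' : Bivariate.swap a ≠ 0 := (map_ne_zero_iff _ Bivariate.swap.injective).2 ha
    rw [natDegree_mul hi.ne_zero ha, map_mul, natDegree_mul hi' ha'] at hK
    nlinarith

end Bezout

section TranslationInvariance

open Polynomial

theorem eq_zero_of_evalEval_eq_zero (F : ℝ[X][X]) (h : ∀ x y, F.evalEval x y = 0) : F = 0 := by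
  have h1 : ∀ x : ℝ, F.map (evalRingHom x) = 0 := fun x => Polynomial.funext fun y => by
    rw [map_evalRingHom_eval, h, eval_zero]
  ext1 i
  refine Polynomial.funext fun x => ?_
  have := congrArg (fun p => p.coeff i) (h1 x)
  simpa using this

theorem eq_biTranslate_of_dvd (F : ℝ[X][X]) (hF : F ≠ 0) (a b : ℝ) (h : F ∣ biTranslate a b F) :
    biTranslate a b F = F := by
  obtain ⟨c, hc⟩ := h
  have hc0 : c ≠ 0 := fun h0 => by
    have := leadingCoeff_biTranslate a b F
    rw [hc, h0, mul_zero] at this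
    simp only [leadingCoeff_zero] at this
    exact hF (leadingCoeff_eq_zero.1 (leadingCoeff_eq_zero.1 this.symm))
  have hs : ∀ p : ℝ[X][X], p ≠ 0 → Bivariate.swap p ≠ 0 := fun p hp =>
    (map_ne_zero_iff _ Bivariate.swap.injective).2 hp
  have h1 : c.natDegree = 0 := by
    have := natDegree_biTranslate a b F
    rw [hc, natDegree_mul hF hc0] at this
    omega
  have h2 : (Bivariate.swap c).natDegree = 0 := by
    have := natDegree_biTranslate b a (Bivariate.swap F)
    rw [← swap_biTranslate, hc, map_mul, natDegree_mul (hs _ hF) (hs _ hc0)] at this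
    omega
  obtain ⟨f, rfl⟩ := natDegree_eq_zero.1 h1
  have h3 := natDegree_coeff_le_natDegree_swap (C f) 0
  rw [coeff_C_zero, h2] at h3
  obtain ⟨r, rfl⟩ := natDegree_eq_zero.1 (Nat.le_zero.1 h3)
  have := leadingCoeff_biTranslate a b F
  rw [hc, leadingCoeff_mul, leadingCoeff_mul, leadingCoeff_C, leadingCoeff_C] at this
  have hr : r = 1 := by
    refine mul_left_cancel₀ (fun h0 => hF ?_) (this.trans (mul_one _).symm)
    exact leadingCoeff_eq_zero.1 (leadingCoeff_eq_zero.1 h0)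
  rw [hc, hr]
  simp

theorem evalEval_add_smul_of_invariant (F : ℝ[X][X]) (a b : ℝ) (h : biTranslate a b F = F)
    (x y s : ℝ) : F.evalEval (x + s * a) (y + s * b) = F.evalEval x y := by
  let φ : ℝ[X][X] →+* ℝ[X] := eval₂RingHom (eval₂RingHom C (C x + C a * X)) (C y + C b * X)
  let p : ℝ[X] := φ F
  have hp : ∀ s : ℝ, p.eval s = F.evalEval (x + s * a) (y + s * b) := fun s => by
    have : (evalRingHom s).comp φ = evalEvalRingHom (x + s * a) (y + s * b) := by
      ext
      · simp [φ]
      · simp [φ, mul_comm s]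
      · simp [φ, mul_comm s]
    exact DFunLike.congr_fun this F
  have hn : ∀ n : ℕ, p.eval (n : ℝ) = p.eval 0 := fun n => by
    induction n with
    | zero => simp
    | succ n ih =>
      rw [← ih, hp, hp]
      conv_rhs => rw [← h, evalEval_biTranslate]
      congr 1 <;> push_cast <;> ring
  have hc : p - C (p.eval 0) = 0 := by
    refine eq_zero_of_infinite_isRoot _ (Set.Infinite.mono ?_
      (Set.infinite_range_of_injective (Nat.cast_injective (R := ℝ))))
    rintro _ ⟨n, rfl⟩
    simp [IsRoot, hn]
  have h1 := hp s
  have h2 := hp 0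
  rw [sub_eq_zero.1 hc, eval_C, h2] at h1
  simpa using h1.symm

theorem exists_large_fiber_of_invariant {Λ : Type*} [AddCommGroup Λ] (x y : Λ →+ ℝ)
    (F : ℝ[X][X]) (hF : F ≠ 0) (t : Finset Λ) (ht : ∀ l ∈ t, F.evalEval (x l) (y l) = 0) (a b : ℝ)
    (ha : a ≠ 0) (h : biTranslate a b F = F) (K : ℕ) (hK : F.natDegree * K < t.card) :
    ∃ A ⊆ t, K < A.card ∧ ∀ l ∈ A, ∀ l' ∈ A, x (l - l') * b = y (l - l') * a := by
  classical
  have h1 : ∀ u v : ℝ, F.evalEval u v = F.evalEval 0 (v - u * b / a) := fun u v => by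
    rw [← evalEval_add_smul_of_invariant F a b h u v (-u / a)]
    congr 1 <;> field_simp <;> ring
  let p : ℝ[X] := F.map (evalRingHom 0)
  have hp : ∀ s, p.eval s = F.evalEval 0 s := fun s => map_evalRingHom_eval _ _ _
  have hp0 : p ≠ 0 := fun h0 => hF (eq_zero_of_evalEval_eq_zero F fun u v => by
    rw [h1, ← hp, h0, eval_zero])
  have hcard : p.roots.toFinset.card * K < t.card := by
    refine lt_of_le_of_lt (Nat.mul_le_mul_right _ ?_) hK
    exact (Multiset.toFinset_card_le _).trans ((card_roots' p).trans natDegree_map_le)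
  obtain ⟨s, hs, hs'⟩ := Finset.exists_lt_card_fiber_of_mul_lt_card_of_maps_to
    (f := fun l => y l - x l * b / a) (fun l hl => by
      rw [Multiset.mem_toFinset, mem_roots hp0, IsRoot, hp, ← h1]
      exact ht l hl) hcard
  refine ⟨_, Finset.filter_subset _ _, hs', fun l hl l' hl' => ?_⟩
  have h2 := (Finset.mem_filter.1 hl).2.trans (Finset.mem_filter.1 hl').2.symm
  rw [map_sub, map_sub]
  field_simp at h2
  linarith

theorem exists_line_of_common_zeros {Λ : Type*} [AddCommGroup Λ] (x y : Λ →+ ℝ) (R : ℝ[X][X])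
    (hR : R ≠ 0) (P Δ : Finset Λ) (hP : ∀ l ∈ P, R.evalEval (x l) (y l) = 0)
    (hx : Set.InjOn x P) (hΔ : ∀ l ∈ P, ∀ l' ∈ P, l' - l ∈ Δ) (K : ℕ) (hK0 : 0 < K)
    (hK : Δ.card ≤ K ^ 2) (hRK : (R.natDegree + (Bivariate.swap R).natDegree) * K < P.card) :
    ∃ g : Λ, x g ≠ 0 ∧ ∃ A ⊆ P, K < A.card ∧
      ∀ l ∈ A, ∀ l' ∈ A, x (l - l') * y g = y (l - l') * x g := by
  classical
  obtain ⟨F, hF, t, htP, ht, htK⟩ :=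
    exists_irreducible_factor_of_many_zeros (fun l => x l) (fun l => y l) K R hR P hP hRK
  set D := F.natDegree + (Bivariate.swap F).natDegree with hD
  suffices h : ∃ g, x g ≠ 0 ∧ F ∣ biTranslate (x g) (y g) F by
    obtain ⟨g, hg, hdvd⟩ := h
    obtain ⟨A, hA, hA'⟩ := exists_large_fiber_of_invariant x y F hF.ne_zero t ht _ _ hg
      (eq_biTranslate_of_dvd F hF.ne_zero _ _ hdvd) K (lt_of_le_of_lt (by gcongr; omega) htK)
    exact ⟨g, hg, A, hA.trans htP, hA'⟩
  by_contra! hcon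
  have hfib : ∀ g ∈ Δ, g ≠ 0 →
      ((t ×ˢ t).filter fun p => p.2 - p.1 = g).card ≤ D ^ 2 := fun g _ hg => by
    by_cases hxg : x g = 0
    · rw [Finset.card_eq_zero.2]
      · exact Nat.zero_le _
      refine Finset.filter_eq_empty_iff.2 fun p hp h => hg ?_
      rw [Finset.mem_product] at hp
      have h1 : x p.2 = x p.1 := by rw [← sub_eq_zero, ← map_sub, h, hxg]
      rw [← h, sub_eq_zero]
      exact hx (htP hp.2) (htP hp.1) h1
    · have hinj : Set.InjOn Prod.fst
          (((t ×ˢ t).filter fun p => p.2 - p.1 = g : Finset (Λ × Λ)) : Set (Λ × Λ)) := by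
        intro p hp p' hp' h
        have h1 := (Finset.mem_filter.1 hp).2
        have h2 := (Finset.mem_filter.1 hp').2
        refine Prod.ext h ?_
        rw [sub_eq_iff_eq_add] at h1 h2
        rw [h1, h2, h]
      rw [← Finset.card_image_of_injOn hinj]
      have hmem : ∀ l ∈ ((t ×ˢ t).filter fun p => p.2 - p.1 = g).image Prod.fst,
          l ∈ t ∧ l + g ∈ t := fun l hl => by
        obtain ⟨p, hp, rfl⟩ := Finset.mem_image.1 hl
        obtain ⟨hp, h⟩ := Finset.mem_filter.1 hp
        rw [Finset.mem_product] at hp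
        refine ⟨hp.1, ?_⟩
        rw [← h]
        simpa using hp.2
      refine card_common_zeros_le F (biTranslate (x g) (y g) F) hF (hcon g hxg)
        (natDegree_biTranslate _ _ _) (by rw [swap_biTranslate, natDegree_biTranslate])
        (fun l => x l) (fun l => y l) _ (fun l hl l' hl' h => hx (htP (hmem l hl).1)
          (htP (hmem l' hl').1) h) (fun l hl => ht l (hmem l hl).1) (fun l hl => ?_)
      rw [evalEval_biTranslate, ← map_add, ← map_add]
      exact ht _ (hmem l hl).2
  have hfib0 : ((t ×ˢ t).filter fun p => p.2 - p.1 = 0).card ≤ t.card := by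
    refine Finset.card_le_card_of_injOn Prod.fst (fun p hp => ?_) fun p hp p' hp' h => ?_
    · exact (Finset.mem_product.1 (Finset.mem_filter.1 hp).1).1
    · have h1 := (Finset.mem_filter.1 hp).2
      have h2 := (Finset.mem_filter.1 hp').2
      rw [sub_eq_zero] at h1 h2
      exact Prod.ext h (by rw [h1, h2, h])
  have hsq : t.card * t.card ≤ t.card + Δ.card * D ^ 2 := by
    rw [← Finset.card_product, Finset.card_eq_sum_card_fiberwise (t := Δ)
      (f := fun p : Λ × Λ => p.2 - p.1) (fun p hp => by
        obtain ⟨h1, h2⟩ := Finset.mem_product.1 hp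
        exact hΔ _ (htP h1) _ (htP h2))]
    calc _ ≤ ∑ g ∈ Δ, ((if g = 0 then t.card else 0) + D ^ 2) := by
            refine Finset.sum_le_sum fun g hg => ?_
            split_ifs with h
            · rw [h]; omega
            · have := hfib g hg h
              omega
      _ ≤ _ := by
        rw [Finset.sum_add_distrib, Finset.sum_const, smul_eq_mul]
        gcongr
        rw [Finset.sum_ite_eq']
        split_ifs <;> simp
  have hD0 : 0 < D := by
    by_contra! h0
    obtain ⟨f, hf⟩ := natDegree_eq_zero.1 (show F.natDegree = 0 by omega)
    have h3 := natDegree_coeff_le_natDegree_swap F 0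
    rw [show (Bivariate.swap F).natDegree = 0 by omega, ← hf, coeff_C_zero] at h3
    obtain ⟨r, rfl⟩ := natDegree_eq_zero.1 (Nat.le_zero.1 h3)
    obtain ⟨l, hl⟩ := Finset.card_pos.1 (Nat.zero_lt_of_lt htK)
    have h4 := ht l hl
    rw [← hf, evalEval_C, eval_C] at h4
    exact hF.ne_zero (by rw [← hf, h4]; simp)
  have h5 : Δ.card * D ^ 2 ≤ K ^ 2 * D ^ 2 := Nat.mul_le_mul_right _ hK
  have h6 : 0 < D * K := Nat.mul_pos hD0 hK0
  nlinarith

end TranslationInvariance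

section Biquadratic

theorem eq_zero_of_sq_eq_mul_sq {d : ℕ} (hd : ¬ IsSquare d) {x y : ℤ} (h : x ^ 2 = d * y ^ 2) :
    x = 0 ∧ y = 0 := by
  have hy : y = 0 := by
    by_contra hy
    obtain ⟨k, rfl⟩ := (Int.pow_dvd_pow_iff two_ne_zero).1 (Dvd.intro_left _ h.symm)
    have h1 : k ^ 2 = d := by
      have := pow_ne_zero 2 hy
      rw [mul_pow, mul_comm] at h
      exact mul_right_cancel₀ this h
    refine hd ⟨k.natAbs, ?_⟩
    zify
    rw [← h1, ← sq, sq_abs]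
  subst hy
  exact ⟨by simpa using h, rfl⟩

theorem eq_zero_of_biquadratic_norm_eq_zero {d₁ d₂ : ℕ} (h1 : ¬ IsSquare d₁) (h2 : ¬ IsSquare d₂)
    (h12 : ¬ IsSquare (d₁ * d₂)) {a b c e : ℤ}
    (h : (a ^ 2 + c ^ 2 * d₂ - d₁ * (b ^ 2 + e ^ 2 * d₂)) ^ 2 =
      d₂ * (2 * a * c - 2 * d₁ * b * e) ^ 2) : a = 0 ∧ b = 0 ∧ c = 0 ∧ e = 0 := by
  have hd2 : (d₂ : ℤ) ≠ 0 := by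
    rintro h0
    exact h2 ⟨0, by simpa using h0⟩
  obtain ⟨hP, hQ⟩ := eq_zero_of_sq_eq_mul_sq h2 h
  have hQ' : a * c = d₁ * b * e := by linarith
  have h3 : (a ^ 2 - d₁ * b ^ 2) * (a ^ 2 - d₁ * d₂ * e ^ 2) = 0 := by
    linear_combination a ^ 2 * hP - d₂ * (a * c + d₁ * b * e) * hQ'
  rcases mul_eq_zero.1 h3 with h3 | h3
  · obtain ⟨rfl, rfl⟩ := eq_zero_of_sq_eq_mul_sq h1 (sub_eq_zero.1 h3)
    have h4 : c ^ 2 = d₁ * e ^ 2 := by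
      refine mul_left_cancel₀ hd2 ?_
      linear_combination hP
    obtain ⟨rfl, rfl⟩ := eq_zero_of_sq_eq_mul_sq h1 h4
    simp
  · obtain ⟨rfl, rfl⟩ := eq_zero_of_sq_eq_mul_sq h12 (x := a) (y := e)
      (by push_cast; linear_combination h3)
    obtain ⟨h5, rfl⟩ := eq_zero_of_sq_eq_mul_sq h12 (x := d₂ * c) (y := b)
      (by push_cast; linear_combination d₂ * hP)
    have := (mul_eq_zero.1 h5).resolve_left hd2
    simp [this]

/-- The four conjugates of `a + b√d₁ + c√d₂ + e√(d₁d₂)`. -/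
noncomputable def biquadraticConj (d₁ d₂ : ℕ) (a b c e : ℤ) : Fin 4 → ℝ :=
  ![a + b * √d₁ + c * √d₂ + e * (√d₁ * √d₂), a - b * √d₁ + c * √d₂ - e * (√d₁ * √d₂),
    a + b * √d₁ - c * √d₂ - e * (√d₁ * √d₂), a - b * √d₁ - c * √d₂ + e * (√d₁ * √d₂)]

theorem prod_biquadraticConj (d₁ d₂ : ℕ) (a b c e : ℤ) :
    ∏ k, biquadraticConj d₁ d₂ a b c e k =
      (((a ^ 2 + c ^ 2 * d₂ - d₁ * (b ^ 2 + e ^ 2 * d₂)) ^ 2 -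
      d₂ * (2 * a * c - 2 * d₁ * b * e) ^ 2 : ℤ) : ℝ) := by
  have h1 : √(d₁ : ℝ) ^ 2 = d₁ := sq_sqrt (Nat.cast_nonneg _)
  have h2 : √(d₂ : ℝ) ^ 2 = d₂ := sq_sqrt (Nat.cast_nonneg _)
  rw [Fin.prod_univ_four]
  simp only [biquadraticConj, Matrix.cons_val]
  push_cast
  generalize √(d₁ : ℝ) = s at *
  generalize √(d₂ : ℝ) = t at *
  rw [← h1, ← h2]
  ring

theorem eq_zero_of_biquadraticConj_eq_zero {d₁ d₂ : ℕ} (h1 : ¬ IsSquare d₁) (h2 : ¬ IsSquare d₂)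
    (h12 : ¬ IsSquare (d₁ * d₂)) {a b c e : ℤ} {k : Fin 4}
    (h : biquadraticConj d₁ d₂ a b c e k = 0) : a = 0 ∧ b = 0 ∧ c = 0 ∧ e = 0 := by
  refine eq_zero_of_biquadratic_norm_eq_zero h1 h2 h12 ?_
  have := prod_biquadraticConj d₁ d₂ a b c e
  rw [Finset.prod_eq_zero (Finset.mem_univ k) h] at this
  exact sub_eq_zero.1 (by exact_mod_cast this.symm)

theorem one_le_abs_prod_biquadraticConj {d₁ d₂ : ℕ} (h1 : ¬ IsSquare d₁) (h2 : ¬ IsSquare d₂)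
    (h12 : ¬ IsSquare (d₁ * d₂)) {a b c e : ℤ} (h : biquadraticConj d₁ d₂ a b c e 0 ≠ 0) :
    1 ≤ |∏ k, biquadraticConj d₁ d₂ a b c e k| := by
  have h0 : ∏ k, biquadraticConj d₁ d₂ a b c e k ≠ 0 := fun h0 => by
    obtain ⟨k, -, hk⟩ := Finset.prod_eq_zero_iff.1 h0
    obtain ⟨rfl, rfl, rfl, rfl⟩ := eq_zero_of_biquadraticConj_eq_zero h1 h2 h12 hk
    exact h (by simp [biquadraticConj])
  rw [prod_biquadraticConj] at h0 ⊢
  rw [← Int.cast_abs]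
  exact_mod_cast Int.one_le_abs (by exact_mod_cast h0)

/-- The order `ℤ[√d₁, √d₂]`, realised through its four real embeddings. -/
noncomputable def biquadraticOrder (d₁ d₂ : ℕ) : Subring (Fin 4 → ℝ) where
  carrier := {f | ∃ a b c e : ℤ, f = biquadraticConj d₁ d₂ a b c e}
  zero_mem' := ⟨0, 0, 0, 0, by ext k; fin_cases k <;> simp [biquadraticConj]⟩
  one_mem' := ⟨1, 0, 0, 0, by ext k; fin_cases k <;> simp [biquadraticConj]⟩
  neg_mem' := by
    rintro _ ⟨a, b, c, e, rfl⟩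
    refine ⟨-a, -b, -c, -e, ?_⟩
    ext k
    fin_cases k <;> simp [biquadraticConj] <;> ring
  add_mem' := by
    rintro _ _ ⟨a, b, c, e, rfl⟩ ⟨a', b', c', e', rfl⟩
    refine ⟨a + a', b + b', c + c', e + e', ?_⟩
    ext k
    fin_cases k <;> simp [biquadraticConj] <;> ring
  mul_mem' := by
    rintro _ _ ⟨a, b, c, e, rfl⟩ ⟨a', b', c', e', rfl⟩
    have h1 : √(d₁ : ℝ) ^ 2 = d₁ := sq_sqrt (Nat.cast_nonneg _)
    have h2 : √(d₂ : ℝ) ^ 2 = d₂ := sq_sqrt (Nat.cast_nonneg _)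
    refine ⟨a * a' + d₁ * b * b' + d₂ * c * c' + d₁ * d₂ * e * e',
      a * b' + b * a' + d₂ * (c * e' + e * c'), a * c' + c * a' + d₁ * (b * e' + e * b'),
      a * e' + e * a' + b * c' + c * b', ?_⟩
    ext k
    generalize hs : √(d₁ : ℝ) = s at *
    generalize ht : √(d₂ : ℝ) = t at *
    fin_cases k <;> simp [biquadraticConj, hs, ht] <;> rw [← h1, ← h2] <;> ring

/-- The real embeddings of `biquadraticOrder`. -/
noncomputable def biquadraticEval (d₁ d₂ : ℕ) (k : Fin 4) : biquadraticOrder d₁ d₂ →+* ℝ :=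
  (Pi.evalRingHom (fun _ => ℝ) k).comp (biquadraticOrder d₁ d₂).subtype

theorem one_le_abs_prod_biquadraticEval {d₁ d₂ : ℕ} (h1 : ¬ IsSquare d₁) (h2 : ¬ IsSquare d₂)
    (h12 : ¬ IsSquare (d₁ * d₂)) (z : biquadraticOrder d₁ d₂) (h : biquadraticEval d₁ d₂ 0 z ≠ 0) :
    1 ≤ |∏ k, biquadraticEval d₁ d₂ k z| := by
  obtain ⟨_, a, b, c, e, rfl⟩ := z
  exact one_le_abs_prod_biquadraticConj h1 h2 h12 h

theorem exists_pow_eq_add_mul_sqrt (d x y : ℕ) (hx : 0 < x) (hy : 0 < y) (n : ℕ) :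
    ∃ p q : ℕ, 0 < p ∧ ((x : ℝ) + y * √d) ^ n = p + q * √d ∧ (0 < n → 0 < q) := by
  induction n with
  | zero => exact ⟨1, 0, one_pos, by simp, by simp⟩
  | succ n ih =>
    obtain ⟨p, q, hp, h, -⟩ := ih
    refine ⟨p * x + q * y * d, p * y + q * x, by positivity, ?_, fun _ => by positivity⟩
    have h1 : √(d : ℝ) ^ 2 = d := sq_sqrt (Nat.cast_nonneg _)
    rw [pow_succ, h]
    push_cast
    generalize √(d : ℝ) = s at *
    rw [← h1]
    ring

theorem log_units_independent {d₁ d₂ : ℕ} (h1 : ¬ IsSquare d₁) (h2 : ¬ IsSquare d₂)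
    (h12 : ¬ IsSquare (d₁ * d₂)) {x₁ y₁ x₂ y₂ : ℕ} (hx₁ : 0 < x₁) (hy₁ : 0 < y₁) (hx₂ : 0 < x₂)
    (hy₂ : 0 < y₂) {l₁ l₂ : ℝ} (hl₁ : exp l₁ = x₁ + y₁ * √d₁) (hl₂ : exp l₂ = x₂ + y₂ * √d₂)
    (hl₁0 : 0 < l₁) (hl₂0 : 0 < l₂) (u v : ℤ) (h : u * l₁ + v * l₂ = 0) : u = 0 ∧ v = 0 := by
  have key : ∀ a b : ℕ, a * l₁ = b * l₂ → a = 0 := fun a b hab => by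
    by_contra ha
    obtain ⟨p, q, -, hpq, hq⟩ := exists_pow_eq_add_mul_sqrt d₁ x₁ y₁ hx₁ hy₁ a
    obtain ⟨r, s, -, hrs, -⟩ := exists_pow_eq_add_mul_sqrt d₂ x₂ y₂ hx₂ hy₂ b
    rw [← hl₁, ← exp_nat_mul, hab, exp_nat_mul, hl₂, hrs] at hpq
    have := eq_zero_of_biquadraticConj_eq_zero h1 h2 h12 (a := (p : ℤ) - r) (b := q) (c := -s)
      (e := 0) (k := 0) (by simp [biquadraticConj]; linarith)
    have := hq (Nat.pos_of_ne_zero ha)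
    omega
  have hu : u = 0 := by
    rcases le_or_gt 0 u with hu | hu <;> rcases le_or_gt 0 v with hv | hv
    · have : (0 : ℝ) ≤ v * l₂ := mul_nonneg (by exact_mod_cast hv) hl₂0.le
      have h0 : (0 : ℝ) ≤ u * l₁ := mul_nonneg (by exact_mod_cast hu) hl₁0.le
      have : (u : ℝ) * l₁ = 0 := by linarith
      exact_mod_cast (mul_eq_zero.1 this).resolve_right hl₁0.ne'
    · lift u to ℕ using hu
      obtain ⟨w, rfl⟩ : ∃ w : ℕ, v = -w := ⟨v.natAbs, by omega⟩
      exact_mod_cast key u w (by push_cast at h; linarith)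
    · obtain ⟨w, rfl⟩ : ∃ w : ℕ, u = -w := ⟨u.natAbs, by omega⟩
      lift v to ℕ using hv
      have := key w v (by push_cast at h; linarith)
      simp [this]
    · have h1 : (v : ℝ) * l₂ < 0 := mul_neg_of_neg_of_pos (by exact_mod_cast hv) hl₂0
      have h2 : (u : ℝ) * l₁ < 0 := mul_neg_of_neg_of_pos (by exact_mod_cast hu) hl₁0
      linarith
  subst hu
  refine ⟨rfl, ?_⟩
  have : (v : ℝ) * l₂ = 0 := by simpa using h
  exact_mod_cast (mul_eq_zero.1 this).resolve_right hl₂0.ne'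

end Biquadratic

section Regulator

/-- The square roots of `d` modulo `n`, as natural numbers below `n`. -/
def sqrtMod (d n : ℕ) : Finset ℕ := (Finset.range n).filter fun r => (n : ℤ) ∣ (r : ℤ) ^ 2 - d

theorem mem_sqrtMod {d n r : ℕ} : r ∈ sqrtMod d n ↔ r < n ∧ (n : ℤ) ∣ (r : ℤ) ^ 2 - d := by
  simp [sqrtMod]

theorem dvd_two_of_sq_dvd_four_mul {d : ℕ} (hd : Squarefree d) {h : ℕ} (hh : h ^ 2 ∣ 4 * d) :
    h ∣ 2 := by
  rcases Nat.even_or_odd h with ⟨k, rfl⟩ | ho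
  · have h1 : k * k ∣ d := by
      refine Nat.dvd_of_mul_dvd_mul_left (show 0 < 4 by norm_num) ?_
      convert hh using 1
      ring
    have := Nat.isUnit_iff.1 (hd k h1)
    subst this
    norm_num
  · have h1 : Nat.Coprime (h ^ 2) 4 := by
      rw [show 4 = 2 ^ 2 by norm_num]
      exact Nat.Coprime.pow 2 2 ho.coprime_two_right
    have h2 := h1.dvd_of_dvd_mul_left hh
    rw [sq] at h2
    have := Nat.isUnit_iff.1 (hd h h2)
    simp [this]

theorem card_sqrtMod_le {d : ℕ} (hd : Squarefree d) {n : ℕ} (hn : 0 < n) :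
    (sqrtMod d n).card ≤ 2 * n.divisors.card := by
  classical
  rcases (sqrtMod d n).eq_empty_or_nonempty with h0 | ⟨r₀, hr₀⟩
  · simp [h0]
  have hr₀' := (mem_sqrtMod.1 hr₀).2
  refine Finset.card_le_mul_card_image_of_maps_to (f := fun r : ℕ => Int.gcd (r - r₀) n)
    (fun r _ => Nat.mem_divisors.2 ⟨?_, hn.ne'⟩) 2 fun g _ => ?_
  · exact_mod_cast Int.gcd_dvd_right ((r : ℤ) - r₀) n
  rcases (Finset.filter (fun r : ℕ => Int.gcd (r - r₀) n = g) (sqrtMod d n)).eq_empty_or_nonempty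
    with h0 | ⟨r₁, hr₁⟩
  · simp [h0]
  have key : ∀ r ∈ Finset.filter (fun r : ℕ => Int.gcd (r - r₀) n = g) (sqrtMod d n),
      ∃ m : ℤ, (n : ℤ) = g * m ∧ (g : ℤ) ∣ r - r₀ ∧ m ∣ r + r₀ := fun r hr => by
    obtain ⟨hr, hg⟩ := Finset.mem_filter.1 hr
    have h1 := (mem_sqrtMod.1 hr).2
    have h2 : (n : ℤ) ∣ (r - r₀) * (r + r₀) := by
      convert dvd_sub h1 hr₀' using 2
      all_goals first | rfl | ring
    obtain ⟨m, hm⟩ : (g : ℤ) ∣ n := hg ▸ Int.gcd_dvd_right _ _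
    obtain ⟨z, hz⟩ : (g : ℤ) ∣ r - r₀ := hg ▸ Int.gcd_dvd_left _ _
    refine ⟨m, hm, ⟨z, hz⟩, ?_⟩
    have hg0 : (g : ℤ) ≠ 0 := by
      rintro h0
      rw [h0, zero_mul] at hm
      omega
    have hcop : IsCoprime m z := by
      have h3 := Int.gcd_eq_gcd_ab ((r : ℤ) - r₀) n
      rw [hg] at h3
      refine ⟨Int.gcdB ((r : ℤ) - r₀) n, Int.gcdA ((r : ℤ) - r₀) n, mul_left_cancel₀ hg0 ?_⟩
      calc _ = (↑g * z) * Int.gcdA ((r : ℤ) - r₀) n + (↑g * m) * Int.gcdB ((r : ℤ) - r₀) n := by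
            ring
        _ = _ := by rw [← hz, ← hm, ← h3, mul_one]
    rw [hm, hz, mul_assoc] at h2
    exact hcop.dvd_of_dvd_mul_left ((mul_dvd_mul_iff_left hg0).1 h2)
  obtain ⟨m, hm, hg1, hm1⟩ := key r₁ hr₁
  have hg0 : (g : ℤ) ≠ 0 := by
    rintro h0
    rw [h0, zero_mul] at hm
    omega
  have hh2 : Int.gcd g m ∣ 2 := by
    refine dvd_two_of_sq_dvd_four_mul hd ?_
    have h1 : (Int.gcd g m : ℤ) ∣ 2 * r₀ := by
      convert dvd_sub ((Int.gcd_dvd_right (g : ℤ) m).trans hm1)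
        ((Int.gcd_dvd_left (g : ℤ) m).trans hg1) using 2
      all_goals first | rfl | ring
    have h2 : (Int.gcd g m : ℤ) ^ 2 ∣ n := by
      rw [hm, sq]
      exact mul_dvd_mul (Int.gcd_dvd_left _ _) (Int.gcd_dvd_right _ _)
    have h3 := dvd_sub (pow_dvd_pow_of_dvd h1 2) (dvd_mul_of_dvd_right (h2.trans hr₀') 4)
    zify
    convert h3 using 2
    all_goals first | rfl | ring
  have hdvd : ∀ r ∈ Finset.filter (fun r : ℕ => Int.gcd (r - r₀) n = g) (sqrtMod d n),
      (n : ℤ) ∣ 2 * (r - r₁) := fun r hr => by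
    obtain ⟨m', hm', hg2, hm2⟩ := key r hr
    obtain rfl : m' = m := mul_left_cancel₀ hg0 (hm'.symm.trans hm)
    have h1 : (g : ℤ) ∣ r - r₁ := by
      convert dvd_sub hg2 hg1 using 1
      all_goals first | rfl | ring
    have h2 : m' ∣ (r : ℤ) - r₁ := by
      convert dvd_sub hm2 hm1 using 1
      all_goals first | rfl | ring
    refine Dvd.dvd.trans ?_ (mul_dvd_mul_right (Int.natCast_dvd_natCast.2 hh2) ((r : ℤ) - r₁))
    rw [Int.gcd_eq_gcd_ab, hm, add_mul]
    refine dvd_add ?_ ?_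
    · rw [mul_assoc]
      exact mul_dvd_mul_left _ (h2.mul_left _)
    · rw [mul_comm (g : ℤ) m', mul_assoc]
      exact mul_dvd_mul_left _ (h1.mul_left _)
  refine (Finset.card_le_card (t := {r₁, if 2 * r₁ < n then (2 * r₁ + n) / 2
    else (2 * r₁ - n) / 2}) fun r hr => ?_).trans Finset.card_le_two
  obtain ⟨k, hk⟩ := hdvd r hr
  have hrn := (mem_sqrtMod.1 (Finset.mem_filter.1 hr).1).1
  have hrn1 := (mem_sqrtMod.1 (Finset.mem_filter.1 hr₁).1).1
  have hk1 : k < 2 := by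
    by_contra! h
    nlinarith
  have hk2 : -2 < k := by
    by_contra! h
    nlinarith
  rw [Finset.mem_insert, Finset.mem_singleton]
  interval_cases k <;> split_ifs <;> omega

theorem sum_card_divisors_le (X : ℕ) :
    ((∑ n ∈ Finset.Icc 1 X, n.divisors.card : ℕ) : ℝ) ≤ X * (1 + log X) := by
  have h1 : ∀ n ∈ Finset.Icc 1 X, n.divisors.card = ∑ a ∈ Finset.Icc 1 X, if a ∣ n then 1 else 0 :=
    fun n hn => by
      rw [Finset.mem_Icc] at hn
      rw [← Finset.card_filter]
      congr 1
      ext a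
      simp only [Nat.mem_divisors, Finset.mem_filter, Finset.mem_Icc]
      constructor
      · rintro ⟨h, -⟩
        exact ⟨⟨Nat.pos_of_dvd_of_pos h hn.1, (Nat.le_of_dvd hn.1 h).trans hn.2⟩, h⟩
      · rintro ⟨-, h⟩
        exact ⟨h, by omega⟩
  rw [Finset.sum_congr rfl h1, Finset.sum_comm]
  have h2 : ∀ a ∈ Finset.Icc 1 X, (∑ n ∈ Finset.Icc 1 X, if a ∣ n then 1 else 0) = X / a :=
    fun a ha => by
      rw [← Finset.card_filter, ← Nat.Ioc_filter_dvd_card_eq_div]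
      rfl
  rw [Finset.sum_congr rfl h2]
  push_cast
  have h3 := harmonic_le_one_add_log X
  rw [harmonic_eq_sum_Icc] at h3
  push_cast at h3
  calc ∑ a ∈ Finset.Icc 1 X, ((X / a : ℕ) : ℝ) ≤ ∑ a ∈ Finset.Icc 1 X, (X : ℝ) * (a : ℝ)⁻¹ :=
        Finset.sum_le_sum fun a _ => by
          rw [← div_eq_mul_inv]
          exact Nat.cast_div_le
    _ ≤ _ := by
      rw [← Finset.mul_sum]
      gcongr

end Regulator

section PellBound

theorem exists_coprime_abs_sub_lt {d : ℕ} (hd : 1 < d) (t : ℕ) :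
    ∃ x y : ℕ, 0 < x ∧ 0 < y ∧ Nat.Coprime x y ∧ y ≤ 2 ^ t ∧ |(x : ℝ) - y * √d| < 1 / 2 ^ t := by
  obtain ⟨q, hq, hqt⟩ := Real.exists_rat_abs_sub_le_and_den_le (√d) (n := 2 ^ t) (by positivity)
  have hd1 : 1 < √(d : ℝ) := by
    rw [Real.lt_sqrt zero_le_one]
    exact_mod_cast (by simpa using hd)
  have hden : (0 : ℝ) < q.den := by exact_mod_cast q.pos
  have h1 : |(q.num : ℝ) - q.den * √d| < 1 / 2 ^ t := by
    have h2 : (q.num : ℝ) - q.den * √d = -(q.den * (√d - q)) := by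
      have : (q : ℝ) * q.den = q.num := by exact_mod_cast Rat.mul_den_eq_num q
      rw [← this]
      ring
    rw [h2, abs_neg, abs_mul, abs_of_pos hden]
    calc _ ≤ (q.den : ℝ) * (1 / (((2 ^ t : ℕ) + 1) * q.den)) := by gcongr
      _ = 1 / (2 ^ t + 1) := by
        push_cast
        field_simp
      _ < _ := by
        apply one_div_lt_one_div_of_lt (by positivity)
        linarith
  have h3 : 0 < q.num := by
    have h4 := (abs_lt.1 h1).1
    have h5 : (1 : ℝ) / 2 ^ t ≤ 1 := by
      rw [div_le_one (by positivity)]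
      exact one_le_pow₀ (by norm_num)
    have h6 : (1 : ℝ) ≤ q.den := by exact_mod_cast q.pos
    have : (0 : ℝ) < q.num := by nlinarith
    exact_mod_cast this
  obtain ⟨x, hx⟩ := Int.eq_ofNat_of_zero_le h3.le
  refine ⟨x, q.den, by omega, q.pos, ?_, by exact_mod_cast hqt, ?_⟩
  · have := q.reduced
    rwa [hx] at this
  · rw [hx] at h1
    exact_mod_cast h1

theorem exists_pell_of_congruent {d n x y x' y' : ℕ} (r : ℕ) (hn : 0 < n) (hx : 0 < x) (hy : 0 < y)
    (hN : (x : ℤ) ^ 2 - d * y ^ 2 = x' ^ 2 - d * y' ^ 2)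
    (hNn : ((x : ℤ) ^ 2 - d * y ^ 2) ^ 2 = n ^ 2) (hr : (n : ℤ) ∣ r ^ 2 - d)
    (h : (n : ℤ) ∣ x - r * y) (h' : (n : ℤ) ∣ x' - r * y') (hne : ¬ (x = x' ∧ y = y')) :
    ∃ u v : ℕ, 0 < u ∧ 0 < v ∧ u ^ 2 = d * v ^ 2 + 1 ∧
      (u : ℝ) + v * √d ≤ (x + y * √d) * (x' + y' * √d) := by
  obtain ⟨U, hU⟩ : (n : ℤ) ∣ x * x' - d * y * y' := by
    have : (x : ℤ) * x' - d * y * y' = (x - r * y) * x' + (x' - r * y') * (r * y) +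
        (r ^ 2 - d) * (y * y') := by ring
    rw [this]
    exact dvd_add (dvd_add (h.mul_right _) (h'.mul_right _)) (hr.mul_right _)
  obtain ⟨V, hV⟩ : (n : ℤ) ∣ y * x' - x * y' := by
    have : (y : ℤ) * x' - x * y' = (x' - r * y') * y - (x - r * y) * y' := by ring
    rw [this]
    exact dvd_sub (h'.mul_right _) (h.mul_right _)
  have hn0 : (n : ℤ) ≠ 0 := by exact_mod_cast hn.ne'
  have hUV : U ^ 2 = d * V ^ 2 + 1 := by
    refine mul_left_cancel₀ (pow_ne_zero 2 hn0) ?_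
    have h1 : (n * U : ℤ) ^ 2 = d * (n * V) ^ 2 + n ^ 2 := by
      rw [← hU, ← hV, ← hNn]
      linear_combination (-(x : ℤ) ^ 2 + d * y ^ 2) * hN
    linear_combination h1
  have hV0 : V ≠ 0 := by
    rintro rfl
    rw [mul_zero, sub_eq_zero] at hV
    have h2 : ((x : ℤ) ^ 2 - d * y ^ 2) * (y' ^ 2 - y ^ 2) = 0 := by
      linear_combination (-(y : ℤ) ^ 2) * hN - (y * x' + x * y') * hV
    have h3 : ((x : ℤ) ^ 2 - d * y ^ 2) ≠ 0 := fun h0 => by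
      rw [h0] at hNn
      exact pow_ne_zero 2 hn0 (by simpa using hNn.symm)
    have h4 := sub_eq_zero.1 ((mul_eq_zero.1 h2).resolve_left h3)
    have h5 : y' = y := Nat.pow_left_injective two_ne_zero (by exact_mod_cast h4)
    subst h5
    have : (y' : ℤ) * x' = y' * x := by rw [hV, mul_comm]
    exact hne ⟨by exact_mod_cast (mul_left_cancel₀ (by exact_mod_cast hy.ne') this).symm, rfl⟩
  have hU0 : U ≠ 0 := by
    rintro rfl
    nlinarith [mul_nonneg (Nat.cast_nonneg (α := ℤ) d) (sq_nonneg V)]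
  refine ⟨U.natAbs, V.natAbs, Int.natAbs_pos.2 hU0, Int.natAbs_pos.2 hV0, ?_, ?_⟩
  · zify
    rw [sq_abs, sq_abs, hUV]
  · have hn1 : (1 : ℤ) ≤ n := by exact_mod_cast hn
    have h1 : |U| ≤ x * x' + d * y * y' := by
      calc |U| ≤ n * |U| := le_mul_of_one_le_left (abs_nonneg _) hn1
        _ = |(x : ℤ) * x' - d * y * y'| := by rw [hU, abs_mul, abs_of_pos (by omega : (0 : ℤ) < n)]
        _ ≤ _ := by
          rw [abs_le]
          constructor <;> nlinarith [show (0 : ℤ) ≤ x * x' by positivity,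
            show (0 : ℤ) ≤ d * y * y' by positivity]
    have h2 : |V| ≤ y * x' + x * y' := by
      calc |V| ≤ n * |V| := le_mul_of_one_le_left (abs_nonneg _) hn1
        _ = |(y : ℤ) * x' - x * y'| := by rw [hV, abs_mul, abs_of_pos (by omega : (0 : ℤ) < n)]
        _ ≤ _ := by
          rw [abs_le]
          constructor <;> nlinarith [show (0 : ℤ) ≤ x * y' by positivity,
            show (0 : ℤ) ≤ y * x' by positivity]
    have h3 : ((U.natAbs : ℕ) : ℝ) ≤ x * x' + d * y * y' := by
      rw [Nat.cast_natAbs]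
      exact_mod_cast h1
    have h4 : ((V.natAbs : ℕ) : ℝ) ≤ y * x' + x * y' := by
      rw [Nat.cast_natAbs]
      exact_mod_cast h2
    have h5 : √(d : ℝ) ^ 2 = d := sq_sqrt (Nat.cast_nonneg _)
    have h6 := mul_le_mul_of_nonneg_right h4 (sqrt_nonneg (d : ℝ))
    calc _ ≤ (x * x' + d * y * y' : ℝ) + (y * x' + x * y') * √d := by linarith
      _ = _ := by linear_combination (-(y : ℝ) * y') * h5

theorem sum_card_sqrtMod_le {d : ℕ} (hd : Squarefree d) (X : ℕ) :
    ((∑ j ∈ Finset.range (X + 1), ∑ n ∈ Finset.Icc 1 (X / 2 ^ j), (sqrtMod d n).card : ℕ) : ℝ) ≤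
      4 * X * (1 + log X) := by
  have h1 : ∀ j : ℕ, ((∑ n ∈ Finset.Icc 1 (X / 2 ^ j), (sqrtMod d n).card : ℕ) : ℝ) ≤
      2 * (X * (1 + log X)) * (1 / 2) ^ j := fun j => by
    have h2 : ∑ n ∈ Finset.Icc 1 (X / 2 ^ j), (sqrtMod d n).card ≤
        2 * ∑ n ∈ Finset.Icc 1 (X / 2 ^ j), n.divisors.card := by
      rw [Finset.mul_sum]
      exact Finset.sum_le_sum fun n hn => card_sqrtMod_le hd (Finset.mem_Icc.1 hn).1
    have h3 : log ((X / 2 ^ j : ℕ) : ℝ) ≤ log X := by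
      rcases Nat.eq_zero_or_pos (X / 2 ^ j) with h0 | h0
      · rw [h0]
        simpa using log_natCast_nonneg X
      · exact log_le_log (by exact_mod_cast h0) (by exact_mod_cast Nat.div_le_self _ _)
    have h4 : ((X / 2 ^ j : ℕ) : ℝ) ≤ X * (1 / 2) ^ j := by
      refine (Nat.cast_div_le).trans_eq ?_
      push_cast
      rw [one_div, inv_pow, div_eq_mul_inv]
    calc _ ≤ ((2 * ∑ n ∈ Finset.Icc 1 (X / 2 ^ j), n.divisors.card : ℕ) : ℝ) := by
            exact_mod_cast h2
      _ = 2 * ((∑ n ∈ Finset.Icc 1 (X / 2 ^ j), n.divisors.card : ℕ) : ℝ) := by push_cast; ring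
      _ ≤ 2 * (((X / 2 ^ j : ℕ) : ℝ) * (1 + log ((X / 2 ^ j : ℕ) : ℝ))) := by
        gcongr
        exact sum_card_divisors_le _
      _ ≤ 2 * ((X * (1 / 2) ^ j) * (1 + log X)) := by
        gcongr
      _ = _ := by ring
  rw [Nat.cast_sum]
  refine (Finset.sum_le_sum fun j _ => h1 j).trans ?_
  rw [← Finset.mul_sum]
  have h5 : ∑ j ∈ Finset.range (X + 1), (1 / 2 : ℝ) ^ j ≤ 2 := by
    rw [geom_sum_eq (by norm_num)]
    have : (0 : ℝ) < (1 / 2) ^ (X + 1) := by positivity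
    rw [div_le_iff_of_neg (by norm_num)]
    linarith
  have h6 := log_natCast_nonneg X
  have h7 : (0 : ℝ) ≤ 2 * (X * (1 + log X)) := by positivity
  calc _ ≤ 2 * (X * (1 + log X)) * (2 : ℝ) := mul_le_mul_of_nonneg_left h5 h7
    _ = _ := by ring

theorem exists_sqrtMod_of_coprime {d x y n : ℕ} (hxy : Nat.Coprime x y) (hn : 0 < n)
    (h : (n : ℤ) ∣ (x : ℤ) ^ 2 - d * y ^ 2) : ∃ r ∈ sqrtMod d n, (n : ℤ) ∣ x - r * y := by
  have hcop : IsCoprime (y : ℤ) n := by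
    rw [Int.isCoprime_iff_gcd_eq_one]
    by_contra hg
    obtain ⟨p, hp, hpg⟩ := Nat.exists_prime_and_dvd hg
    have h1 : (p : ℤ) ∣ y := (Int.natCast_dvd_natCast.2 hpg).trans (Int.gcd_dvd_left _ _)
    have h2 : (p : ℤ) ∣ n := (Int.natCast_dvd_natCast.2 hpg).trans (Int.gcd_dvd_right _ _)
    have h3 : (p : ℤ) ∣ (x : ℤ) ^ 2 := by
      have h4 := dvd_add (h2.trans h) ((dvd_pow h1 two_ne_zero).mul_left (d : ℤ))
      simpa using h4
    have h5 := (Nat.prime_iff_prime_int.1 hp).dvd_of_dvd_pow h3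
    have := Nat.dvd_gcd (Int.natCast_dvd_natCast.1 h5) (Int.natCast_dvd_natCast.1 h1)
    rw [hxy] at this
    exact hp.one_lt.ne' (Nat.dvd_one.1 this)
  obtain ⟨a, b, hab⟩ := hcop
  have hn' : (0 : ℤ) < n := by exact_mod_cast hn
  have hr0 : 0 ≤ (x * a) % (n : ℤ) := Int.emod_nonneg _ hn'.ne'
  have hr1 : (x * a) % (n : ℤ) < n := Int.emod_lt_of_pos _ hn'
  obtain ⟨r, hr⟩ := Int.eq_ofNat_of_zero_le hr0
  have hra : (n : ℤ) ∣ x * a - r := by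
    have := Int.dvd_self_sub_emod (x := x * a) (m := (n : ℤ))
    rwa [hr] at this
  have hxr : (n : ℤ) ∣ x - r * y := by
    have : (x : ℤ) - r * y = (x * a - r) * y + n * (x * b) := by
      linear_combination -(x : ℤ) * hab
    rw [this]
    exact dvd_add (hra.mul_right _) (dvd_mul_right _ _)
  refine ⟨r, mem_sqrtMod.2 ⟨by omega, ?_⟩, hxr⟩
  have h1 : (n : ℤ) ∣ y ^ 2 * (r ^ 2 - d) := by
    have : (y : ℤ) ^ 2 * (r ^ 2 - d) = (x ^ 2 - d * y ^ 2) - (x - r * y) * (x + r * y) := by ring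
    rw [this]
    exact dvd_sub h (hxr.mul_right _)
  exact (IsCoprime.pow_right ⟨b, a, by linarith⟩).dvd_of_dvd_mul_left h1

theorem exists_approx_data {d X : ℕ} (hd : 1 < d) (hsq : ¬ IsSquare d) (hX : 2 * √d + 1 ≤ X)
    (t : ℕ) : ∃ x y n r : ℕ, 0 < x ∧ 0 < y ∧ 0 < n ∧ ((x : ℤ) ^ 2 - d * y ^ 2).natAbs = n ∧
      r ∈ sqrtMod d n ∧ (n : ℤ) ∣ x - r * y ∧ (n : ℝ) * 2 ^ t < x + y * √d ∧
      (x : ℝ) + y * √d < 2 ^ t * X := by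
  obtain ⟨x, y, hx, hy, hxy, hyt, h⟩ := exists_coprime_abs_sub_lt hd t
  have hn : 0 < ((x : ℤ) ^ 2 - d * y ^ 2).natAbs := by
    refine Int.natAbs_pos.2 fun h0 => ?_
    have := (eq_zero_of_sq_eq_mul_sq hsq (sub_eq_zero.1 h0)).2
    omega
  obtain ⟨r, hr, hxr⟩ := exists_sqrtMod_of_coprime hxy hn (Int.natAbs_dvd.2 dvd_rfl)
  have hθ : 0 < (x : ℝ) + y * √d := by positivity
  have h2 : (0 : ℝ) < 2 ^ t := by positivity
  refine ⟨x, y, _, r, hx, hy, hn, rfl, hr, hxr, ?_, ?_⟩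
  · have h3 : ((((x : ℤ) ^ 2 - d * y ^ 2).natAbs : ℕ) : ℝ) =
        |(x : ℝ) - y * √d| * (x + y * √d) := by
      rw [Nat.cast_natAbs, Int.cast_abs]
      conv_rhs => rw [← abs_of_pos hθ, ← abs_mul]
      congr 1
      push_cast
      linear_combination ((y : ℝ) ^ 2) * sq_sqrt (Nat.cast_nonneg (α := ℝ) d)
    rw [h3]
    calc _ < 1 / 2 ^ t * (x + y * √d) * (2 : ℝ) ^ t := by gcongr
      _ = _ := by field_simp
  · have h3 := (abs_lt.1 h).2
    have h4 : (1 : ℝ) / 2 ^ t ≤ 1 := by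
      rw [div_le_one h2]
      exact one_le_pow₀ (by norm_num)
    have h5 : (y : ℝ) ≤ 2 ^ t := by exact_mod_cast hyt
    have h6 : (1 : ℝ) ≤ 2 ^ t := one_le_pow₀ (by norm_num)
    have h7 := mul_le_mul_of_nonneg_right h5 (sqrt_nonneg (d : ℝ))
    have h8 := mul_le_mul_of_nonneg_left hX h2.le
    nlinarith

theorem exists_pell_solution_le {d X : ℕ} (hd : 1 < d) (hsf : Squarefree d) (hsq : ¬ IsSquare d)
    (hX : 2 * √d + 1 ≤ X) (τ : ℕ) (hτ : 8 * X * (1 + log X) < τ) :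
    ∃ u v : ℕ, 0 < u ∧ 0 < v ∧ u ^ 2 = d * v ^ 2 + 1 ∧
      (u : ℝ) + v * √d ≤ (2 ^ τ * X) * (2 ^ τ * X) := by
  classical
  choose x y n r hx hy hn hN hr hxr hθ hθ' using exists_approx_data hd hsq hX
  let s : ℝ → ℕ := fun θ => sInf {s : ℕ | θ < 2 ^ s * X}
  let θ : ℕ → ℝ := fun t => x t + y t * √d
  have hs : ∀ t, θ t < 2 ^ s (θ t) * X := fun t => Nat.sInf_mem (s := {s : ℕ | θ t < 2 ^ s * X})
    ⟨t, hθ' t⟩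
  have hst : ∀ t, s (θ t) ≤ t := fun t => Nat.sInf_le (s := {s : ℕ | θ t < 2 ^ s * X}) (hθ' t)
  let A : Finset (Bool × (Σ _ : ℕ, Σ _ : ℕ, ℕ)) := Finset.univ ×ˢ (Finset.range (X + 1)).sigma
    fun j => (Finset.Icc 1 (X / 2 ^ j)).sigma fun n => sqrtMod d n
  let f : ℕ → Bool × (Σ _ : ℕ, Σ _ : ℕ, ℕ) := fun t =>
    (decide (0 ≤ (x t : ℤ) ^ 2 - d * y t ^ 2), ⟨t - s (θ t), n t, r t⟩)
  have hA : A.card < (Finset.range τ).card := by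
    rw [Finset.card_range, Finset.card_product, Finset.card_sigma]
    simp only [Finset.card_sigma]
    have := sum_card_sqrtMod_le hsf X
    have h2 : ((Finset.univ : Finset Bool).card * ∑ j ∈ Finset.range (X + 1),
        ∑ n ∈ Finset.Icc 1 (X / 2 ^ j), (sqrtMod d n).card : ℝ) < τ := by
      rw [Finset.card_univ, Fintype.card_bool]
      push_cast at this ⊢
      linarith
    exact_mod_cast h2
  have hmem : ∀ t ∈ Finset.range τ, f t ∈ A := fun t _ => by
    have h1 : n t * 2 ^ (t - s (θ t)) ≤ X := by
      have h2 : (n t : ℝ) * 2 ^ t < 2 ^ s (θ t) * X := (hθ t).trans (hs t)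
      have h3 : (2 : ℝ) ^ t = 2 ^ s (θ t) * 2 ^ (t - s (θ t)) := by
        rw [← pow_add, Nat.add_sub_cancel' (hst t)]
      have h4 : (0 : ℝ) < 2 ^ s (θ t) := by positivity
      rw [h3] at h2
      have h5 : (n t : ℝ) * 2 ^ (t - s (θ t)) < X := by
        refine lt_of_mul_lt_mul_left (lt_of_eq_of_lt ?_ h2) h4.le
        ring
      exact_mod_cast h5.le
    simp only [A, f, Finset.mem_product, Finset.mem_univ, true_and, Finset.mem_sigma,
      Finset.mem_range, Finset.mem_Icc]
    refine ⟨?_, ⟨hn t, ?_⟩, hr t⟩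
    · have := Nat.lt_two_pow_self (n := t - s (θ t))
      have := Nat.mul_le_mul_right (2 ^ (t - s (θ t))) (hn t)
      omega
    · rwa [Nat.le_div_iff_mul_le (by positivity)]
  obtain ⟨t, ht, t', ht', hne, hf⟩ := Finset.exists_ne_map_eq_of_card_lt_of_maps_to hA hmem
  simp only [f, Prod.mk.injEq, Sigma.mk.injEq, heq_eq_eq] at hf
  obtain ⟨hsign, hj, hnn, hrr⟩ := hf
  have hNN : (x t : ℤ) ^ 2 - d * y t ^ 2 = x t' ^ 2 - d * y t' ^ 2 := by
    have h1 := hN t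
    have h2 := hN t'
    rw [decide_eq_decide] at hsign
    omega
  obtain ⟨u, v, hu, hv, huv, hle⟩ := exists_pell_of_congruent (x' := x t') (y' := y t') (r t) (hn t)
    (hx t) (hy t) hNN (by rw [← hN t]; simp) (mem_sqrtMod.1 (hr t)).2 (hxr t)
    (by rw [hnn, hrr]; exact hxr t') (fun ⟨h1, h2⟩ => hne (by
      have h3 : θ t = θ t' := by simp only [θ, h1, h2]
      have h4 := hst t
      have h5 := hst t'
      rw [h3] at hj h4
      omega))
  refine ⟨u, v, hu, hv, huv, hle.trans ?_⟩
  have hpow : ∀ t ∈ Finset.range τ, (2 : ℝ) ^ t * X ≤ 2 ^ τ * X := fun t ht => by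
    gcongr
    · norm_num
    · exact (Finset.mem_range.1 ht).le
  exact mul_le_mul ((hθ' t).le.trans (hpow t ht)) ((hθ' t').le.trans (hpow t' ht')) (by positivity)
    (by positivity)

theorem exists_small_pell_solution : ∃ C : ℝ, 0 < C ∧ ∀ d : ℕ, 1 < d → Squarefree d →
    ¬ IsSquare d → ∃ u v : ℕ, 0 < u ∧ 0 < v ∧ u ^ 2 = d * v ^ 2 + 1 ∧
      log (u + v * √d) ≤ C * (√d * (1 + log d)) := by
  refine ⟨240, by norm_num, fun d hd hsf hsq => ?_⟩
  set X := ⌈2 * √(d : ℝ) + 1⌉₊ with hX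
  have hX1 : 2 * √d + 1 ≤ X := Nat.le_ceil _
  have hd1 : 1 ≤ √(d : ℝ) := by
    rw [Real.one_le_sqrt]
    exact_mod_cast hd.le
  have hX2 : (X : ℝ) ≤ 4 * √d := by
    have := Nat.ceil_lt_add_one (show 0 ≤ 2 * √(d : ℝ) + 1 by positivity)
    rw [← hX] at this
    linarith
  have hX0 : (1 : ℝ) ≤ X := by linarith
  have hlX : 0 ≤ log X := log_nonneg hX0
  set τ := ⌊8 * X * (1 + log X)⌋₊ + 1 with hτ
  have hτ1 : 8 * X * (1 + log X) < τ := by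
    rw [hτ]
    push_cast
    exact Nat.lt_floor_add_one _
  have hτ2 : (τ : ℝ) ≤ 8 * X * (1 + log X) + 1 := by
    rw [hτ]
    push_cast
    have := Nat.floor_le (show 0 ≤ 8 * X * (1 + log X) by positivity)
    linarith
  obtain ⟨u, v, hu, hv, huv, hle⟩ := exists_pell_solution_le hd hsf hsq hX1 τ hτ1
  refine ⟨u, v, hu, hv, huv, ?_⟩
  have h1 : log (u + v * √d) ≤ 2 * (τ * log 2 + log X) := by
    refine (log_le_log (by positivity) hle).trans_eq ?_
    rw [log_mul (by positivity) (by positivity), log_mul (by positivity) (by positivity), log_pow]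
    ring
  have h2 : log 2 ≤ 1 := by
    have := log_two_lt_d9
    linarith
  have h3 : log X ≤ 2 + log d := by
    have h4 : log X ≤ log (4 * √d) := log_le_log (by linarith) hX2
    rw [log_mul (by norm_num) (by positivity), log_sqrt (by positivity)] at h4
    have h5 : log 4 ≤ 2 := by
      rw [show (4 : ℝ) = 2 ^ 2 by norm_num, log_pow]
      push_cast
      linarith
    have h6 := log_natCast_nonneg d
    linarith
  have h6 := log_natCast_nonneg d
  have h7 : (τ : ℝ) * log 2 ≤ τ := mul_le_of_le_one_right (by positivity) h2
  calc log (u + v * √d) ≤ 20 * (X * (1 + log X)) := by nlinarith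
    _ ≤ 20 * ((4 * √d) * (1 + (2 + log d))) := by gcongr
    _ ≤ 240 * (√d * (1 + log d)) := by nlinarith [mul_nonneg (sqrt_nonneg (d : ℝ)) h6]

end PellBound

section Lattice

open Polynomial

/-- The box of integer vectors whose coordinates are bounded by `L₁`, `L₂`, `L₃`. -/
noncomputable def latticeBox (L₁ L₂ L₃ : ℕ) : Finset (ℤ × ℤ × ℤ) :=
  Finset.Icc (-(L₁ : ℤ)) L₁ ×ˢ Finset.Icc (-(L₂ : ℤ)) L₂ ×ˢ Finset.Icc (-(L₃ : ℤ)) L₃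

theorem mem_latticeBox {L₁ L₂ L₃ : ℕ} {l : ℤ × ℤ × ℤ} :
    l ∈ latticeBox L₁ L₂ L₃ ↔ |l.1| ≤ L₁ ∧ |l.2.1| ≤ L₂ ∧ |l.2.2| ≤ L₃ := by
  simp [latticeBox, abs_le]

theorem card_latticeBox (L₁ L₂ L₃ : ℕ) :
    (latticeBox L₁ L₂ L₃).card = (2 * L₁ + 1) * ((2 * L₂ + 1) * (2 * L₃ + 1)) := by
  simp only [latticeBox, Finset.card_product, Int.card_Icc]
  have h (L : ℕ) : ((L : ℤ) + 1 - -(L : ℤ)).toNat = 2 * L + 1 := by omega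
  rw [h, h, h]

/-- The linear form `l₁ - m l₃` on `ℤ³`. -/
def firstForm (m : ℤ) : ℤ × ℤ × ℤ →+ ℤ where
  toFun l := l.1 - m * l.2.2
  map_zero' := by simp
  map_add' a b := by simp only [Prod.fst_add, Prod.snd_add]; ring

/-- The linear form `l₂ + n l₃` on `ℤ³`. -/
def secondForm (n : ℤ) : ℤ × ℤ × ℤ →+ ℤ where
  toFun l := l.2.1 + n * l.2.2
  map_zero' := by simp
  map_add' a b := by simp only [Prod.fst_add, Prod.snd_add]; ring

/-- The combination of the two forms with real weights. -/
noncomputable def logForm (m n : ℤ) (l₁ l₂ : ℝ) : ℤ × ℤ × ℤ →+ ℝ where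
  toFun l := firstForm m l * l₁ + secondForm n l * l₂
  map_zero' := by simp
  map_add' a b := by simp only [map_add]; push_cast; ring

theorem firstForm_apply (m : ℤ) (l : ℤ × ℤ × ℤ) : firstForm m l = l.1 - m * l.2.2 := rfl

theorem secondForm_apply (n : ℤ) (l : ℤ × ℤ × ℤ) : secondForm n l = l.2.1 + n * l.2.2 := rfl

theorem logForm_apply (m n : ℤ) (l₁ l₂ : ℝ) (l : ℤ × ℤ × ℤ) :
    logForm m n l₁ l₂ l = firstForm m l * l₁ + secondForm n l * l₂ := rfl

theorem eq_zero_of_forms_eq_zero {m n : ℤ} {l : ℤ × ℤ × ℤ} (h : |l.1| < m)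
    (hu : firstForm m l = 0) (hv : secondForm n l = 0) : l = 0 := by
  rw [firstForm_apply] at hu
  rw [secondForm_apply] at hv
  have h3 : l.2.2 = 0 := by
    by_contra h0
    have h1 := Int.one_le_abs h0
    rw [sub_eq_zero.1 hu, abs_mul] at h
    have := le_abs_self m
    have := abs_nonneg m
    nlinarith
  rw [h3, mul_zero] at hu hv
  exact Prod.ext (by simpa using hu) (Prod.ext (by simpa using hv) h3)

theorem eq_zero_of_logForm_eq_zero {m n : ℤ} {l₁ l₂ : ℝ}
    (hind : ∀ u v : ℤ, u * l₁ + v * l₂ = 0 → u = 0 ∧ v = 0) {l : ℤ × ℤ × ℤ} (h : |l.1| < m)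
    (h0 : logForm m n l₁ l₂ l = 0) : l = 0 :=
  eq_zero_of_forms_eq_zero h (hind _ _ h0).1 (hind _ _ h0).2

theorem exists_le_sub_of_card {A : Finset ℤ} {K : ℕ} (h : K < A.card) :
    ∃ a ∈ A, ∃ b ∈ A, (K : ℤ) ≤ b - a := by
  have hA : A.Nonempty := Finset.card_pos.1 (by omega)
  refine ⟨A.min' hA, A.min'_mem hA, A.max' hA, A.max'_mem hA, ?_⟩
  have h1 : A ⊆ Finset.Icc (A.min' hA) (A.max' hA) := fun x hx =>
    Finset.mem_Icc.2 ⟨A.min'_le x hx, A.le_max' x hx⟩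
  have h2 := Finset.card_le_card h1
  rw [Int.card_Icc] at h2
  omega

theorem exists_long_vector_of_common_zeros (m n : ℤ) (l₁ l₂ : ℝ) (hl₂ : 0 < l₂)
    (hind : ∀ u v : ℤ, u * l₁ + v * l₂ = 0 → u = 0 ∧ v = 0) (L₁ L₂ L₃ K : ℕ)
    (hm : (6 * L₁ : ℕ) < m) (R : ℝ[X][X]) (hR : R ≠ 0)
    (hP : ∀ l ∈ latticeBox L₁ L₂ L₃, R.evalEval (logForm m n l₁ l₂ l) (firstForm m l) = 0)
    (hK0 : 0 < K) (hK : (latticeBox (2 * L₁) (2 * L₂) (2 * L₃)).card ≤ K ^ 2)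
    (hRK : (R.natDegree + (Bivariate.swap R).natDegree) * K < (latticeBox L₁ L₂ L₃).card) :
    ∃ u₀ v₀ r s Θ : ℤ, r * u₀ + s * v₀ = 1 ∧ (K : ℤ) ≤ Θ ∧
      ∃ p ∈ latticeBox (2 * L₁) (2 * L₂) (2 * L₃),
        firstForm m p = Θ * u₀ ∧ secondForm n p = Θ * v₀ := by
  have hsub : ∀ l ∈ latticeBox L₁ L₂ L₃, ∀ l' ∈ latticeBox L₁ L₂ L₃,
      l' - l ∈ latticeBox (2 * L₁) (2 * L₂) (2 * L₃) := by
    intro l hl l' hl'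
    rw [mem_latticeBox] at *
    simp only [Prod.fst_sub, Prod.snd_sub]
    push_cast
    simp only [abs_le] at *
    omega
  obtain ⟨g, hg, A, hA, hAc, hline⟩ := exists_line_of_common_zeros (logForm m n l₁ l₂)
    ((Int.castAddHom ℝ).comp (firstForm m)) R hR (latticeBox L₁ L₂ L₃)
    (latticeBox (2 * L₁) (2 * L₂) (2 * L₃)) hP
    (by
      intro l hl l' hl' h
      have h1 := (mem_latticeBox.1 (hsub _ hl' _ hl)).1
      refine sub_eq_zero.1 (eq_zero_of_logForm_eq_zero hind (m := m) (n := n) ?_ ?_)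
      · push_cast at *
        omega
      · rw [map_sub, h, sub_self]) hsub K hK0 hK hRK
  have hline' : ∀ l ∈ A, ∀ l' ∈ A,
      firstForm m (l - l') * secondForm n g = secondForm n (l - l') * firstForm m g := by
    intro l hl l' hl'
    have h := hline l hl l' hl'
    simp only [logForm_apply, AddMonoidHom.comp_apply, Int.coe_castAddHom] at h
    have h2 : l₂ * ((firstForm m (l - l') : ℝ) * secondForm n g) =
        l₂ * (secondForm n (l - l') * firstForm m g) := by linear_combination -h
    exact_mod_cast mul_left_cancel₀ hl₂.ne' h2
  have hg0 : 0 < Int.gcd (firstForm m g) (secondForm n g) := by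
    rw [Int.gcd_pos_iff]
    by_contra! h
    apply hg
    rw [logForm_apply, h.1, h.2]
    simp
  obtain ⟨u₀, v₀, hco, hu, hv⟩ := Int.exists_gcd_one hg0
  set d : ℤ := (Int.gcd (firstForm m g) (secondForm n g) : ℤ)
  have hd : d ≠ 0 := Int.natCast_ne_zero.2 hg0.ne'
  obtain ⟨r, s, hrs⟩ := Int.isCoprime_iff_gcd_eq_one.2 hco
  have hpar : ∀ l ∈ A, ∀ l' ∈ A, firstForm m (l - l') * v₀ = secondForm n (l - l') * u₀ := by
    intro l hl l' hl'
    have h := hline' l hl l' hl'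
    rw [hu, hv] at h
    exact mul_right_cancel₀ hd (by linear_combination h)
  let θ : ℤ × ℤ × ℤ → ℤ := fun l => r * firstForm m l + s * secondForm n l
  have hθ1 : ∀ l ∈ A, ∀ l' ∈ A, firstForm m (l - l') = θ (l - l') * u₀ := by
    intro l hl l' hl'
    linear_combination (-firstForm m (l - l')) * hrs + s * hpar l hl l' hl'
  have hθ2 : ∀ l ∈ A, ∀ l' ∈ A, secondForm n (l - l') = θ (l - l') * v₀ := by
    intro l hl l' hl'
    linear_combination (-secondForm n (l - l')) * hrs - r * hpar l hl l' hl'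
  have hinj : Set.InjOn θ A := by
    intro l hl l' hl' h
    have h0 : θ (l - l') = 0 := by
      simp only [θ, map_sub] at h ⊢
      linear_combination h
    have h1 := (mem_latticeBox.1 (hsub _ (hA hl') _ (hA hl))).1
    refine sub_eq_zero.1 (eq_zero_of_forms_eq_zero (m := m) (n := n) ?_ ?_ ?_)
    · push_cast at *
      omega
    · rw [hθ1 l hl l' hl', h0, zero_mul]
    · rw [hθ2 l hl l' hl', h0, zero_mul]
  obtain ⟨a, ha, b, hb, hab⟩ := exists_le_sub_of_card
    (A := A.image θ) (K := K) (by rwa [Finset.card_image_of_injOn hinj])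
  obtain ⟨l, hl, rfl⟩ := Finset.mem_image.1 ha
  obtain ⟨l', hl', rfl⟩ := Finset.mem_image.1 hb
  refine ⟨u₀, v₀, r, s, θ (l' - l), hrs, ?_, l' - l, hsub _ (hA hl) _ (hA hl'),
    hθ1 _ hl' _ hl, hθ2 _ hl' _ hl⟩
  refine hab.trans (le_of_eq ?_)
  simp only [θ, map_sub]
  ring

end Lattice

section LatticeMultiples

theorem abs_le_of_mul_bound {Q Θ Θ₀ L m t p ρ x : ℤ} (hQ : 0 < Q) (hΘ : 2 * Θ₀ ≤ Θ) (hΘ₀ : 0 < Θ₀)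
    (hm0 : 0 ≤ m) (hm : m ≤ 2 * Q * L) (ht : |t| ≤ Θ₀) (hp : |p| ≤ 2 * L) (hρ : |Q * ρ| ≤ Θ)
    (h : Θ * x = t * p + m * ρ) : |x| ≤ 3 * L := by
  have hΘ' : 0 < Θ := by omega
  have hL : 0 ≤ L := by have := abs_nonneg p; omega
  have h1 : |t * p| ≤ Θ * L := by
    rw [abs_mul]
    calc |t| * |p| ≤ Θ₀ * (2 * L) := by gcongr
      _ ≤ Θ * L := by nlinarith
  have h2 : |m * (Q * ρ)| ≤ 2 * Q * L * Θ := by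
    rw [abs_mul, abs_of_nonneg hm0]
    gcongr
  have h3 : Q * Θ * |x| ≤ Q * Θ * (3 * L) := by
    have h4 : |Q * Θ * x| = Q * Θ * |x| := by
      rw [abs_mul, abs_of_pos (mul_pos hQ hΘ')]
    rw [← h4, show Q * Θ * x = Q * (t * p) + m * (Q * ρ) by linear_combination Q * h]
    refine (abs_add_le _ _).trans ?_
    rw [abs_mul Q, abs_of_pos hQ]
    nlinarith
  exact le_of_mul_le_mul_left h3 (mul_pos hQ hΘ')

theorem exists_dense_multiples {m n u₀ v₀ Θ : ℤ} {L₁ L₂ L₃ q T : ℕ} (hq : 0 < q) (hT : 0 < T)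
    (hL₃ : 0 < L₃) (hm0 : 0 ≤ m) (hn0 : 0 ≤ n)
    (hm : m ≤ 2 * (q ^ 3 : ℕ) * L₁) (hn : n ≤ 2 * (q ^ 3 : ℕ) * L₂)
    (hΘ : 2 * (q ^ 4 * T : ℕ) ≤ Θ) {p : ℤ × ℤ × ℤ}
    (hp : p ∈ latticeBox (2 * L₁) (2 * L₂) (2 * L₃))
    (hu : firstForm m p = Θ * u₀) (hv : secondForm n p = Θ * v₀) :
    ∃ E : Finset ℤ, q * T < E.card ∧ ∀ t ∈ E, |t| ≤ (q ^ 4 * T : ℕ) ∧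
      ∃ l ∈ latticeBox (3 * L₁) (3 * L₂) (3 * L₃),
        firstForm m l = t * u₀ ∧ secondForm n l = t * v₀ := by
  have hΘ₀ : (0 : ℤ) < (q ^ 4 * T : ℕ) := by exact_mod_cast (by positivity : 0 < q ^ 4 * T)
  set Θ₀ : ℤ := ((q ^ 4 * T : ℕ) : ℤ) with hΘ₀d
  have hQ : (0 : ℤ) < (q ^ 3 : ℕ) := by exact_mod_cast (by positivity : 0 < q ^ 3)
  set Q : ℤ := ((q ^ 3 : ℕ) : ℤ) with hQd
  have hΘ' : 0 < Θ := by omega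
  obtain ⟨hp1, hp2, hp3⟩ := mem_latticeBox.1 hp
  push_cast at hp1 hp2 hp3
  rw [firstForm_apply] at hu
  rw [secondForm_apply] at hv
  let ρ : ℤ → ℤ := fun t => (-(t * p.2.2)) % Θ
  let z : ℤ → ℤ := fun t => -((-(t * p.2.2)) / Θ)
  have hz : ∀ t, Θ * z t = t * p.2.2 + ρ t := fun t => by
    have := Int.emod_add_mul_ediv (-(t * p.2.2)) Θ
    simp only [z, ρ]
    linear_combination -this
  have hρ0 : ∀ t, 0 ≤ ρ t := fun t => Int.emod_nonneg _ hΘ'.ne'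
  have hρ1 : ∀ t, ρ t < Θ := fun t => Int.emod_lt_of_pos _ hΘ'
  obtain ⟨κ, -, hκ⟩ := Finset.exists_lt_card_fiber_of_mul_lt_card_of_maps_to
    (s := Finset.Icc (0 : ℤ) Θ₀) (t := Finset.Ico (0 : ℤ) Q) (f := fun t => Q * ρ t / Θ)
    (n := q * T) (fun t _ => by
      have := hρ0 t
      have := hρ1 t
      rw [Finset.mem_Ico]
      refine ⟨by positivity, ?_⟩
      rw [Int.ediv_lt_iff_lt_mul hΘ']
      gcongr)
    (by
      rw [Int.card_Ico, Int.card_Icc, hΘ₀d, hQd]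
      have h1 : (((q ^ 3 : ℕ) : ℤ) - 0).toNat = q ^ 3 := by omega
      have h2 : (((q ^ 4 * T : ℕ) : ℤ) + 1 - 0).toNat = q ^ 4 * T + 1 := by omega
      rw [h1, h2]
      nlinarith)
  set F := (Finset.Icc (0 : ℤ) Θ₀).filter fun t => Q * ρ t / Θ = κ
  obtain ⟨t₀, ht₀⟩ := Finset.card_pos.1 (pos_of_gt hκ)
  refine ⟨F.image fun t => t - t₀, ?_, ?_⟩
  · rwa [Finset.card_image_of_injective _ (sub_left_injective)]
  intro t' ht'
  obtain ⟨t, ht, rfl⟩ := Finset.mem_image.1 ht'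
  simp only [F, Finset.mem_filter, Finset.mem_Icc] at ht ht₀
  have htt : |t - t₀| ≤ Θ₀ := by rw [abs_le]; omega
  have hρ : |Q * (ρ t - ρ t₀)| ≤ Θ := by
    have h1 := Int.emod_add_mul_ediv (Q * ρ t) Θ
    have h2 := Int.emod_add_mul_ediv (Q * ρ t₀) Θ
    rw [ht.2] at h1
    rw [ht₀.2] at h2
    have h3 := Int.emod_nonneg (Q * ρ t) hΘ'.ne'
    have h4 := Int.emod_lt_of_pos (Q * ρ t) hΘ'
    have h5 := Int.emod_nonneg (Q * ρ t₀) hΘ'.ne'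
    have h6 := Int.emod_lt_of_pos (Q * ρ t₀) hΘ'
    rw [mul_sub, abs_le]
    constructor <;> linarith
  have hzz : Θ * (z t - z t₀) = (t - t₀) * p.2.2 + 1 * (ρ t - ρ t₀) := by
    linear_combination hz t - hz t₀
  refine ⟨htt, ((t - t₀) * u₀ + m * (z t - z t₀), (t - t₀) * v₀ - n * (z t - z t₀), z t - z t₀),
    ?_, ?_, ?_⟩
  · rw [mem_latticeBox]
    push_cast
    refine ⟨?_, ?_, ?_⟩
    · exact abs_le_of_mul_bound hQ hΘ hΘ₀ hm0 hm htt hp1 hρ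
        (by linear_combination m * hzz - (t - t₀) * hu)
    · refine abs_le_of_mul_bound (ρ := -(ρ t - ρ t₀)) hQ hΘ hΘ₀ hn0 hn htt hp2 ?_
        (by linear_combination (-n) * hzz - (t - t₀) * hv)
      rwa [mul_neg, abs_neg]
    · refine abs_le_of_mul_bound hQ hΘ hΘ₀ zero_le_one ?_ htt hp3 hρ hzz
      nlinarith
  · rw [firstForm_apply]; ring
  · rw [secondForm_apply]; ring

end LatticeMultiples

section Independence

open Polynomial

/-- An integral linear combination of the two forms. -/
def lineForm (m n r s : ℤ) : ℤ × ℤ × ℤ →+ ℤ where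
  toFun l := r * firstForm m l + s * secondForm n l
  map_zero' := by simp
  map_add' a b := by simp only [map_add]; ring

theorem lineForm_apply (m n r s : ℤ) (l : ℤ × ℤ × ℤ) :
    lineForm m n r s l = r * firstForm m l + s * secondForm n l := rfl

/-- The vectors of a box on which the two forms are `θ • (u₀, v₀)` with `|θ| ≤ M`. -/
noncomputable def lineBox (m n u₀ v₀ r s : ℤ) (L₁ L₂ L₃ M : ℕ) : Finset (ℤ × ℤ × ℤ) :=
  (latticeBox L₁ L₂ L₃).filter fun l => firstForm m l = lineForm m n r s l * u₀ ∧
    secondForm n l = lineForm m n r s l * v₀ ∧ |lineForm m n r s l| ≤ M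

theorem mem_lineBox {m n u₀ v₀ r s : ℤ} {L₁ L₂ L₃ M : ℕ} {l : ℤ × ℤ × ℤ} :
    l ∈ lineBox m n u₀ v₀ r s L₁ L₂ L₃ M ↔ l ∈ latticeBox L₁ L₂ L₃ ∧
      firstForm m l = lineForm m n r s l * u₀ ∧
      secondForm n l = lineForm m n r s l * v₀ ∧ |lineForm m n r s l| ≤ M := by
  simp [lineBox]

theorem add_mem_latticeBox {L₁ L₂ L₃ : ℕ} {i j : ℕ} {l g : ℤ × ℤ × ℤ}
    (hl : l ∈ latticeBox (i * L₁) (i * L₂) (i * L₃))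
    (hg : g ∈ latticeBox (j * L₁) (j * L₂) (j * L₃)) :
    l + g ∈ latticeBox ((i + j) * L₁) ((i + j) * L₂) ((i + j) * L₃) := by
  rw [mem_latticeBox] at *
  push_cast at *
  simp only [Prod.fst_add, Prod.snd_add, add_mul]
  exact ⟨(abs_add_le _ _).trans (by linarith), (abs_add_le _ _).trans (by linarith),
    (abs_add_le _ _).trans (by linarith)⟩

theorem latticeBox_mono {L₁ L₂ L₃ L₁' L₂' L₃' : ℕ} (h1 : L₁ ≤ L₁') (h2 : L₂ ≤ L₂')
    (h3 : L₃ ≤ L₃') : latticeBox L₁ L₂ L₃ ⊆ latticeBox L₁' L₂' L₃' := by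
  intro l hl
  rw [mem_latticeBox] at *
  omega

/-- The approximate exponential attached to an integer vector. -/
noncomputable def latticeExp (m n : ℤ) (l₁ l₂ Λ : ℝ) (l : ℤ × ℤ × ℤ) : ℝ :=
  exp (logForm m n l₁ l₂ l + l.2.2 * Λ)

theorem latticeExp_add (m n : ℤ) (l₁ l₂ Λ : ℝ) (l g : ℤ × ℤ × ℤ) :
    latticeExp m n l₁ l₂ Λ (l + g) = latticeExp m n l₁ l₂ Λ l * latticeExp m n l₁ l₂ Λ g := by
  rw [latticeExp, latticeExp, latticeExp, ← exp_add, map_add]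
  congr 1
  simp only [Prod.snd_add]
  push_cast
  ring

theorem exists_bivariate_zero_on_box (m n : ℤ) (l₁ l₂ Λ : ℝ) (hl₁ : 0 < l₁) (S T L₁ L₂ L₃ : ℕ)
    (hL₁ : 0 < L₁) (f : Fin S × lowDegree T → ℝ) (hf : f ≠ 0)
    (hrel : ∀ l ∈ latticeBox (3 * (S + 1) * L₁) (3 * (S + 1) * L₂) (3 * (S + 1) * L₃),
      ∑ r, f r * (latticeExp m n l₁ l₂ Λ l ^ (r.1 : ℕ) *
        ((firstForm m l : ℝ) ^ r.2.1.1 * logForm m n l₁ l₂ l ^ r.2.1.2)) = 0) :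
    ∃ R : ℝ[X][X], R ≠ 0 ∧ R.natDegree ≤ 2 ^ S * T ∧ (Bivariate.swap R).natDegree ≤ 2 ^ S * T ∧
      ∀ l ∈ latticeBox L₁ L₂ L₃, R.evalEval (logForm m n l₁ l₂ l) (firstForm m l) = 0 := by
  have hg : latticeExp m n l₁ l₂ Λ (1, 0, 0) = exp l₁ := by
    simp [latticeExp, logForm_apply, firstForm_apply, secondForm_apply]
  obtain ⟨R, h0, h1, h2, h3⟩ := exists_bivariate_zero_of_relation S T
    (fun l => logForm m n l₁ l₂ l) (fun l => (firstForm m l : ℝ)) (1, 0, 0)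
    (logForm m n l₁ l₂ (1, 0, 0)) (firstForm m (1, 0, 0)) (fun l => map_add _ _ _)
    (fun l => by rw [map_add]; push_cast; rfl)
    (latticeExp m n l₁ l₂ Λ) (exp l₁) (fun l => (exp_pos _).ne')
    (fun l => by rw [latticeExp_add, hg]) (exp_pos _) (by simpa using hl₁.ne')
    (fun j => latticeBox (3 * (j + 1) * L₁) (3 * (j + 1) * L₂) (3 * (j + 1) * L₃))
    (fun j => Finset.coe_subset.2 (latticeBox_mono (by gcongr; omega) (by gcongr; omega)
      (by gcongr; omega)))
    (fun j l hl => by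
      refine Finset.mem_coe.2 ?_
      have := add_mem_latticeBox (Finset.mem_coe.1 hl) (j := 3) (g := (1, 0, 0))
        (by rw [mem_latticeBox]; push_cast; simp; omega)
      exact this) f hf hrel
  refine ⟨R, h0, h1, h2, fun l hl => h3 l (Finset.mem_coe.2 (latticeBox_mono ?_ ?_ ?_ hl))⟩ <;>
    omega

theorem eq_zero_of_relation_on_lineBox (m n u₀ v₀ r s : ℤ) (hrs : r * u₀ + s * v₀ = 1)
    (l₁ l₂ Λ : ℝ) (hind : ∀ u v : ℤ, u * l₁ + v * l₂ = 0 → u = 0 ∧ v = 0) (S T L₁ L₂ L₃ M N : ℕ)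
    (hm : (6 * L₁ : ℕ) < m) (E : Finset ℤ) (hE : N < E.card) (hE' : ∀ t ∈ E, |t| ≤ M ∧
      ∃ l ∈ latticeBox (3 * L₁) (3 * L₂) (3 * L₃),
        firstForm m l = t * u₀ ∧ secondForm n l = t * v₀) (hN : 6 * L₃ + 1 ≤ N)
    (hN' : 2 ^ S * T ≤ N) (f : Fin S × Fin T → ℝ)
    (hrel : ∀ l ∈ lineBox m n u₀ v₀ r s (3 * (S + 1) * L₁) (3 * (S + 1) * L₂) (3 * (S + 1) * L₃)
        ((S + 1) * M),
      ∑ r', f r' * (latticeExp m n l₁ l₂ Λ l ^ (r'.1 : ℕ) *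
        (lineForm m n r s l : ℝ) ^ (r'.2 : ℕ)) = 0) : f = 0 := by
  by_contra hf
  have hE2 : ∀ t ∈ E, ∃ l ∈ lineBox m n u₀ v₀ r s (3 * L₁) (3 * L₂) (3 * L₃) M,
      lineForm m n r s l = t := by
    intro t ht
    obtain ⟨ht1, l, hl, h1, h2⟩ := hE' t ht
    have h3 : lineForm m n r s l = t := by
      rw [lineForm_apply, h1, h2]; linear_combination t * hrs
    exact ⟨l, by rw [mem_lineBox, h3]; exact ⟨hl, h1, h2, ht1⟩, h3⟩
  choose! e he he' using hE2
  have hinj : Set.InjOn e E := fun a ha b hb h => by rw [← he' a ha, ← he' b hb, h]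
  obtain ⟨g, hg, hg1⟩ : ∃ g ∈ lineBox m n u₀ v₀ r s (3 * L₁) (3 * L₂) (3 * L₃) M,
      latticeExp m n l₁ l₂ Λ g ≠ 1 := by
    by_contra! hcon
    have hmaps : ∀ t ∈ E, (e t).2.2 ∈ Finset.Icc (-(3 * L₃ : ℤ)) (3 * L₃) := by
      intro t ht
      have := (mem_latticeBox.1 (mem_lineBox.1 (he t ht)).1).2.2
      push_cast at this
      rw [Finset.mem_Icc, ← abs_le]
      exact this
    have hinj3 : Set.InjOn (fun t => (e t).2.2) E := by
      intro a ha b hb hab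
      dsimp only at hab
      refine hinj ha hb (sub_eq_zero.1 (eq_zero_of_logForm_eq_zero hind (m := m) (n := n) ?_ ?_))
      · have h1 := (mem_latticeBox.1 (mem_lineBox.1 (he a ha)).1).1
        have h2 := (mem_latticeBox.1 (mem_lineBox.1 (he b hb)).1).1
        rw [Prod.fst_sub]
        push_cast at *
        exact (abs_sub _ _).trans_lt (by linarith)
      · have h1 := hcon _ (he a ha)
        have h2 := hcon _ (he b hb)
        rw [latticeExp, exp_eq_one_iff] at h1 h2
        rw [map_sub]
        rw [hab] at h1
        linarith
    have := Finset.card_le_card_of_injOn _ hmaps hinj3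
    rw [Int.card_Icc] at this
    omega
  obtain ⟨R, hR0, hR1, hR2⟩ := exists_univariate_zero_of_relation S T
    (fun l => (lineForm m n r s l : ℝ)) g (lineForm m n r s g)
    (fun l => by rw [map_add]; push_cast; rfl)
    (latticeExp m n l₁ l₂ Λ) (latticeExp m n l₁ l₂ Λ g) (fun l => (exp_pos _).ne')
    (fun l => latticeExp_add ..) (exp_pos _) hg1
    (fun j => lineBox m n u₀ v₀ r s (3 * (j + 1) * L₁) (3 * (j + 1) * L₂) (3 * (j + 1) * L₃)
      ((j + 1) * M))
    (fun j l hl => by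
      have hl' := mem_lineBox.1 (Finset.mem_coe.1 hl)
      refine Finset.mem_coe.2 (mem_lineBox.2 ⟨latticeBox_mono (by gcongr; omega)
        (by gcongr; omega) (by gcongr; omega) hl'.1, hl'.2.1, hl'.2.2.1, hl'.2.2.2.trans ?_⟩)
      push_cast
      nlinarith)
    (fun j l hl => by
      have hl' := mem_lineBox.1 (Finset.mem_coe.1 hl)
      have hg' := mem_lineBox.1 hg
      refine Finset.mem_coe.2 (mem_lineBox.2 ⟨add_mem_latticeBox hl'.1 hg'.1, ?_, ?_, ?_⟩)
      · rw [map_add, map_add, hl'.2.1, hg'.2.1]; ring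
      · rw [map_add, map_add, hl'.2.2.1, hg'.2.2.1]; ring
      · rw [map_add]
        refine (abs_add_le _ _).trans ?_
        have h1 := hl'.2.2.2
        have h2 := hg'.2.2.2
        push_cast at *
        linarith) f hf hrel
  have hz : ∀ t ∈ E.image fun t : ℤ => (t : ℝ), R.IsRoot t := by
    intro x hx
    obtain ⟨t, ht, rfl⟩ := Finset.mem_image.1 hx
    have := hR2 (e t) (Finset.mem_coe.2 (by simpa using he t ht))
    rwa [he' t ht] at this
  have hc : (E.image fun t : ℤ => (t : ℝ)).card = E.card :=
    Finset.card_image_of_injective _ Int.cast_injective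
  have := Polynomial.card_le_degree_of_subset_roots (p := R) (Z := E.image fun t : ℤ => (t : ℝ))
    (fun x hx => (Polynomial.mem_roots hR0).2 (hz x (by simpa using hx)))
  omega

end Independence

section LatticeContradiction

/-- The product of powers of four elements attached to a vector of the box of size `R`. -/
def latticeProduct {A : Type*} [CommRing A] (e₁ e₂ α β : A) (R₁ R₂ R₃ : ℕ) (l : ℤ × ℤ × ℤ) : A :=
  e₁ ^ (l.1 + R₁).toNat * e₂ ^ (l.2.1 + R₂).toNat * α ^ (l.2.2 + R₃).toNat *
    β ^ (R₃ - l.2.2).toNat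

variable {A : Type*} [CommRing A] {e₁ e₂ α β : A} {R₁ R₂ R₃ : ℕ} {l : ℤ × ℤ × ℤ}

theorem abs_map_latticeProduct_le (φ : A →+* ℝ) {l₁ l₂ a : ℝ} (hl₁ : 0 ≤ l₁) (hl₂ : 0 ≤ l₂)
    (h1 : |φ e₁| ≤ exp l₁) (h2 : |φ e₂| ≤ exp l₂)
    (h3 : |φ α| ≤ exp a) (h4 : |φ β| ≤ exp a) (hl : l ∈ latticeBox R₁ R₂ R₃) :
    |φ (latticeProduct e₁ e₂ α β R₁ R₂ R₃ l)| ≤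
      exp (2 * (R₁ * l₁) + 2 * (R₂ * l₂) + 2 * (R₃ * a)) := by
  obtain ⟨b1, b2, b3⟩ := mem_latticeBox.1 hl
  rw [abs_le] at b1 b2 b3
  obtain ⟨n1, hn1⟩ := Int.eq_ofNat_of_zero_le (show 0 ≤ l.1 + R₁ by omega)
  obtain ⟨n2, hn2⟩ := Int.eq_ofNat_of_zero_le (show 0 ≤ l.2.1 + R₂ by omega)
  obtain ⟨n3, hn3⟩ := Int.eq_ofNat_of_zero_le (show 0 ≤ l.2.2 + R₃ by omega)
  obtain ⟨n4, hn4⟩ := Int.eq_ofNat_of_zero_le (show 0 ≤ R₃ - l.2.2 by omega)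
  have c1 : (n1 : ℝ) ≤ 2 * R₁ := by exact_mod_cast (by omega : n1 ≤ 2 * R₁)
  have c2 : (n2 : ℝ) ≤ 2 * R₂ := by exact_mod_cast (by omega : n2 ≤ 2 * R₂)
  have c3 : (n3 : ℝ) + n4 = 2 * R₃ := by exact_mod_cast (by omega : n3 + n4 = 2 * R₃)
  rw [latticeProduct, hn1, hn2, hn3, hn4]
  simp only [Int.toNat_natCast, map_mul, map_pow, abs_mul, abs_pow]
  calc _ ≤ exp l₁ ^ n1 * exp l₂ ^ n2 * exp a ^ n3 * exp a ^ n4 := by gcongr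
    _ = exp (n1 * l₁ + n2 * l₂ + (n3 + n4) * a) := by
      simp only [← exp_nat_mul, ← exp_add]
      congr 1
      ring
    _ ≤ _ := by
      rw [exp_le_exp, c3]
      nlinarith

theorem map_latticeProduct (φ : A →+* ℝ) {l₁ l₂ la lb Λ : ℝ} {m n : ℤ}
    (h1 : φ e₁ = exp l₁) (h2 : φ e₂ = exp l₂)
    (h3 : φ α = exp la) (h4 : φ β = exp lb) (hΛ : la + m * l₁ = lb + n * l₂ + Λ)
    (hl : l ∈ latticeBox R₁ R₂ R₃) :
    φ (latticeProduct e₁ e₂ α β R₁ R₂ R₃ l) =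
      exp (R₁ * l₁ + R₂ * l₂ + R₃ * (la + lb)) * latticeExp m n l₁ l₂ Λ l := by
  obtain ⟨b1, b2, b3⟩ := mem_latticeBox.1 hl
  rw [abs_le] at b1 b2 b3
  obtain ⟨n1, hn1⟩ := Int.eq_ofNat_of_zero_le (show 0 ≤ l.1 + R₁ by omega)
  obtain ⟨n2, hn2⟩ := Int.eq_ofNat_of_zero_le (show 0 ≤ l.2.1 + R₂ by omega)
  obtain ⟨n3, hn3⟩ := Int.eq_ofNat_of_zero_le (show 0 ≤ l.2.2 + R₃ by omega)
  obtain ⟨n4, hn4⟩ := Int.eq_ofNat_of_zero_le (show 0 ≤ R₃ - l.2.2 by omega)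
  have c1 : (n1 : ℝ) = l.1 + R₁ := by exact_mod_cast hn1.symm
  have c2 : (n2 : ℝ) = l.2.1 + R₂ := by exact_mod_cast hn2.symm
  have c3 : (n3 : ℝ) = l.2.2 + R₃ := by exact_mod_cast hn3.symm
  have c4 : (n4 : ℝ) = R₃ - l.2.2 := by exact_mod_cast hn4.symm
  rw [latticeProduct, hn1, hn2, hn3, hn4]
  simp only [Int.toNat_natCast, map_mul, map_pow, h1, h2, h3, h4, latticeExp,
    ← exp_nat_mul, ← exp_add]
  congr 1
  rw [c1, c2, c3, c4, logForm_apply, firstForm_apply, secondForm_apply]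
  push_cast
  linear_combination (l.2.2 : ℝ) * hΛ

theorem abs_logForm_le {l₁ l₂ a la lb Λ : ℝ} {m n : ℤ} (hl₁ : 0 ≤ l₁) (hl₂ : 0 ≤ l₂)
    (ha : 1 ≤ a) (hla : 0 ≤ la) (hla' : la ≤ a) (hlb : 0 ≤ lb) (hlb' : lb ≤ a)
    (hΛ : la + m * l₁ = lb + n * l₂ + Λ) (hΛ1 : |Λ| ≤ 1) (hl : l ∈ latticeBox R₁ R₂ R₃) :
    |logForm m n l₁ l₂ l| ≤ R₁ * l₁ + R₂ * l₂ + 2 * (R₃ * a) := by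
  obtain ⟨b1, b2, b3⟩ := mem_latticeBox.1 hl
  have c1 : |(l.1 : ℝ)| ≤ R₁ := by exact_mod_cast b1
  have c2 : |(l.2.1 : ℝ)| ≤ R₂ := by exact_mod_cast b2
  have c3 : |(l.2.2 : ℝ)| ≤ R₃ := by exact_mod_cast b3
  have h : logForm m n l₁ l₂ l = l.1 * l₁ + l.2.1 * l₂ + l.2.2 * (la - lb - Λ) := by
    rw [logForm_apply, firstForm_apply, secondForm_apply]
    push_cast
    linear_combination (-l.2.2 : ℝ) * hΛ
  have h1 : |la - lb - Λ| ≤ 2 * a := by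
    rw [abs_le] at hΛ1 ⊢
    constructor <;> linarith
  rw [h]
  refine (abs_add_three _ _ _).trans ?_
  rw [abs_mul, abs_mul, abs_mul, abs_of_nonneg hl₁, abs_of_nonneg hl₂]
  have : |(l.2.2 : ℝ)| * |la - lb - Λ| ≤ R₃ * (2 * a) := by gcongr
  have : |(l.1 : ℝ)| * l₁ ≤ R₁ * l₁ := by gcongr
  have : |(l.2.1 : ℝ)| * l₂ ≤ R₂ * l₂ := by gcongr
  linarith

end LatticeContradiction

section LatticeContradiction

set_option maxHeartbeats 1000000 in
theorem no_lattice_parameters {A : Type*} [CommRing A] (φ : Fin 4 → A →+* ℝ)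
    (hφ : ∀ z, φ 0 z ≠ 0 → 1 ≤ |∏ k, φ k z|) {e₁ e₂ α β : A} {l₁ l₂ a la lb Λ : ℝ} {m n : ℤ}
    (hl₁ : 0 < l₁) (hl₂ : 0 < l₂) (ha : 1 ≤ a)
    (hind : ∀ u v : ℤ, u * l₁ + v * l₂ = 0 → u = 0 ∧ v = 0)
    (h1 : ∀ k, |φ k e₁| ≤ exp l₁) (h2 : ∀ k, |φ k e₂| ≤ exp l₂)
    (h3 : ∀ k, |φ k α| ≤ exp a) (h4 : ∀ k, |φ k β| ≤ exp a)
    (h1' : φ 0 e₁ = exp l₁) (h2' : φ 0 e₂ = exp l₂) (h3' : φ 0 α = exp la) (h4' : φ 0 β = exp lb)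
    (hla : 0 ≤ la) (hla' : la ≤ a) (hlb : 0 ≤ lb) (hlb' : lb ≤ a)
    (hΛ : la + m * l₁ = lb + n * l₂ + Λ) (hΛ1 : |Λ| ≤ 1)
    {S q T L₁ L₂ L₃ : ℕ} (hS : S = 8450) (hqS : 2 ^ S ≤ q) (hqS' : 108 * (S + 1) ^ 2 ≤ q)
    (hT : 1 ≤ T) (hL₁ : 1 ≤ L₁) (hL₂ : 1 ≤ L₂) (hL₃ : 1 ≤ L₃)
    (hLT₁ : L₁ * l₁ * q ^ 2 ≤ T) (hLT₂ : L₂ * l₂ * q ^ 2 ≤ T) (hLT₃ : L₃ * a * q ^ 2 ≤ T)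
    (hTΩ : T ≤ q ^ 11 * (l₁ * l₂ * a))
    (hm : (6 * L₁ : ℕ) < m) (hm' : m ≤ 2 * (q ^ 3 : ℕ) * L₁)
    (hn : 0 ≤ n) (hn' : n ≤ 2 * (q ^ 3 : ℕ) * L₂)
    (hcard : (latticeBox (2 * L₁) (2 * L₂) (2 * L₃)).card ≤ (2 * (q ^ 4 * T)) ^ 2)
    (hcard' : 2 ^ S * T * 2 * (2 * (q ^ 4 * T)) < (latticeBox L₁ L₂ L₃).card)
    (hnT : ((S * (T * (T + 1)) : ℕ) : ℝ) ≤ exp T)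
    (hδ : 2 * S * ((3 * (S + 1) * L₃ : ℕ) * |Λ|) * (q : ℝ) ^ (64 * T) ≤ 1) : False := by
  set R₁ := 3 * (S + 1) * L₁ with hR₁
  set R₂ := 3 * (S + 1) * L₂ with hR₂
  set R₃ := 3 * (S + 1) * L₃ with hR₃
  have hq : (108 * (S + 1) ^ 2 : ℝ) ≤ q := by exact_mod_cast hqS'
  have hS0 : (0 : ℝ) ≤ S := by positivity
  have hq81 : 81 ≤ q := le_trans (by nlinarith only [Nat.zero_le S]) hqS'
  have hqR : (81 : ℝ) ≤ q := by exact_mod_cast hq81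
  have hT0 : (1 : ℝ) ≤ T := by exact_mod_cast hT
  let W : ℝ := R₁ * l₁ + R₂ * l₂ + 2 * (R₃ * a)
  let h : ℝ := 2 * (R₁ * l₁) + 2 * (R₂ * l₂) + 4 * (R₃ * a)
  let B : ℝ := exp (R₁ * l₁ + R₂ * l₂ + R₃ * (la + lb))
  have hW : 0 ≤ W := by positivity
  have hh : 0 ≤ h := by positivity
  have hB : 1 ≤ B := one_le_exp (by positivity)
  have hBW : B * exp W ≤ exp h := by
    rw [← exp_add, exp_le_exp]
    have : (R₃ : ℝ) * (la + lb) ≤ R₃ * (2 * a) := by gcongr; linarith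
    simp only [W, h]
    linarith
  have hRq (L : ℕ) (b : ℝ) (hb : L * b * q ^ 2 ≤ T) :
      q ^ 2 * (((3 * (S + 1) * L : ℕ) : ℝ) * b) ≤ 3 * (S + 1) * T := by
    push_cast
    have := mul_le_mul_of_nonneg_left hb (by positivity : (0 : ℝ) ≤ 3 * (S + 1))
    linarith
  have hw1 := hRq _ _ hLT₁
  have hw2 := hRq _ _ hLT₂
  have hw3 := hRq _ _ hLT₃
  rw [← hR₁] at hw1
  rw [← hR₂] at hw2
  rw [← hR₃] at hw3
  have hWq : q ^ 2 * W ≤ 12 * (S + 1) * T := by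
    simp only [W]
    linarith
  have hhq : q ^ 2 * h ≤ 24 * (S + 1) * T := by
    simp only [h]
    linarith
  have hq0 : (0 : ℝ) < q := by linarith
  have hSS : 24 * (S + 1) * S ≤ (q : ℝ) := by nlinarith only [hq, hS0]
  have hSW : q * (S * W) ≤ T := by
    refine le_of_mul_le_mul_left (a := (q : ℝ)) ?_ hq0
    calc q * (q * (S * W)) = S * (q ^ 2 * W) := by ring
      _ ≤ S * (12 * (S + 1) * T) := by gcongr
      _ = (12 * (S + 1) * S) * T := by ring
      _ ≤ q * T := by gcongr; nlinarith only [hq, hS0]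
  have hSh : S * h ≤ T := by
    refine le_of_mul_le_mul_left (a := (q : ℝ) ^ 2) ?_ (by positivity)
    have e1 := mul_le_mul_of_nonneg_left hhq hS0
    have e2 : 24 * (S + 1) * S * (T : ℝ) ≤ q ^ 2 * T := by
      gcongr
      exact hSS.trans (le_self_pow₀ (by linarith) (by norm_num))
    linarith
  have hwB : ∀ k, ∀ l ∈ latticeBox R₁ R₂ R₃,
      |φ k (latticeProduct e₁ e₂ α β R₁ R₂ R₃ l)| ≤ exp h := by
    intro k l hl
    refine (abs_map_latticeProduct_le (φ k) hl₁.le hl₂.le (h1 k) (h2 k) (h3 k) (h4 k) hl).trans ?_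
    rw [exp_le_exp]
    have : 0 ≤ (R₃ : ℝ) * a := by positivity
    simp only [h]
    linarith
  have hw0 : ∀ l ∈ latticeBox R₁ R₂ R₃, φ 0 (latticeProduct e₁ e₂ α β R₁ R₂ R₃ l) =
      B * latticeExp m n l₁ l₂ Λ l :=
    fun l hl => map_latticeProduct (φ 0) h1' h2' h3' h4' hΛ hl
  have hω : ∀ l ∈ latticeBox R₁ R₂ R₃, |logForm m n l₁ l₂ l| ≤ W :=
    fun l hl => abs_logForm_le hl₁.le hl₂.le ha hla hla' hlb hlb' hΛ hΛ1 hl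
  have hδ' : ∀ l ∈ latticeBox R₁ R₂ R₃,
      2 * S * |(l.2.2 : ℝ) * Λ| * (q : ℝ) ^ (64 * T) ≤ 1 := by
    intro l hl
    have : |(l.2.2 : ℝ)| ≤ R₃ := by exact_mod_cast (mem_latticeBox.1 hl).2.2
    rw [abs_mul]
    refine le_trans ?_ hδ
    gcongr
  by_cases hindep : ∀ y : Fin S × lowDegree T → ℝ, (∀ l ∈ latticeBox R₁ R₂ R₃,
      ∑ r, y r * (latticeExp m n l₁ l₂ Λ l ^ (r.1 : ℕ) *
        ((firstForm m l : ℝ) ^ r.2.1.1 * logForm m n l₁ l₂ l ^ r.2.1.2)) = 0) → y = 0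
  · refine interpolation_contradiction_two φ hφ (C := latticeBox R₁ R₂ R₃) S q T hS hq81 hT
      (fun c => firstForm m c) (fun c => secondForm n c) l₁ l₂ hl₂
      (fun c => logForm m n l₁ l₂ c) (fun c => rfl)
      (fun c => latticeProduct e₁ e₂ α β R₁ R₂ R₃ c) h hh (fun k c => hwB k c c.2) B W
      (fun c => ((c : ℤ × ℤ × ℤ).2.2 : ℝ) * Λ) hB (fun c => hw0 c c.2) hBW hW (fun c => hω c c.2)
      ?_ (R₁ + m * R₃) (W / l₂) ?_ ?_ ?_ (by positivity) ?_ hnT hSh hSW (fun c => hδ' c c.2)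
    · intro y hy
      have h0 := hindep (fun r => y r * B ^ (r.1 : ℕ)) fun l hl => by
        rw [← hy ⟨l, hl⟩]
        refine Finset.sum_congr rfl fun r _ => ?_
        rw [hw0 l hl, mul_pow]
        ring
      funext r
      have hBr : B ^ (r.1 : ℕ) ≠ 0 := by positivity
      simpa [hBr] using congrFun h0 r
    · intro c
      obtain ⟨b1, b2, b3⟩ := mem_latticeBox.1 c.2
      have c1 : |((c : ℤ × ℤ × ℤ).1 : ℝ)| ≤ R₁ := by exact_mod_cast b1
      have c3 : |((c : ℤ × ℤ × ℤ).2.2 : ℝ)| ≤ R₃ := by exact_mod_cast b3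
      have hm0 : (0 : ℝ) ≤ m := by exact_mod_cast (by omega : 0 ≤ m)
      rw [firstForm_apply]
      push_cast
      refine (abs_sub _ _).trans ?_
      rw [abs_mul, abs_of_nonneg hm0]
      gcongr
    · intro c
      rw [mul_div_cancel₀ _ hl₂.ne']
      exact hω c c.2
    · have hm0 : (0 : ℝ) ≤ m := by exact_mod_cast (by omega : 0 ≤ m)
      positivity
    · have hmR : (m : ℝ) ≤ 2 * q ^ 3 * L₁ := by exact_mod_cast hm'
      have hL₃' : (1 : ℝ) ≤ L₃ := by exact_mod_cast hL₃
      have hU : (R₁ : ℝ) + m * R₃ ≤ 9 * (S + 1) * q ^ 3 * (L₁ * L₃) := by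
        have e1 : (R₁ : ℝ) ≤ 3 * (S + 1) * (q ^ 3 * (L₁ * L₃)) := by
          rw [hR₁]
          push_cast
          have : (L₁ : ℝ) ≤ q ^ 3 * (L₁ * L₃) := by
            calc (L₁ : ℝ) = 1 * (L₁ * 1) := by ring
              _ ≤ q ^ 3 * (L₁ * L₃) := by
                gcongr
                exact one_le_pow₀ (by linarith)
          gcongr
        have e2 : (m : ℝ) * R₃ ≤ 2 * q ^ 3 * L₁ * (3 * (S + 1) * L₃) := by
          rw [hR₃]
          push_cast
          gcongr
        linarith
      have hLL : (L₁ : ℝ) * L₃ ≤ T * q ^ 7 * l₂ := by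
        have e1 : (L₁ * l₁ * q ^ 2 : ℝ) * (L₃ * a * q ^ 2) ≤ T * (q ^ 11 * (l₁ * l₂ * a)) :=
          mul_le_mul hLT₁ (hLT₃.trans hTΩ) (by positivity) (by positivity)
        refine le_of_mul_le_mul_left (a := (q : ℝ) ^ 4 * (l₁ * a)) ?_ (by positivity)
        linarith
      have hX : W / l₂ * q ^ 2 ≤ 12 * (S + 1) * T / l₂ := by
        rw [div_mul_eq_mul_div]
        exact div_le_div_of_nonneg_right (by linarith) hl₂.le
      refine le_of_mul_le_mul_left (a := (q : ℝ) ^ 2) ?_ (by positivity)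
      calc q ^ 2 * ((R₁ + m * R₃) * (W / l₂)) = (R₁ + m * R₃) * (W / l₂ * q ^ 2) := by ring
        _ ≤ 9 * (S + 1) * q ^ 3 * (T * q ^ 7 * l₂) * (12 * (S + 1) * T / l₂) := by
          refine mul_le_mul (hU.trans ?_) hX (by positivity) (by positivity)
          gcongr
        _ = 9 * 12 * (S + 1) ^ 2 * (T ^ 2 * q ^ 10) := by field_simp
        _ ≤ q * (T ^ 2 * q ^ 10) := by gcongr; linarith
        _ = _ := by ring
  push Not at hindep
  obtain ⟨f, hf, hf0⟩ := hindep
  obtain ⟨R, hR0, hRd, hRd', hRz⟩ := exists_bivariate_zero_on_box m n l₁ l₂ Λ hl₁ S T L₁ L₂ L₃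
    hL₁ f hf0 hf
  have hT' : 0 < q ^ 4 * T := by positivity
  obtain ⟨u₀, v₀, r, s, Θ, hrs, hΘ, p, hp, hpu, hpv⟩ := exists_long_vector_of_common_zeros m n
    l₁ l₂ hl₂ hind L₁ L₂ L₃ (2 * (q ^ 4 * T)) hm R hR0 hRz (by omega) hcard
    (lt_of_le_of_lt (by gcongr; omega) hcard')
  obtain ⟨E, hE, hE'⟩ := exists_dense_multiples (T := T) (by omega) (by omega) (by omega) (by omega) hn
    hm' hn' (by exact_mod_cast hΘ) hp hpu hpv
  have hL₃T : L₃ ≤ T := by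
    have : (L₃ : ℝ) ≤ T := by
      refine le_trans ?_ hLT₃
      rw [mul_assoc]
      exact le_mul_of_one_le_right (by positivity)
        (one_le_mul_of_one_le_of_one_le ha (one_le_pow₀ (by linarith)))
    exact_mod_cast this
  have hind1 := eq_zero_of_relation_on_lineBox m n u₀ v₀ r s hrs l₁ l₂ Λ hind S T L₁ L₂ L₃
    (q ^ 4 * T) (q * T) hm E hE hE' (by nlinarith only [hL₃T, hq81, hT]) (by gcongr)
  have hsub : ∀ l ∈ lineBox m n u₀ v₀ r s R₁ R₂ R₃ ((S + 1) * (q ^ 4 * T)),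
      l ∈ latticeBox R₁ R₂ R₃ := fun l hl => (mem_lineBox.1 hl).1
  have hlog : ∀ l ∈ lineBox m n u₀ v₀ r s R₁ R₂ R₃ ((S + 1) * (q ^ 4 * T)),
      logForm m n l₁ l₂ l = lineForm m n r s l * (u₀ * l₁ + v₀ * l₂) := by
    intro l hl
    obtain ⟨-, b1, b2, -⟩ := mem_lineBox.1 hl
    rw [logForm_apply]
    conv_lhs => rw [b1, b2]
    push_cast
    ring
  refine interpolation_contradiction_one φ hφ
    (C := lineBox m n u₀ v₀ r s R₁ R₂ R₃ ((S + 1) * (q ^ 4 * T))) S q T hS hq81 hT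
    (fun c => lineForm m n r s c) (u₀ * l₁ + v₀ * l₂)
    (fun c => latticeProduct e₁ e₂ α β R₁ R₂ R₃ c) h hh (fun k c => hwB k c (hsub c c.2)) B W
    (fun c => ((c : ℤ × ℤ × ℤ).2.2 : ℝ) * Λ) hB
    (fun c => by rw [hw0 c (hsub c c.2), ← hlog c c.2]; rfl) hBW hW
    (fun c => by rw [← hlog c c.2]; exact hω c (hsub c c.2))
    ?_ ((S + 1) * (q ^ 4 * T)) ?_ ?_ ?_ hSh hSW (fun c => hδ' c (hsub c c.2))
  · intro y hy
    have h0 := hind1 (fun r => y r * B ^ (r.1 : ℕ)) fun l hl => by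
      rw [← hy ⟨l, hl⟩]
      refine Finset.sum_congr rfl fun r _ => ?_
      rw [hw0 l (hsub l hl), mul_pow]
      ring
    funext r
    have hBr : B ^ (r.1 : ℕ) ≠ 0 := by positivity
    simpa [hBr] using congrFun h0 r
  · intro c
    have := (mem_lineBox.1 c.2).2.2.2
    exact_mod_cast this
  · have e1 : 3 * ((S : ℝ) + 1) ≤ q := by nlinarith only [hq, hS0]
    have e2 := mul_le_mul_of_nonneg_right e1 (by positivity : (0 : ℝ) ≤ q ^ 4 * T)
    linarith
  · refine le_trans ?_ hnT
    exact_mod_cast Nat.mul_le_mul_left _ (Nat.le_mul_of_pos_right _ (by omega))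

end LatticeContradiction

section Parameters

theorem add_one_pow_twelve_le {q : ℝ} (hq : 36 ≤ q) : 2 * (q + 1) ^ 12 ≤ 3 * q ^ 12 := by
  have h0 : 0 < q + 1 := by linarith
  have h1 := one_add_mul_le_pow (a := -1 / (q + 1))
    (by rw [le_div_iff₀ h0]; linarith) 12
  have h2 : 1 + -1 / (q + 1) = q / (q + 1) := by field_simp; ring
  have h3 : (2 : ℝ) / 3 ≤ 1 + (12 : ℕ) * (-1 / (q + 1)) := by
    have : 1 / (q + 1) ≤ 1 / 36 := one_div_le_one_div_of_le (by norm_num) (by linarith)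
    rw [neg_div]
    push_cast
    linarith
  rw [h2, div_pow] at h1
  have h4 := h3.trans h1
  rw [div_le_div_iff₀ (by norm_num) (by positivity)] at h4
  linarith

theorem exists_pow_twelve_mul_le {Y Ω : ℝ} {Q : ℕ} (hQ : 36 ≤ Q) (hΩ : 0 < Ω)
    (hY : (Q : ℝ) ^ 12 * Ω < Y) :
    ∃ q : ℕ, Q ≤ q ∧ (q : ℝ) ^ 12 * Ω ≤ Y ∧ 2 * Y ≤ 3 * (q ^ 12 * Ω) := by
  classical
  have hex : ∃ k : ℕ, Y < ((k : ℝ) + 1) ^ 12 * Ω := by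
    obtain ⟨k, hk⟩ := exists_nat_gt (Y / Ω)
    refine ⟨k, (div_lt_iff₀ hΩ).1 (hk.trans_le ?_)⟩
    have : (k : ℝ) + 1 ≤ (k + 1) ^ 12 := le_self_pow₀ (by linarith [k.cast_nonneg (α := ℝ)])
      (by norm_num)
    linarith
  have hq := Nat.find_spec hex
  set q := Nat.find hex with hqd
  have hQq : Q ≤ q := by
    by_contra! h
    have h1 : ((q : ℝ) + 1) ≤ Q := by exact_mod_cast h
    have h2 : ((q : ℝ) + 1) ^ 12 * Ω ≤ Q ^ 12 * Ω := by gcongr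
    linarith
  refine ⟨q, hQq, ?_, ?_⟩
  · have h1 := Nat.find_min hex (m := q - 1) (by omega)
    rw [not_lt] at h1
    have h2 : ((q - 1 : ℕ) : ℝ) + 1 = q := by exact_mod_cast (by omega : q - 1 + 1 = q)
    rwa [h2] at h1
  · have h1 : (36 : ℝ) ≤ q := by exact_mod_cast hQ.trans hQq
    nlinarith [add_one_pow_twelve_le h1]

theorem mul_pow_mul_abs_le_one {S q T : ℕ} {Y Λ L : ℝ} (hq : 108 * (S + 1) ^ 2 ≤ q)
    (hq' : 100000 ≤ q) (hT : 1 ≤ T) (hL : 0 ≤ L) (hLT : L ≤ T) (hY : (q : ℝ) * T ≤ Y)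
    (hΛ : |Λ| ≤ exp (-Y / 2)) :
    2 * S * (3 * (S + 1) * L * |Λ|) * (q : ℝ) ^ (64 * T) ≤ 1 := by
  have hqR : (108 * (S + 1) ^ 2 : ℝ) ≤ q := by exact_mod_cast hq
  have hqR' : (100000 : ℝ) ≤ q := by exact_mod_cast hq'
  have hS0 : (0 : ℝ) ≤ S := by positivity
  have hT0 : (1 : ℝ) ≤ T := by exact_mod_cast hT
  have hq0 : (0 : ℝ) < q := by linarith
  have h1 : 2 * S * (3 * (S + 1)) ≤ (q : ℝ) ^ T := by
    calc 2 * S * (3 * (S + 1)) ≤ (q : ℝ) := by nlinarith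
      _ ≤ q ^ T := le_self_pow₀ (by linarith) (by omega)
  have h2 : L ≤ (q : ℝ) ^ T := by
    refine hLT.trans ?_
    have h : (T : ℝ) ≤ 2 ^ T := by exact_mod_cast Nat.lt_two_pow_self.le
    refine h.trans ?_
    gcongr
    linarith
  have h3 : log q ≤ q / 132 := by
    have e1 := log_le_sub_one_of_pos (sqrt_pos.2 hq0)
    rw [log_sqrt hq0.le] at e1
    have e2 : (264 : ℝ) ≤ √q := le_sqrt_of_sq_le (by norm_num; linarith)
    have e3 := mul_self_sqrt hq0.le
    nlinarith
  have h4 : (q : ℝ) ^ (66 * T) ≤ exp (Y / 2) := by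
    rw [← exp_log (pow_pos hq0 _), exp_le_exp, log_pow]
    push_cast
    calc 66 * (T : ℝ) * log q ≤ 66 * T * (q / 132) := by gcongr
      _ ≤ Y / 2 := by linarith
  calc _ = (2 * S * (3 * (S + 1))) * L * (q : ℝ) ^ (64 * T) * |Λ| := by ring
    _ ≤ (q : ℝ) ^ T * q ^ T * q ^ (64 * T) * exp (-Y / 2) := by gcongr
    _ = q ^ (66 * T) * exp (-Y / 2) := by
      rw [← pow_add, ← pow_add]
      ring_nf
    _ ≤ exp (Y / 2) * exp (-Y / 2) := by gcongr
    _ = 1 := by rw [← exp_add]; ring_nf; exact exp_zero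

theorem mul_le_exp_of_large {S T : ℕ} (hT : 108 * (S + 1) ^ 2 ≤ T) :
    ((S * (T * (T + 1)) : ℕ) : ℝ) ≤ exp T := by
  have hTR : (108 * (S + 1) ^ 2 : ℝ) ≤ T := by exact_mod_cast hT
  have hS0 : (0 : ℝ) ≤ S := by positivity
  have h1 := pow_div_factorial_le_exp (T : ℝ) (by positivity) 4
  have h4 : ((Nat.factorial 4 : ℕ) : ℝ) = 24 := by norm_num [Nat.factorial]
  rw [h4] at h1
  refine le_trans ?_ h1
  rw [le_div_iff₀ (by norm_num)]
  push_cast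
  have h2 : (S : ℝ) * 48 ≤ T := by nlinarith
  have h3 : (1 : ℝ) ≤ T := by nlinarith
  calc (S : ℝ) * (T * (T + 1)) * 24 ≤ S * (T * (2 * T)) * 24 := by gcongr; linarith
    _ = (S * 48) * T ^ 2 := by ring
    _ ≤ T * T ^ 2 := by gcongr
    _ ≤ T ^ 4 := by
      rw [← pow_succ']
      exact pow_le_pow_right₀ h3 (by norm_num)

theorem exists_nat_mul_le_lt {T c : ℝ} (hc : 0 < c) (hT : c ≤ T) :
    ∃ L : ℕ, 1 ≤ L ∧ L * c ≤ T ∧ T < (L + 1) * c := by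
  refine ⟨⌊T / c⌋₊, (Nat.one_le_floor_iff _).2 ((one_le_div hc).2 hT), ?_, ?_⟩
  · rw [← le_div_iff₀ hc]
    exact Nat.floor_le (by have := hc.le.trans hT; positivity)
  · rw [← div_lt_iff₀ hc]
    exact Nat.lt_floor_add_one _

theorem card_latticeBox_double_le {q T L₁ L₂ L₃ : ℕ} {l₁ l₂ a : ℝ} (hl₁ : 0 < l₁) (hl₂ : 0 < l₂)
    (ha : 0 < a) (hq : 32 ≤ q) (hL₁ : 1 ≤ L₁) (hL₂ : 1 ≤ L₂) (hL₃ : 1 ≤ L₃)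
    (h₁ : L₁ * (q ^ 2 * l₁) ≤ T) (h₂ : L₂ * (q ^ 2 * l₂) ≤ T) (h₃ : L₃ * (q ^ 2 * a) ≤ T)
    (hT : T ≤ q ^ 11 * (l₁ * l₂ * a)) :
    (latticeBox (2 * L₁) (2 * L₂) (2 * L₃)).card ≤ (2 * (q ^ 4 * T)) ^ 2 := by
  have hqR : (32 : ℝ) ≤ q := by exact_mod_cast hq
  have hLLL : (L₁ * L₂ * L₃ : ℝ) ≤ q ^ 5 * T ^ 2 := by
    refine le_of_mul_le_mul_left (a := (q : ℝ) ^ 6 * (l₁ * l₂ * a)) ?_ (by positivity)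
    calc (q : ℝ) ^ 6 * (l₁ * l₂ * a) * (L₁ * L₂ * L₃) =
        (L₁ * (q ^ 2 * l₁)) * (L₂ * (q ^ 2 * l₂)) * (L₃ * (q ^ 2 * a)) := by ring
      _ ≤ T * T * (q ^ 11 * (l₁ * l₂ * a)) := by
        refine mul_le_mul (mul_le_mul h₁ h₂ (by positivity) (by positivity)) (h₃.trans hT)
          (by positivity) (by positivity)
      _ = _ := by ring
  rw [card_latticeBox]
  have h : (2 * (2 * L₁) + 1) * ((2 * (2 * L₂) + 1) * (2 * (2 * L₃) + 1)) ≤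
      (5 * L₁) * ((5 * L₂) * (5 * L₃)) := by gcongr <;> omega
  refine h.trans ?_
  have h' : ((5 * L₁ * (5 * L₂ * (5 * L₃)) : ℕ) : ℝ) ≤ ((2 * (q ^ 4 * T)) ^ 2 : ℕ) := by
    push_cast
    have e3 : (125 : ℝ) ≤ 4 * q ^ 3 := by
      have := pow_le_pow_left₀ (by norm_num) hqR 3
      linarith
    calc (5 * L₁ * (5 * L₂ * (5 * L₃)) : ℝ) = 125 * (L₁ * L₂ * L₃) := by ring
      _ ≤ (4 * q ^ 3) * (q ^ 5 * T ^ 2) := by gcongr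
      _ = _ := by ring
  exact_mod_cast h'

theorem lt_card_latticeBox {q S T L₁ L₂ L₃ : ℕ} {l₁ l₂ a : ℝ} (hl₁ : 0 < l₁) (hl₂ : 0 < l₂)
    (ha : 0 < a) (hq : 8 * 2 ^ S < q) (hT0 : 1 ≤ T)
    (h₁ : T < (L₁ + 1) * (q ^ 2 * l₁)) (h₂ : T < (L₂ + 1) * (q ^ 2 * l₂))
    (h₃ : T < (L₃ + 1) * (q ^ 2 * a)) (hT : q ^ 11 * (l₁ * l₂ * a) ≤ 2 * T) :
    2 ^ S * T * 2 * (2 * (q ^ 4 * T)) < (latticeBox L₁ L₂ L₃).card := by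
  have hqR : (8 * 2 ^ S : ℝ) < q := by exact_mod_cast hq
  have hq0 : (0 : ℝ) < q := lt_trans (by positivity) hqR
  have hT0' : (0 : ℝ) < T := by exact_mod_cast hT0
  have hLLL : (q : ℝ) ^ 5 * T ^ 2 ≤ 2 * ((L₁ + 1) * ((L₂ + 1) * (L₃ + 1))) := by
    refine le_of_mul_le_mul_left (a := (q : ℝ) ^ 6 * (l₁ * l₂ * a)) ?_ (by positivity)
    calc (q : ℝ) ^ 6 * (l₁ * l₂ * a) * (q ^ 5 * T ^ 2) =
        (T : ℝ) * T * (q ^ 11 * (l₁ * l₂ * a)) := by ring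
      _ ≤ (T : ℝ) * T * (2 * T) := by gcongr
      _ ≤ ((L₁ + 1) * (q ^ 2 * l₁)) * ((L₂ + 1) * (q ^ 2 * l₂)) *
          (2 * ((L₃ + 1) * (q ^ 2 * a))) := by gcongr
      _ = _ := by ring
  rw [card_latticeBox]
  have h : (L₁ + 1) * ((L₂ + 1) * (L₃ + 1)) ≤ (2 * L₁ + 1) * ((2 * L₂ + 1) * (2 * L₃ + 1)) := by
    gcongr <;> omega
  refine lt_of_lt_of_le ?_ h
  have h' : ((2 ^ S * T * 2 * (2 * (q ^ 4 * T)) : ℕ) : ℝ) <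
      ((L₁ + 1) * ((L₂ + 1) * (L₃ + 1)) : ℕ) := by
    push_cast
    have e := mul_lt_mul_of_pos_right hqR (by positivity : (0 : ℝ) < q ^ 4 * T ^ 2)
    linarith
  exact_mod_cast h'

theorem log_bound_of_small_linear_form : ∃ C : ℝ, 0 < C ∧
    ∀ {A : Type} [CommRing A] (φ : Fin 4 → A →+* ℝ)
    (_ : ∀ z, φ 0 z ≠ 0 → 1 ≤ |∏ k, φ k z|) {e₁ e₂ α β : A} {l₁ l₂ a la lb Λ : ℝ} {m n : ℤ}
    (_ : 1 ≤ l₁) (_ : 1 ≤ l₂) (_ : l₁ + l₂ ≤ a)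
    (_ : ∀ u v : ℤ, u * l₁ + v * l₂ = 0 → u = 0 ∧ v = 0)
    (_ : ∀ k, |φ k e₁| ≤ exp l₁) (_ : ∀ k, |φ k e₂| ≤ exp l₂)
    (_ : ∀ k, |φ k α| ≤ exp a) (_ : ∀ k, |φ k β| ≤ exp a)
    (_ : φ 0 e₁ = exp l₁) (_ : φ 0 e₂ = exp l₂) (_ : φ 0 α = exp la) (_ : φ 0 β = exp lb)
    (_ : 0 ≤ la) (_ : la ≤ l₁) (_ : 0 ≤ lb) (_ : lb ≤ l₂)
    (_ : la + m * l₁ = lb + n * l₂ + Λ) (_ : |Λ| ≤ exp (-(la + m * l₁) / 2)),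
    la + m * l₁ ≤ C * (l₁ * l₂ * a) := by
  obtain ⟨S, hS⟩ : ∃ S : ℕ, S = 8450 := ⟨_, rfl⟩
  obtain ⟨Q, hQ⟩ : ∃ Q : ℕ, Q = 2 ^ S * (108 * (S + 1) ^ 2) := ⟨_, rfl⟩
  have hS2 : 1 ≤ 2 ^ S := Nat.one_le_two_pow
  have hQ1 : 108 * (S + 1) ^ 2 ≤ Q := hQ ▸ Nat.le_mul_of_pos_left _ (by positivity)
  have hQ2 : 108 * 2 ^ S ≤ Q := by
    rw [hQ, mul_comm]
    exact Nat.mul_le_mul_left _ (by nlinarith)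
  have hQ3 : 100000 ≤ Q := le_trans (by subst hS; norm_num) hQ1
  refine ⟨(Q : ℝ) ^ 12, by have : 0 < Q := by omega
                           positivity, ?_⟩
  intro A _ φ hφ e₁ e₂ α β l₁ l₂ a la lb Λ m n hl₁ hl₂ hla hind h1 h2 h3 h4 h1' h2' h3' h4'
    ha0 ha1 hb0 hb1 hΛ hΛY
  by_contra! hY
  set Y := la + m * l₁ with hYd
  set Ω := l₁ * l₂ * a with hΩd
  have ha : 1 ≤ a := by linarith
  have hΩ1 : l₁ ≤ Ω := by
    rw [hΩd, mul_assoc]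
    exact le_mul_of_one_le_right (by linarith) (one_le_mul_of_one_le_of_one_le hl₂ ha)
  have hΩ2 : l₂ ≤ Ω := by
    rw [hΩd, mul_comm l₁, mul_assoc]
    exact le_mul_of_one_le_right (by linarith) (one_le_mul_of_one_le_of_one_le hl₁ ha)
  have hΩ3 : a ≤ Ω :=
    le_mul_of_one_le_left (by linarith) (one_le_mul_of_one_le_of_one_le hl₁ hl₂)
  have hΩ : 1 ≤ Ω := hl₁.trans hΩ1
  obtain ⟨q, hQq, hqY, hqY'⟩ := exists_pow_twelve_mul_le (by omega) (by linarith) hY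
  have hq5 : 100000 ≤ q := hQ3.trans hQq
  have hq : (100000 : ℝ) ≤ q := by exact_mod_cast hq5
  have hq0 : (0 : ℝ) < q := by linarith
  have hp (i : ℕ) : (100000 : ℝ) * q ^ i ≤ q ^ (i + 1) := by
    rw [pow_succ']
    gcongr
  have hp1 (i : ℕ) : (1 : ℝ) ≤ q ^ i := one_le_pow₀ (by linarith)
  have hpm (i j : ℕ) (h : i ≤ j) : (q : ℝ) ^ i ≤ q ^ j := pow_le_pow_right₀ (by linarith) h
  obtain ⟨T, hT1, hT2, hT3⟩ := exists_nat_mul_le_lt (T := q ^ 11 * Ω) (c := 1) one_pos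
    (one_le_mul_of_one_le_of_one_le (hp1 11) hΩ)
  rw [mul_one] at hT2 hT3
  have hT1R : (1 : ℝ) ≤ T := by exact_mod_cast hT1
  have hTq : (q : ℝ) ^ 10 * Ω ≤ T := by
    have := mul_le_mul_of_nonneg_right (hp 10) (by linarith : 0 ≤ Ω)
    have := one_le_mul_of_one_le_of_one_le (hp1 10) hΩ
    norm_num at *
    linarith
  have hTq2 (b : ℝ) (hb : b ≤ Ω) : (q : ℝ) ^ 2 * b ≤ T := by
    refine le_trans ?_ hTq
    exact (mul_le_mul_of_nonneg_left hb (by positivity)).trans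
      (mul_le_mul_of_nonneg_right (hpm 2 10 (by norm_num)) (by linarith))
  have hqT : (q : ℝ) ≤ T := by
    refine le_trans ?_ hTq
    have := hpm 1 10 (by norm_num)
    rw [pow_one] at this
    exact this.trans (le_mul_of_one_le_right (by positivity) hΩ)
  obtain ⟨L₁, hL₁, hL₁T, hTL₁⟩ := exists_nat_mul_le_lt (by positivity) (hTq2 l₁ hΩ1)
  obtain ⟨L₂, hL₂, hL₂T, hTL₂⟩ := exists_nat_mul_le_lt (by positivity) (hTq2 l₂ hΩ2)
  obtain ⟨L₃, hL₃, hL₃T, hTL₃⟩ := exists_nat_mul_le_lt (by positivity) (hTq2 a hΩ3)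
  have hY0 : 0 ≤ Y := le_trans (by positivity) hqY
  have hΛ1 : |Λ| ≤ 1 := hΛY.trans (exp_le_one_iff.2 (by linarith))
  have hqTY : (q : ℝ) * T ≤ Y := by
    refine le_trans ?_ hqY
    calc (q : ℝ) * T ≤ q * (q ^ 11 * Ω) := by gcongr
      _ = _ := by ring
  have hL₃T' : (L₃ : ℝ) ≤ T := by
    refine le_trans (le_mul_of_one_le_right (by positivity) ?_) hL₃T
    exact one_le_mul_of_one_le_of_one_le (hp1 2) ha
  have hbig (b : ℝ) (hb : b ≤ Ω) (hb1 : 1 ≤ b) (L : ℕ) (hL : T < (L + 1) * (q ^ 2 * b)) (k : ℤ)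
      (hk : k * b ≤ Y + 1) : k ≤ 2 * (q ^ 3 : ℕ) * L := by
    have e1 : (k : ℝ) * b ≤ (2 * q ^ 3 * L) * b := by
      have e2 : 2 * q * (q ^ 11 * Ω) ≤ 2 * q * ((L + 1) * (q ^ 2 * b) + 1) := by
        gcongr
        linarith
      have e3 : (q : ℝ) ^ 3 * b ≤ q ^ 3 * Ω := by gcongr
      have e4 := mul_le_mul_of_nonneg_right (hp 11) (by linarith : 0 ≤ Ω)
      have e5 := mul_le_mul_of_nonneg_right (hpm 3 11 (by norm_num)) (by linarith : 0 ≤ Ω)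
      have e6 := mul_le_mul_of_nonneg_right (hpm 1 11 (by norm_num)) (by linarith : 0 ≤ Ω)
      have e7 : (q : ℝ) ≤ q ^ 1 * Ω := by
        rw [pow_one]; exact le_mul_of_one_le_right hq0.le hΩ
      norm_num at e4 e5 e6 e7
      linarith
    have e8 := le_of_mul_le_mul_right e1 (by linarith)
    exact_mod_cast e8
  have hmY : m * l₁ ≤ Y + 1 := by linarith
  have hnY : n * l₂ ≤ Y + 1 := by
    have := (abs_le.1 hΛ1).1
    linarith
  have hn0 : 0 ≤ n := by
    have h5 : (-1 : ℝ) * l₂ < n * l₂ := by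
      have := (abs_le.1 hΛ1).2
      have e4 := mul_le_mul_of_nonneg_right (hp 11) (by linarith : 0 ≤ Ω)
      have e5 := one_le_mul_of_one_le_of_one_le (hp1 11) hΩ
      norm_num at *
      linarith
    have h6 := lt_of_mul_lt_mul_right h5 (by linarith)
    have : (-1 : ℤ) < n := by exact_mod_cast h6
    omega
  have hm6 : ((6 * L₁ : ℕ) : ℤ) < m := by
    have h5 : (6 * L₁ : ℝ) * (q ^ 2 * l₁) < m * (q ^ 2 * l₁) := by
      have e1 : (q : ℝ) ^ 2 * (q ^ 12 * Ω) ≤ q ^ 2 * (Ω + m * l₁) := by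
        gcongr
        linarith
      have e2 := mul_le_mul_of_nonneg_right (hp 13) (by linarith : 0 ≤ Ω)
      have e3 := mul_le_mul_of_nonneg_right (hpm 2 13 (by norm_num)) (by linarith : 0 ≤ Ω)
      have e4 := mul_le_mul_of_nonneg_right (hpm 11 13 (by norm_num)) (by linarith : 0 ≤ Ω)
      have e5 := one_le_mul_of_one_le_of_one_le (hp1 13) hΩ
      norm_num at *
      linarith
    have h6 := lt_of_mul_lt_mul_right h5 (by positivity)
    exact_mod_cast h6
  have hδ := mul_pow_mul_abs_le_one (S := S) (L := L₃) (hQ1.trans hQq) hq5 hT1 (by positivity)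
    hL₃T' hqTY hΛY
  refine no_lattice_parameters φ hφ (by linarith) (by linarith) ha hind h1 h2 h3 h4 h1' h2' h3' h4'
    ha0 (by linarith) hb0 (by linarith) hΛ hΛ1 hS (q := q) (T := T) (by omega) (hQ1.trans hQq)
    hT1 hL₁ hL₂ hL₃ (by linarith) (by linarith) (by linarith) hT2 hm6
    (hbig l₁ hΩ1 hl₁ L₁ hTL₁ m hmY) hn0 (hbig l₂ hΩ2 hl₂ L₂ hTL₂ n hnY)
    (card_latticeBox_double_le (by linarith) (by linarith) (by linarith) (by omega) hL₁ hL₂ hL₃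
      hL₁T hL₂T hL₃T hT2)
    (lt_card_latticeBox (by linarith) (by linarith) (by linarith) (by omega) hT1 hTL₁ hTL₂ hTL₃
      (by linarith))
    (mul_le_exp_of_large (hQ1.trans (hQq.trans (by exact_mod_cast hqT)))) ?_
  push_cast
  exact hδ

end Parameters

section Reduction

theorem exists_int_mul_conj_pow {d : ℕ} (u v p q : ℤ) (m : ℕ) : ∃ b c : ℤ,
    (b + c * √d : ℝ) = (p + q * √d) * (u - v * √d) ^ m ∧
    (b - c * √d : ℝ) = (p - q * √d) * (u + v * √d) ^ m := by
  induction m with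
  | zero => exact ⟨p, q, by simp, by simp⟩
  | succ m ih =>
    obtain ⟨b, c, h1, h2⟩ := ih
    have hs : √(d : ℝ) ^ 2 = d := sq_sqrt d.cast_nonneg
    refine ⟨b * u - c * v * d, c * u - b * v, ?_, ?_⟩
    · rw [pow_succ, ← mul_assoc, ← h1]
      push_cast
      linear_combination c * v * hs
    · rw [pow_succ, ← mul_assoc, ← h2]
      push_cast
      linear_combination c * v * hs

theorem exists_reduced_element {d u v w p : ℕ} {l M : ℝ}
    (huv : u ^ 2 = d * v ^ 2 + 1) (hl : exp l = u + v * √d) (hl0 : 0 < l) (hw : 0 < w)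
    (hX : |((w : ℝ) + p * √d) * (w - p * √d)| ≤ M) :
    ∃ (b c : ℤ) (m : ℤ) (la : ℝ), 0 ≤ la ∧ la ≤ l ∧ log (w + p * √d) = la + m * l ∧
      (b + c * √d : ℝ) = exp la ∧ |(b - c * √d : ℝ)| ≤ M := by
  have hw1 : (1 : ℝ) ≤ w := by exact_mod_cast hw
  set X : ℝ := w + p * √d with hXd
  have hX1 : 1 ≤ X := by
    have : 0 ≤ (p : ℝ) * √d := by positivity
    linarith
  have hlog : 0 ≤ log X := log_nonneg hX1
  set m := ⌊log X / l⌋₊ with hm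
  have hm1 : m * l ≤ log X := (le_div_iff₀ hl0).1 (Nat.floor_le (by positivity))
  have hm2 : log X < (m + 1) * l := (div_lt_iff₀ hl0).1 (Nat.lt_floor_add_one _)
  obtain ⟨b, c, h1, h2⟩ := exists_int_mul_conj_pow (d := d) u v w p m
  have hs : √(d : ℝ) ^ 2 = d := sq_sqrt d.cast_nonneg
  have hinv : (u : ℝ) - v * √d = exp (-l) := by
    rw [exp_neg]
    refine eq_inv_of_mul_eq_one_left ?_
    rw [hl]
    have : (u : ℝ) ^ 2 = d * v ^ 2 + 1 := by exact_mod_cast huv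
    linear_combination this - (v : ℝ) ^ 2 * hs
  refine ⟨b, c, m, log X - m * l, by linarith, by linarith, by push_cast; ring, ?_, ?_⟩
  · rw [h1]
    push_cast
    rw [hinv, ← exp_nat_mul, ← hXd, exp_sub, exp_log (by linarith), mul_neg, exp_neg]
    rfl
  · rw [h2]
    push_cast
    rw [← hl, ← exp_nat_mul, abs_mul, abs_of_pos (exp_pos _)]
    have h3 : exp (m * l) ≤ X := (exp_le_exp.2 hm1).trans_eq (exp_log (by linarith))
    rw [abs_mul, abs_of_pos (by linarith : 0 < X)] at hX
    refine le_trans ?_ hX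
    rw [mul_comm]
    gcongr

theorem abs_log_sub_log_le {w X Y : ℝ} (hw : 0 < w) (hX : w ≤ X) (hY : w ≤ Y) :
    |log X - log Y| ≤ |X - Y| / w := by
  wlog h : Y ≤ X generalizing X Y
  · rw [abs_sub_comm, abs_sub_comm X]
    exact this hY hX (by linarith)
  have hY0 : 0 < Y := by linarith
  rw [abs_of_nonneg (sub_nonneg.2 (log_le_log hY0 h)), abs_of_nonneg (by linarith),
    ← log_div (by linarith) hY0.ne']
  refine (log_le_sub_one_of_pos (div_pos (by linarith) hY0)).trans ?_
  rw [div_sub_one hY0.ne']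
  have : 0 ≤ X - Y := by linarith
  gcongr

/-- The element `b + c√d₁` of the biquadratic order. -/
noncomputable def biquadraticLeft (d₁ d₂ : ℕ) (b c : ℤ) : biquadraticOrder d₁ d₂ :=
  ⟨biquadraticConj d₁ d₂ b c 0 0, b, c, 0, 0, rfl⟩

/-- The element `b + c√d₂` of the biquadratic order. -/
noncomputable def biquadraticRight (d₁ d₂ : ℕ) (b c : ℤ) : biquadraticOrder d₁ d₂ :=
  ⟨biquadraticConj d₁ d₂ b 0 c 0, b, 0, c, 0, rfl⟩

theorem biquadraticEval_zero_left (d₁ d₂ : ℕ) (b c : ℤ) :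
    biquadraticEval d₁ d₂ 0 (biquadraticLeft d₁ d₂ b c) = b + c * √d₁ := by
  simp [biquadraticEval, biquadraticLeft, biquadraticConj]

theorem biquadraticEval_zero_right (d₁ d₂ : ℕ) (b c : ℤ) :
    biquadraticEval d₁ d₂ 0 (biquadraticRight d₁ d₂ b c) = b + c * √d₂ := by
  simp [biquadraticEval, biquadraticRight, biquadraticConj]

theorem abs_biquadraticEval_left_le {d₁ d₂ : ℕ} {b c : ℤ} {R : ℝ} (h : |(b + c * √d₁ : ℝ)| ≤ R)
    (h' : |(b - c * √d₁ : ℝ)| ≤ R) (k : Fin 4) :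
    |biquadraticEval d₁ d₂ k (biquadraticLeft d₁ d₂ b c)| ≤ R := by
  fin_cases k <;> simpa [biquadraticEval, biquadraticLeft, biquadraticConj]

theorem abs_biquadraticEval_right_le {d₁ d₂ : ℕ} {b c : ℤ} {R : ℝ}
    (h : |(b + c * √d₂ : ℝ)| ≤ R) (h' : |(b - c * √d₂ : ℝ)| ≤ R) (k : Fin 4) :
    |biquadraticEval d₁ d₂ k (biquadraticRight d₁ d₂ b c)| ≤ R := by
  fin_cases k <;> simpa [biquadraticEval, biquadraticRight, biquadraticConj]

theorem abs_pell_conj_le {d u v : ℕ} {l : ℝ} (hl : exp l = u + v * √d) :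
    |(((u : ℤ) : ℝ) + ((v : ℤ) : ℝ) * √d)| ≤ exp l ∧
      |(((u : ℤ) : ℝ) - ((v : ℤ) : ℝ) * √d)| ≤ exp l := by
  have h1 : (0 : ℝ) ≤ u := by positivity
  have h2 : 0 ≤ (v : ℝ) * √d := by positivity
  push_cast
  rw [hl, abs_of_nonneg (by linarith)]
  exact ⟨le_rfl, abs_le.2 ⟨by linarith, by linarith⟩⟩

theorem abs_log_sub_log_le_of_conj {w s t M : ℝ} (hw : 0 < w) (hs : 0 ≤ s) (ht : 0 ≤ t)
    (hM : 9 ≤ M) (hwM : 2 * M ≤ w) (hX : |(w + s) * (w - s)| ≤ M) (hY : |(w + t) * (w - t)| ≤ M) :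
    |log (w + s) - log (w + t)| ≤ exp (-log (w + s) / 2) := by
  have key {r : ℝ} (hr : 0 ≤ r) (h : |(w + r) * (w - r)| ≤ M) : |w - r| ≤ M / w := by
    rw [le_div_iff₀ hw]
    rw [abs_mul, abs_of_pos (by linarith)] at h
    nlinarith [abs_nonneg (w - r)]
  have h1 := key hs hX
  have h2 := key ht hY
  have hMw : M / w ≤ 1 := (div_le_one hw).2 (by linarith)
  have h3 : |log (w + s) - log (w + t)| ≤ 2 * M / w ^ 2 := by
    refine (abs_log_sub_log_le hw (by linarith) (by linarith)).trans ?_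
    rw [show 2 * M / w ^ 2 = (M / w + M / w) / w by field_simp; ring]
    gcongr
    refine le_trans (le_of_eq ?_) ((abs_sub (w - t) (w - s)).trans (add_le_add h2 h1))
    congr 1
    ring
  have h4 : w + s ≤ 3 * w := by linarith [(abs_le.1 h1).1]
  refine abs_le_of_sq_le_sq ?_ (exp_pos _).le
  have h5 : exp (-log (w + s) / 2) ^ 2 = 1 / (w + s) := by
    rw [← exp_nat_mul]
    push_cast
    rw [mul_div_cancel₀ _ (by norm_num), exp_neg, exp_log (by linarith), one_div]
  rw [h5, ← sq_abs, le_div_iff₀ (by linarith)]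
  calc |log (w + s) - log (w + t)| ^ 2 * (w + s) ≤ (2 * M / w ^ 2) ^ 2 * (3 * w) := by gcongr
    _ = 12 * M ^ 2 / w ^ 3 := by field_simp; ring
    _ ≤ 1 := by
      rw [div_le_one (by positivity)]
      calc 12 * M ^ 2 ≤ (2 * M) ^ 3 := by nlinarith [sq_nonneg M]
        _ ≤ w ^ 3 := by gcongr

theorem log_le_of_pell_solutions : ∃ C : ℝ, 0 < C ∧
    ∀ {d₁ d₂ u₁ v₁ u₂ v₂ w p q : ℕ} {l₁ l₂ M : ℝ} (_ : ¬IsSquare d₁) (_ : ¬IsSquare d₂)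
    (_ : ¬IsSquare (d₁ * d₂)) (_ : 0 < u₁) (_ : 0 < v₁) (_ : 0 < u₂) (_ : 0 < v₂)
    (_ : u₁ ^ 2 = d₁ * v₁ ^ 2 + 1) (_ : u₂ ^ 2 = d₂ * v₂ ^ 2 + 1)
    (_ : exp l₁ = u₁ + v₁ * √d₁) (_ : exp l₂ = u₂ + v₂ * √d₂) (_ : 1 ≤ l₁) (_ : 1 ≤ l₂)
    (_ : 9 ≤ M) (_ : 2 * M ≤ w)
    (_ : |((w : ℝ) + p * √d₁) * (w - p * √d₁)| ≤ M)
    (_ : |((w : ℝ) + q * √d₂) * (w - q * √d₂)| ≤ M),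
    log w ≤ C * (l₁ * l₂ * (l₁ + l₂ + log M)) := by
  obtain ⟨C, hC, key⟩ := log_bound_of_small_linear_form
  refine ⟨C, hC, ?_⟩
  intro d₁ d₂ u₁ v₁ u₂ v₂ w p q l₁ l₂ M hd₁ hd₂ hd₁₂ hu₁ hv₁ hu₂ hv₂ hp₁ hp₂ hl₁ hl₂ hl₁1 hl₂1
    hM hwM hX hY
  have hwR : (0 : ℝ) < w := by linarith
  have hw0 : 0 < w := by exact_mod_cast hwR
  obtain ⟨b₁, c₁, m, la, hla0, hla1, hXm, hα, hα'⟩ :=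
    exists_reduced_element hp₁ hl₁ (by linarith) hw0 hX
  obtain ⟨b₂, c₂, n, lb, hlb0, hlb1, hYn, hβ, hβ'⟩ :=
    exists_reduced_element hp₂ hl₂ (by linarith) hw0 hY
  have hΛ := abs_log_sub_log_le_of_conj hwR (s := p * √d₁) (t := q * √d₂) (by positivity)
    (by positivity) hM hwM hX hY
  have hlM : 0 ≤ log M := log_nonneg (by linarith)
  have hMa : M ≤ exp (l₁ + l₂ + log M) := by
    rw [exp_add, exp_log (by linarith)]
    exact le_mul_of_one_le_left (by linarith) (one_le_exp (by linarith))
  have ht : log w ≤ la + m * l₁ := by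
    rw [← hXm]
    exact log_le_log hwR (le_add_of_nonneg_right (by positivity))
  refine ht.trans (key (biquadraticEval d₁ d₂)
    (fun z hz => one_le_abs_prod_biquadraticEval hd₁ hd₂ hd₁₂ z hz)
    (e₁ := biquadraticLeft d₁ d₂ u₁ v₁) (e₂ := biquadraticRight d₁ d₂ u₂ v₂)
    (α := biquadraticLeft d₁ d₂ b₁ c₁) (β := biquadraticRight d₁ d₂ b₂ c₂)
    (Λ := log (w + p * √d₁) - log (w + q * √d₂)) (n := n) hl₁1 hl₂1 (by linarith)
    (log_units_independent hd₁ hd₂ hd₁₂ hu₁ hv₁ hu₂ hv₂ hl₁ hl₂ (by linarith) (by linarith))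
    (abs_biquadraticEval_left_le (abs_pell_conj_le hl₁).1 (abs_pell_conj_le hl₁).2)
    (abs_biquadraticEval_right_le (abs_pell_conj_le hl₂).1 (abs_pell_conj_le hl₂).2)
    (abs_biquadraticEval_left_le ?_ (hα'.trans hMa))
    (abs_biquadraticEval_right_le ?_ (hβ'.trans hMa))
    ?_ ?_ ?_ ?_ hla0 hla1 hlb0 hlb1 (by rw [← hXm, ← hYn]; ring) (by rwa [← hXm]))
  · rw [hα, abs_of_pos (exp_pos _)]
    exact exp_le_exp.2 (by linarith)
  · rw [hβ, abs_of_pos (exp_pos _)]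
    exact exp_le_exp.2 (by linarith)
  · rw [biquadraticEval_zero_left, hl₁]
    push_cast
    rfl
  · rw [biquadraticEval_zero_right, hl₂]
    push_cast
    rfl
  · rw [biquadraticEval_zero_left, hα]
  · rw [biquadraticEval_zero_right, hβ]

end Reduction

section AlmostSquares

theorem abs_mul_sq_sub_mul_sq_le {N K a b x y : ℕ} (h1 : N ≤ a * x ^ 2) (h2 : a * x ^ 2 ≤ N + K)
    (h3 : N ≤ b * y ^ 2) (h4 : b * y ^ 2 ≤ N + K) : |(a * x ^ 2 - b * y ^ 2 : ℤ)| ≤ K := by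
  zify at h1 h2 h3 h4
  exact abs_le.2 ⟨by linarith, by linarith⟩

theorem le_mul_sq_of_isSquare_mul {N K H a b x y : ℕ} (ha : 0 < a) (haH : a ≤ H) (hx : 0 < x)
    (hab : IsSquare (a * b)) (h1 : N ≤ a * x ^ 2) (h2 : a * x ^ 2 ≤ N + K)
    (h3 : N ≤ b * y ^ 2) (h4 : b * y ^ 2 ≤ N + K) (hne : a * x ^ 2 ≠ b * y ^ 2) :
    N ≤ (H * K) ^ 2 := by
  obtain ⟨f, hf⟩ := hab
  have hK := abs_mul_sq_sub_mul_sq_le h1 h2 h3 h4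
  zify at hf ha hx hne haH
  have e1 : ((a * x + f * y) * (a * x - f * y) : ℤ) = a * (a * x ^ 2 - b * y ^ 2) := by
    linear_combination (y : ℤ) ^ 2 * hf
  have e2 : (a * x - f * y : ℤ) ≠ 0 := by
    intro h
    rw [h, mul_zero, eq_comm, mul_eq_zero] at e1
    rcases e1 with e1 | e1
    · omega
    · exact hne (sub_eq_zero.1 e1)
  have e3 : (a * x + f * y : ℤ) ≤ H * K :=
    calc (a * x + f * y : ℤ) ≤ (a * x + f * y) * |(a * x - f * y : ℤ)| :=
        le_mul_of_one_le_right (by positivity) (Int.one_le_abs e2)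
      _ = |((a * x + f * y) * (a * x - f * y) : ℤ)| := by
        rw [abs_mul, abs_of_nonneg (by positivity : (0 : ℤ) ≤ a * x + f * y)]
      _ = a * |(a * x ^ 2 - b * y ^ 2 : ℤ)| := by rw [e1, abs_mul, Nat.abs_cast]
      _ ≤ H * K := by gcongr
  have e4 : (a * x : ℤ) ≤ H * K := le_trans (le_add_of_nonneg_right (by positivity)) e3
  have e5 : a * x ≤ H * K := by exact_mod_cast e4
  calc N ≤ a * x ^ 2 := h1
    _ ≤ a ^ 2 * x ^ 2 := by
      gcongr
      exact Nat.le_self_pow (by norm_num) a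
    _ = (a * x) ^ 2 := by ring
    _ ≤ (H * K) ^ 2 := by gcongr

theorem isSquare_of_sq_mul {a b : ℕ} (ha : 0 < a) (h : IsSquare (a ^ 2 * b)) : IsSquare b := by
  obtain ⟨r, hr⟩ := h
  rw [← sq] at hr
  obtain ⟨t, rfl⟩ := (Nat.pow_dvd_pow_iff two_ne_zero).1 (Dvd.intro b hr)
  refine ⟨t, Nat.eq_of_mul_eq_mul_left (pow_pos ha 2) (hr.trans (by ring))⟩

theorem one_lt_log_natCast {n : ℕ} (hn : 3 ≤ n) : 1 < log (n : ℝ) := by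
  have h : (3 : ℝ) ≤ n := by exact_mod_cast hn
  rw [lt_log_iff_exp_lt (by linarith)]
  exact exp_one_lt_three.trans_le h

theorem exists_pell_log_le : ∃ C : ℝ, 0 < C ∧ ∀ {d H : ℕ} (_ : 3 ≤ H) (_ : d ≤ H ^ 2)
    (_ : Squarefree d) (_ : ¬IsSquare d), ∃ (u v : ℕ) (l : ℝ), 0 < u ∧ 0 < v ∧
      u ^ 2 = d * v ^ 2 + 1 ∧ exp l = u + v * √d ∧ 1 ≤ l ∧ l ≤ C * (H * log H) := by
  obtain ⟨C, hC, key⟩ := exists_small_pell_solution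
  refine ⟨3 * C, by positivity, ?_⟩
  intro d H hH hdH hsf hsq
  have hd1 : 1 < d := by
    have h0 : d ≠ 0 := hsf.ne_zero
    have h1 : d ≠ 1 := fun h => hsq (h ▸ IsSquare.one)
    omega
  obtain ⟨u, v, hu, hv, huv, hl⟩ := key d hd1 hsf hsq
  have hL := one_lt_log_natCast hH
  have hd1R : (1 : ℝ) ≤ d := by exact_mod_cast hd1.le
  have hdR : (d : ℝ) ≤ (H : ℝ) ^ 2 := by exact_mod_cast hdH
  have hs1 : 1 ≤ √(d : ℝ) := one_le_sqrt.2 hd1R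
  have hv1 : (1 : ℝ) ≤ v := by exact_mod_cast hv
  have hu2 : 2 ≤ u := by nlinarith [Nat.mul_le_mul hd1.le (Nat.one_le_pow 2 v hv)]
  have hu2R : (2 : ℝ) ≤ u := by exact_mod_cast hu2
  have hε : (3 : ℝ) ≤ u + v * √d := by
    linarith [one_le_mul_of_one_le_of_one_le hv1 hs1]
  refine ⟨u, v, log (u + v * √d), hu, hv, huv, exp_log (by linarith), ?_, hl.trans ?_⟩
  · rw [le_log_iff_exp_le (by linarith)]
    exact exp_one_lt_three.le.trans hε
  · have h1 : √(d : ℝ) ≤ H := sqrt_le_left (by positivity) |>.2 hdR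
    have h2 : log (d : ℝ) ≤ 2 * log H := by
      refine (log_le_log (by linarith) hdR).trans_eq ?_
      rw [log_pow]
      push_cast
      ring
    calc C * (√(d : ℝ) * (1 + log d)) ≤ C * (H * (log H + 2 * log H)) := by
          have : 0 ≤ log (d : ℝ) := log_nonneg hd1R
          gcongr
      _ = _ := by ring

theorem exists_sq_mul_of_not_isSquare {n : ℕ} (hn : ¬IsSquare n) :
    ∃ f d : ℕ, f ^ 2 * d = n ∧ Squarefree d ∧ ¬IsSquare d ∧ d ≤ n := by
  obtain ⟨d, f, hfd, hd⟩ := Nat.sq_mul_squarefree n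
  refine ⟨f, d, hfd, hd, ?_, ?_⟩
  · rintro ⟨r, rfl⟩
    exact hn ⟨f * r, by rw [← hfd]; ring⟩
  · have : f ≠ 0 := by
      rintro rfl
      exact hn (by rw [← hfd]; simp)
    rw [← hfd]
    exact Nat.le_mul_of_pos_left _ (by positivity)

theorem abs_conj_mul_le {N K H a b x y f d : ℕ} (haH : a ≤ H) (hf : f ^ 2 * d = a * b)
    (h1 : N ≤ a * x ^ 2) (h2 : a * x ^ 2 ≤ N + K) (h3 : N ≤ b * y ^ 2) (h4 : b * y ^ 2 ≤ N + K) :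
    |(((a * x : ℕ) : ℝ) + (y * f : ℕ) * √d) * ((a * x : ℕ) - (y * f : ℕ) * √d)| ≤ (H * K : ℕ) := by
  have hK := abs_mul_sq_sub_mul_sq_le h1 h2 h3 h4
  have hK' : |(a * x ^ 2 - b * y ^ 2 : ℝ)| ≤ K := by exact_mod_cast hK
  have hf' : (f : ℝ) ^ 2 * d = a * b := by exact_mod_cast hf
  have hs : √(d : ℝ) ^ 2 = d := sq_sqrt d.cast_nonneg
  have e : (((a * x : ℕ) : ℝ) + (y * f : ℕ) * √d) * ((a * x : ℕ) - (y * f : ℕ) * √d) =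
      a * (a * x ^ 2 - b * y ^ 2) := by
    push_cast
    linear_combination (-(y : ℝ) ^ 2 * f ^ 2) * hs - (y : ℝ) ^ 2 * hf'
  rw [e, abs_mul, Nat.abs_cast]
  push_cast
  gcongr

theorem log_le_of_three_almost_squares : ∃ C : ℝ, 4 ≤ C ∧
    ∀ {N K H a₁ a₂ a₃ x₁ x₂ x₃ : ℕ} (_ : 0 < N) (_ : 3 ≤ K) (_ : 3 ≤ H)
    (_ : 0 < a₁) (_ : 0 < a₂) (_ : 0 < x₁) (_ : 0 < x₂)
    (_ : a₁ ≤ H) (_ : a₂ ≤ H) (_ : a₃ ≤ H)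
    (_ : N ≤ a₁ * x₁ ^ 2) (_ : a₁ * x₁ ^ 2 ≤ N + K)
    (_ : N ≤ a₂ * x₂ ^ 2) (_ : a₂ * x₂ ^ 2 ≤ N + K)
    (_ : N ≤ a₃ * x₃ ^ 2) (_ : a₃ * x₃ ^ 2 ≤ N + K)
    (_ : a₁ * x₁ ^ 2 ≠ a₂ * x₂ ^ 2) (_ : a₁ * x₁ ^ 2 ≠ a₃ * x₃ ^ 2)
    (_ : a₂ * x₂ ^ 2 ≠ a₃ * x₃ ^ 2),
    log N ≤ C * ((H : ℝ) ^ 2 * log H ^ 2 * (H * log H + log K)) := by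
  obtain ⟨C₁, hC₁, hpell⟩ := exists_pell_log_le
  obtain ⟨C₂, hC₂, hmain⟩ := log_le_of_pell_solutions
  refine ⟨4 + 2 * (C₂ * (C₁ ^ 2 * (2 * C₁ + 1))), le_add_of_nonneg_right (by positivity), ?_⟩
  intro N K H a₁ a₂ a₃ x₁ x₂ x₃ hN hK hH ha₁ ha₂ hx₁ hx₂ hH₁ hH₂ hH₃ h₁ h₁' h₂ h₂' h₃ h₃'
    h₁₂ h₁₃ h₂₃
  have hL := one_lt_log_natCast hH
  have hk := one_lt_log_natCast hK
  have hHR : (3 : ℝ) ≤ H := by exact_mod_cast hH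
  have hKR : (3 : ℝ) ≤ K := by exact_mod_cast hK
  have hNR : (0 : ℝ) < N := by exact_mod_cast hN
  have hHL : log H ≤ H * log H := le_mul_of_one_le_left (by linarith) (by linarith)
  have hlogM : log ((H * K : ℕ) : ℝ) = log H + log K := by
    push_cast
    rw [log_mul (by linarith) (by linarith)]
  have hM9 : (9 : ℝ) ≤ (H * K : ℕ) := by
    have : 3 * 3 ≤ H * K := Nat.mul_le_mul hH hK
    exact_mod_cast this
  have hfac : (1 : ℝ) ≤ (H : ℝ) ^ 2 * log H ^ 2 :=
    one_le_mul_of_one_le_of_one_le (one_le_pow₀ (by linarith)) (one_le_pow₀ hL.le)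
  have htriv (h : (N : ℝ) ≤ ((H * K : ℕ) : ℝ) ^ 4) : log N ≤
      (4 + 2 * (C₂ * (C₁ ^ 2 * (2 * C₁ + 1)))) *
        ((H : ℝ) ^ 2 * log H ^ 2 * (H * log H + log K)) := by
    calc log N ≤ log (((H * K : ℕ) : ℝ) ^ 4) := log_le_log hNR h
      _ = 4 * (1 * (log H + log K)) := by
        rw [log_pow, hlogM]
        push_cast
        ring
      _ ≤ _ := by
        gcongr
        exact le_add_of_nonneg_right (by positivity)
  have hsq (h : N ≤ (H * K) ^ 2) : (N : ℝ) ≤ ((H * K : ℕ) : ℝ) ^ 4 := by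
    have h' : (N : ℝ) ≤ ((H * K : ℕ) : ℝ) ^ 2 := by exact_mod_cast h
    exact h'.trans (pow_le_pow_right₀ (by linarith) (by norm_num))
  by_cases s₁₂ : IsSquare (a₁ * a₂)
  · exact htriv (hsq (le_mul_sq_of_isSquare_mul ha₁ hH₁ hx₁ s₁₂ h₁ h₁' h₂ h₂' h₁₂))
  by_cases s₁₃ : IsSquare (a₁ * a₃)
  · exact htriv (hsq (le_mul_sq_of_isSquare_mul ha₁ hH₁ hx₁ s₁₃ h₁ h₁' h₃ h₃' h₁₃))
  by_cases s₂₃ : IsSquare (a₂ * a₃)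
  · exact htriv (hsq (le_mul_sq_of_isSquare_mul ha₂ hH₂ hx₂ s₂₃ h₂ h₂' h₃ h₃' h₂₃))
  have hNw : N ≤ (a₁ * x₁) ^ 2 := by
    refine h₁.trans ?_
    rw [mul_pow]
    gcongr
    exact Nat.le_self_pow (by norm_num) a₁
  have hNw' : (N : ℝ) ≤ ((a₁ * x₁ : ℕ) : ℝ) ^ 2 := by exact_mod_cast hNw
  by_cases hw : 2 * ((H * K : ℕ) : ℝ) ≤ (a₁ * x₁ : ℕ)
  swap
  · refine htriv (hNw'.trans ?_)
    calc ((a₁ * x₁ : ℕ) : ℝ) ^ 2 ≤ (2 * ((H * K : ℕ) : ℝ)) ^ 2 := by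
          gcongr
          exact (not_le.1 hw).le
      _ ≤ (((H * K : ℕ) : ℝ) ^ 2) ^ 2 := by
          gcongr
          nlinarith
      _ = _ := by ring
  obtain ⟨f₁, d₁, hfd₁, hsf₁, hd₁, hle₁⟩ := exists_sq_mul_of_not_isSquare s₁₂
  obtain ⟨f₂, d₂, hfd₂, hsf₂, hd₂, hle₂⟩ := exists_sq_mul_of_not_isSquare s₁₃
  have hd₁₂ : ¬IsSquare (d₁ * d₂) := by
    rintro ⟨r, hr⟩
    refine s₂₃ (isSquare_of_sq_mul ha₁ ⟨f₁ * f₂ * r, ?_⟩)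
    calc a₁ ^ 2 * (a₂ * a₃) = (a₁ * a₂) * (a₁ * a₃) := by ring
      _ = f₁ ^ 2 * f₂ ^ 2 * (d₁ * d₂) := by rw [← hfd₁, ← hfd₂]; ring
      _ = _ := by rw [hr]; ring
  have hdH₁ : d₁ ≤ H ^ 2 := hle₁.trans (by rw [sq]; gcongr)
  have hdH₂ : d₂ ≤ H ^ 2 := hle₂.trans (by rw [sq]; gcongr)
  obtain ⟨u₁, v₁, l₁, hu₁, hv₁, hp₁, he₁, hl₁, hlb₁⟩ := hpell hH hdH₁ hsf₁ hd₁
  obtain ⟨u₂, v₂, l₂, hu₂, hv₂, hp₂, he₂, hl₂, hlb₂⟩ := hpell hH hdH₂ hsf₂ hd₂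
  have hb := hmain hd₁ hd₂ hd₁₂ hu₁ hv₁ hu₂ hv₂ hp₁ hp₂ he₁ he₂ hl₁ hl₂ hM9 hw
    (abs_conj_mul_le hH₁ hfd₁ h₁ h₁' h₂ h₂') (abs_conj_mul_le hH₁ hfd₂ h₁ h₁' h₃ h₃')
  rw [hlogM] at hb
  have hN2 : log N ≤ 2 * log (a₁ * x₁ : ℕ) := by
    refine (log_le_log hNR hNw').trans_eq ?_
    rw [log_pow]
    push_cast
    ring
  have hsum : l₁ + l₂ + (log H + log K) ≤ (2 * C₁ + 1) * (H * log H + log K) := by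
    have : 0 ≤ C₁ * log K := by positivity
    linarith
  calc log N ≤ 2 * log (a₁ * x₁ : ℕ) := hN2
    _ ≤ 2 * (C₂ * (l₁ * l₂ * (l₁ + l₂ + (log H + log K)))) := by gcongr
    _ ≤ 2 * (C₂ * ((C₁ * (H * log H)) * (C₁ * (H * log H)) *
        ((2 * C₁ + 1) * (H * log H + log K)))) := by gcongr
    _ = 2 * (C₂ * (C₁ ^ 2 * (2 * C₁ + 1))) * (H ^ 2 * log H ^ 2 * (H * log H + log K)) := by ring
    _ ≤ _ := by
      gcongr
      linarith

end AlmostSquares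

/-- Turk's theorem: an interval `[N, N+K]` cannot contain three distinct integers of the
form `a * x ^ 2` with small `a` unless `N` is suitably bounded. -/
theorem turk_three_almost_squares :
    ∃ C : ℝ, 0 < C ∧
      ∀ (N K : ℕ) (a₁ a₂ a₃ x₁ x₂ x₃ : ℕ),
        0 < N → 3 ≤ K →
        0 < a₁ → 0 < a₂ → 0 < a₃ → 0 < x₁ → 0 < x₂ → 0 < x₃ →
        N ≤ a₁ * x₁ ^ 2 → a₁ * x₁ ^ 2 ≤ N + K →
        N ≤ a₂ * x₂ ^ 2 → a₂ * x₂ ^ 2 ≤ N + K →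
        N ≤ a₃ * x₃ ^ 2 → a₃ * x₃ ^ 2 ≤ N + K →
        a₁ * x₁ ^ 2 ≠ a₂ * x₂ ^ 2 → a₁ * x₁ ^ 2 ≠ a₃ * x₃ ^ 2 →
        a₂ * x₂ ^ 2 ≠ a₃ * x₃ ^ 2 →
        let H : ℝ := max (max (a₁ : ℝ) (a₂ : ℝ)) (max (a₃ : ℝ) 3)
        C * H ^ 2 * (Real.log H) ^ 3 * (H * Real.log H + Real.log K) *
            (Real.log H + Real.log (Real.log K)) > Real.log N := by
  obtain ⟨C, hC, key⟩ := log_le_of_three_almost_squares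
  refine ⟨C, by linarith, ?_⟩
  intro N K a₁ a₂ a₃ x₁ x₂ x₃ hN hK ha₁ ha₂ _ hx₁ hx₂ _ h₁ h₁' h₂ h₂' h₃ h₃' h₁₂ h₁₃ h₂₃ H
  set n : ℕ := max (max a₁ a₂) (max a₃ 3) with hn
  have hHn : H = n := by
    rw [hn]
    push_cast
    rfl
  have h := key hN hK (H := n) (by omega) ha₁ ha₂ hx₁ hx₂ (by omega) (by omega) (by omega)
    h₁ h₁' h₂ h₂' h₃ h₃' h₁₂ h₁₃ h₂₃
  have hL : 1 < log (n : ℝ) := one_lt_log_natCast (by omega)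
  have hk : 1 < log (K : ℝ) := one_lt_log_natCast hK
  have hkk : 0 < log (log (K : ℝ)) := log_pos hk
  have hn0 : (0 : ℝ) < n := by
    have : 0 < n := by omega
    exact_mod_cast this
  rw [hHn, gt_iff_lt]
  set B := C * ((n : ℝ) ^ 2 * log n ^ 2 * (n * log n + log K)) with hB
  have hB0 : 0 < B := by positivity
  calc log N ≤ B := h
    _ < B * (log n * (log n + log (log K))) :=
      lt_mul_of_one_lt_right hB0 (one_lt_mul_of_lt_of_le hL (by linarith))
    _ = _ := by rw [hB]; ring
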